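/- For every integer n ≥ 0 the following crank inequalities hold: 11·M(0,11,11n) ≥ p(11n) ≥ 11·M(1,11,11n); 11·M(1,11,11n+1) ≥ p(11n+1) ≥ 11·M(2,11,11n+1) ≥ 11·M(0,11,11n+1); 11·M(2,11,11n+2) ≥ p(11n+2) ≥ 11·M(0,11,11n+2); 11·M(0,11,11n+3) ≥ p(11n+3) ≥ 11·M(1,11,11n+3); 11·M(0,11,11n+4) ≥ p(11n+4) ≥ 11·M(1,11,11n+4); 11·M(0,11,11n+5) ≥ p(11n+5) ≥ 11·M(2,11,11n+5); 11·M(1,11,11n+7) ≥ p(11n+7) ≥ 11·M(0,11,11n+7); 11·M(1,11,11n+9) ≥ p(11n+9) ≥ 11·M(0,11,11n+9); and 11·M(0,11,11n+10) ≥ p(11n+10) ≥ 11·M(3,11,11n+10). -/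

import Mathlib

/-- `p n`: the number of partitions of `n`. -/
def partitionCount (n : ℕ) : ℕ := Fintype.card (Nat.Partition n)

/-- The rank of a partition: its largest part minus its number of parts
(the empty partition has rank 0). -/
def partitionRank {n : ℕ} (π : Nat.Partition n) : ℤ :=
  (π.parts.sup : ℤ) - (Multiset.card π.parts : ℤ)

/-- The crank of a partition `π`: if `π` has no parts equal to 1, it is the largest part;
otherwise it is (number of parts larger than the number of ones) − (number of ones). -/
def partitionCrank {n : ℕ} (π : Nat.Partition n) : ℤ :=
  if π.parts.count 1 = 0 then (π.parts.sup : ℤ)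
  else ((π.parts.filter fun x => π.parts.count 1 < x).card : ℤ) - (π.parts.count 1 : ℤ)

/-- `rankCount a r n` = `N(a,r,n)`: the number of partitions of `n` whose rank is
congruent to `a` modulo `r`. -/
def rankCount (a r : ℤ) (n : ℕ) : ℕ :=
  (Finset.univ.filter fun π : Nat.Partition n => partitionRank π % r = a % r).card

/-- `crankCount a n` = `M(a,11,n)`: for `n ≠ 1`, the number of partitions of `n` whose crank
is congruent to `a` modulo 11; at `n = 1` the standard convention `M(0,11,1) = −1`,
`M(1,11,1) = M(10,11,1) = 1`, and `M(a,11,1) = 0` otherwise. -/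
def crankCount (a : ℤ) (n : ℕ) : ℤ :=
  if n = 1 then
    if a % 11 = 0 then -1
    else if a % 11 = 1 ∨ a % 11 = 10 then 1
    else 0
  else ((Finset.univ.filter fun π : Nat.Partition n => partitionCrank π % 11 = a % 11).card : ℤ)

open Filter Topology

section QBinomial

/-- The `q`-binomial theorem, in terms of the recursion for the coefficients of the series. -/
theorem tsum_mul_eq_of_qbinomial_recursion {R : Type*} [CommRing R] [TopologicalSpace R]
    [IsTopologicalRing R] [T2Space R] {q α β A B : R} {t : ℕ → R}
    (ht : ∀ n, t (n + 1) * (1 - q ^ (n + 1)) = t n * (α - β * q ^ n))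
    (hs : ∀ N, Summable fun n => t n * q ^ (n * N))
    (hl : Tendsto (fun N : ℕ => ∑' n, t n * q ^ (n * N)) atTop (𝓝 1))
    (hA : Tendsto (fun N : ℕ => ∏ i ∈ Finset.range N, (1 - α * q ^ i)) atTop (𝓝 A))
    (hB : Tendsto (fun N : ℕ => ∏ i ∈ Finset.range N, (1 - β * q ^ i)) atTop (𝓝 B)) :
    (∑' n, t n) * A = B := by
  have hrec (N : ℕ) : (∑' n, t n * q ^ (n * N)) * (1 - α * q ^ N) =
      (∑' n, t n * q ^ (n * (N + 1))) * (1 - β * q ^ N) := by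
    have h1 : (∑' n, t n * q ^ (n * N)) - ∑' n, t n * q ^ (n * (N + 1)) =
        ∑' n, t n * q ^ (n * N) * (1 - q ^ n) := by
      rw [← (hs N).tsum_sub (hs (N + 1))]
      exact tsum_congr fun n => by ring
    have hsub : Summable fun n => t n * q ^ (n * N) * (1 - q ^ n) :=
      ((hs N).sub (hs (N + 1))).congr fun n => by ring
    have h2 : (∑' n, t n * q ^ (n * N) * (1 - q ^ n)) =
        ∑' n, t (n + 1) * q ^ ((n + 1) * N) * (1 - q ^ (n + 1)) := by
      rw [hsub.tsum_eq_zero_add]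
      simp
    have h3 : (∑' n, t (n + 1) * q ^ ((n + 1) * N) * (1 - q ^ (n + 1))) =
        (α * (∑' n, t n * q ^ (n * N)) - β * ∑' n, t n * q ^ (n * (N + 1))) * q ^ N := by
      rw [← (hs N).tsum_mul_left, ← (hs (N + 1)).tsum_mul_left,
        ← ((hs N).mul_left α).tsum_sub ((hs (N + 1)).mul_left β),
        ← Summable.tsum_mul_right (q ^ N) (((hs N).mul_left α).sub ((hs (N + 1)).mul_left β))]
      exact tsum_congr fun n => by linear_combination q ^ ((n + 1) * N) * ht n
    linear_combination h1 + h2 + h3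
  have hfin (N : ℕ) : (∑' n, t n) * ∏ i ∈ Finset.range N, (1 - α * q ^ i) =
      (∑' n, t n * q ^ (n * N)) * ∏ i ∈ Finset.range N, (1 - β * q ^ i) := by
    induction N with
    | zero => simp
    | succ N ih =>
      rw [Finset.prod_range_succ, Finset.prod_range_succ]
      linear_combination (1 - α * q ^ N) * ih +
        (∏ i ∈ Finset.range N, (1 - β * q ^ i)) * hrec N
  have h4 := (tendsto_const_nhds (x := ∑' n, t n)).mul hA
  have h5 := hl.mul hB
  rw [one_mul] at h5
  exact tendsto_nhds_unique h4 (h5.congr fun N => (hfin N).symm)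

end QBinomial

section QPochhammer

/-- The infinite `q`-Pochhammer symbol `∏ (1 - z q ^ i)`. -/
noncomputable def qPoch (q z : ℂ) : ℂ := ∏' i : ℕ, (1 - z * q ^ i)

variable {q : ℂ}

theorem summable_norm_neg_mul_pow (hq : ‖q‖ < 1) (z : ℂ) :
    Summable fun i : ℕ => ‖-(z * q ^ i)‖ := by
  simpa [norm_mul, norm_pow] using
    (summable_geometric_of_lt_one (norm_nonneg q) hq).mul_left ‖z‖

theorem multipliable_qPoch (hq : ‖q‖ < 1) (z : ℂ) :
    Multipliable fun i : ℕ => (1 - z * q ^ i) := by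
  simpa [sub_eq_add_neg] using multipliable_one_add_of_summable (summable_norm_neg_mul_pow hq z)

theorem tendsto_qPoch (hq : ‖q‖ < 1) (z : ℂ) :
    Tendsto (fun N : ℕ => ∏ i ∈ Finset.range N, (1 - z * q ^ i)) atTop (𝓝 (qPoch q z)) :=
  (multipliable_qPoch hq z).hasProd.tendsto_prod_nat

theorem qPoch_ne_zero (hq : ‖q‖ < 1) {z : ℂ} (h : ∀ i : ℕ, 1 - z * q ^ i ≠ 0) :
    qPoch q z ≠ 0 := by
  have := tprod_one_add_ne_zero_of_summable (f := fun i : ℕ => -(z * q ^ i))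
    (by simpa [sub_eq_add_neg] using h) (summable_norm_neg_mul_pow hq z)
  simpa [qPoch, sub_eq_add_neg] using this

theorem one_sub_ne_zero_of_norm_lt_one {w : ℂ} (hw : ‖w‖ < 1) : 1 - w ≠ 0 := by
  intro h
  rw [sub_eq_zero] at h
  rw [← h] at hw
  simp at hw

theorem qPoch_ne_zero_of_norm_lt_one (hq : ‖q‖ < 1) {z : ℂ} (hz : ‖z‖ < 1) :
    qPoch q z ≠ 0 := by
  refine qPoch_ne_zero hq fun i => one_sub_ne_zero_of_norm_lt_one ?_
  rw [norm_mul, norm_pow]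
  exact mul_lt_one_of_nonneg_of_lt_one_left (norm_nonneg _) hz
    (pow_le_one₀ (norm_nonneg _) hq.le)

theorem qPoch_eq_mul (hq : ‖q‖ < 1) (z : ℂ) : qPoch q z = (1 - z) * qPoch q (z * q) := by
  refine tendsto_nhds_unique ((tendsto_qPoch hq z).comp (tendsto_add_atTop_nat 1)) ?_
  refine ((tendsto_qPoch hq (z * q)).const_mul (1 - z)).congr fun N => ?_
  simp only [Function.comp]
  rw [Finset.prod_range_succ']
  simp only [pow_zero, mul_one]
  rw [mul_comm]
  congr 1
  exact Finset.prod_congr rfl fun i _ => by ring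

theorem summable_norm_of_qbinomial_recursion (hq : ‖q‖ < 1) {α β : ℂ} (hα : ‖α‖ < 1) {t : ℕ → ℂ}
    (ht : ∀ n, t (n + 1) * (1 - q ^ (n + 1)) = t n * (α - β * q ^ n)) :
    Summable fun n => ‖t n‖ := by
  obtain ⟨r, hr, hr1⟩ := exists_between hα
  have hlim : Tendsto (fun n : ℕ => ‖(α - β * q ^ n) / (1 - q ^ (n + 1))‖) atTop (𝓝 ‖α‖) := by
    have h1 : Tendsto (fun n : ℕ => q ^ n) atTop (𝓝 0) :=
      tendsto_pow_atTop_nhds_zero_of_norm_lt_one hq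
    have h2 := (tendsto_add_atTop_iff_nat 1).2 h1
    have h3 := (((h1.const_mul β).const_sub α).div (h2.const_sub 1) (by simp)).norm
    simpa using h3
  have hev : ∀ᶠ n in atTop, ‖t (n + 1)‖ ≤ r * ‖t n‖ := by
    filter_upwards [hlim.eventually (gt_mem_nhds hr)] with n hn
    have hne : (1 - q ^ (n + 1)) ≠ 0 := by
      refine one_sub_ne_zero_of_norm_lt_one ?_
      rw [norm_pow]
      exact pow_lt_one₀ (norm_nonneg _) hq (by simp)
    have : t (n + 1) = (α - β * q ^ n) / (1 - q ^ (n + 1)) * t n := by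
      field_simp
      linear_combination ht n
    rw [this, norm_mul]
    exact mul_le_mul_of_nonneg_right hn.le (norm_nonneg _)
  refine summable_of_ratio_norm_eventually_le (r := r) hr1 (f := fun n => ‖t n‖) ?_
  simpa using hev

theorem tsum_mul_qPoch (hq : ‖q‖ < 1) {α β : ℂ} (hα : ‖α‖ < 1) {t : ℕ → ℂ} (h0 : t 0 = 1)
    (ht : ∀ n, t (n + 1) * (1 - q ^ (n + 1)) = t n * (α - β * q ^ n)) :
    (∑' n, t n) * qPoch q α = qPoch q β := by
  have hs := summable_norm_of_qbinomial_recursion hq hα ht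
  have hbd (N n : ℕ) : ‖t n * q ^ (n * N)‖ ≤ ‖t n‖ := by
    rw [norm_mul, norm_pow]
    exact mul_le_of_le_one_right (norm_nonneg _) (pow_le_one₀ (norm_nonneg _) hq.le)
  refine tsum_mul_eq_of_qbinomial_recursion ht (fun N => ?_) ?_ (tendsto_qPoch hq α)
    (tendsto_qPoch hq β)
  · exact Summable.of_norm_bounded hs (hbd N)
  · have h := tendsto_tsum_of_dominated_convergence (𝓕 := (atTop : Filter ℕ))
      (f := fun N n => t n * q ^ (n * N)) (g := fun n => if n = 0 then 1 else 0) hs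
      (fun n => ?_) (Eventually.of_forall fun N n => hbd N n)
    · simpa using h
    · rcases eq_or_ne n 0 with rfl | hn
      · simp [h0]
      · simp only [hn, if_false]
        have : Tendsto (fun N : ℕ => (q ^ n) ^ N) atTop (𝓝 0) :=
          tendsto_pow_atTop_nhds_zero_of_norm_lt_one
            (by rw [norm_pow]; exact pow_lt_one₀ (norm_nonneg _) hq hn)
        simpa [pow_mul] using this.const_mul (t n)

/-- Limit of shifted one-sided sums of a summable bilateral sequence. -/
theorem tendsto_tsum_shift {f : ℤ → ℂ} (hf : Summable fun n => ‖f n‖) {w : ℕ → ℂ} {W : ℂ}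
    (hw : Tendsto w atTop (𝓝 W)) :
    Tendsto (fun M : ℕ => ∑' k : ℕ, f ((k : ℤ) - M) * w k) atTop (𝓝 ((∑' n, f n) * W)) := by
  obtain ⟨C, hC⟩ := hw.norm.bddAbove_range
  have hC' (k : ℕ) : ‖w k‖ ≤ C := hC ⟨k, rfl⟩
  have hC0 : 0 ≤ C := (norm_nonneg _).trans (hC' 0)
  let g : ℕ → ℤ → ℂ := fun M n => f n * (if 0 ≤ n + M then w (n + M).toNat else 0)
  have hg (M : ℕ) : ∑' k : ℕ, f ((k : ℤ) - M) * w k = ∑' n, g M n := by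
    have hinj : Function.Injective fun k : ℕ => (k : ℤ) - M := fun a b h => by
      simpa using h
    rw [← hinj.tsum_eq (f := g M)]
    · refine tsum_congr fun k => ?_
      simp [g]
    · intro n hn
      have : 0 ≤ n + M := by
        by_contra h
        exact hn (by simp only [g, h, if_false, mul_zero])
      exact ⟨(n + M).toNat, by simp [this]⟩
  simp_rw [hg]
  rw [← tsum_mul_right]
  refine tendsto_tsum_of_dominated_convergence (bound := fun n => ‖f n‖ * C) (hf.mul_right C)
    (fun n => ?_) (Eventually.of_forall fun M n => ?_)
  · refine Tendsto.const_mul _ ?_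
    have ht : Tendsto (fun M : ℕ => (n + M).toNat) atTop atTop := by
      refine tendsto_atTop_atTop.2 fun b => ⟨b + n.natAbs, fun M hM => ?_⟩
      omega
    refine (hw.comp ht).congr' ?_
    filter_upwards [eventually_ge_atTop n.natAbs] with M hM
    have : 0 ≤ n + M := by omega
    simp [this]
  · simp only [g]
    rw [norm_mul]
    refine mul_le_mul_of_nonneg_left ?_ (norm_nonneg _)
    split_ifs
    · exact hC' _
    · simpa using hC0

end QPochhammer

section Lambert

variable {q : ℂ}

theorem tsum_lambert_mul_qPoch (hq : ‖q‖ < 1) {a b : ℂ} (hb : ‖b‖ < 1)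
    (ha : ∀ i : ℕ, 1 - a * q ^ i ≠ 0) {t : ℕ → ℂ} (h0 : t 0 = 1)
    (ht : ∀ n, t (n + 1) * (1 - q ^ (n + 1)) = t n * (b - q * q ^ n)) :
    (∑' k, t k / (1 - a * q ^ k)) * (qPoch q a * qPoch q b) = qPoch q (a * b) * qPoch q q := by
  have hs := summable_norm_of_qbinomial_recursion hq hb ht
  have hlim1 : Tendsto (fun k : ℕ => (1 - a * q ^ k)⁻¹) atTop (𝓝 1) := by
    have h1 : Tendsto (fun n : ℕ => q ^ n) atTop (𝓝 0) :=
      tendsto_pow_atTop_nhds_zero_of_norm_lt_one hq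
    have h2 := ((h1.const_mul a).const_sub 1).inv₀ (by simp)
    simpa using h2
  obtain ⟨C, hC⟩ := hlim1.norm.bddAbove_range
  have hC' (k : ℕ) : ‖(1 - a * q ^ k)⁻¹‖ ≤ C := hC ⟨k, rfl⟩
  have hbd (N k : ℕ) : ‖t k / (1 - a * q ^ (k + N))‖ ≤ ‖t k‖ * C := by
    rw [div_eq_mul_inv, norm_mul]
    exact mul_le_mul_of_nonneg_left (hC' _) (norm_nonneg _)
  have hsN (N : ℕ) : Summable fun k => t k / (1 - a * q ^ (k + N)) :=
    Summable.of_norm_bounded (hs.mul_right C) (hbd N)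
  have hst : Summable t := hs.of_norm
  have hrec (N : ℕ) : (∑' k, t k / (1 - a * q ^ (k + N))) * (1 - a * q ^ N) =
      (1 - a * b * q ^ N) * ∑' k, t k / (1 - a * q ^ (k + (N + 1))) := by
    have e1 (k : ℕ) : t k / (1 - a * q ^ (k + N)) * (1 - a * q ^ N) =
        t k - a * q ^ N * (t k * (1 - q ^ k) / (1 - a * q ^ (k + N))) := by
      have := ha (k + N)
      field_simp
      ring
    have hs2 : Summable fun k => t k * (1 - q ^ k) / (1 - a * q ^ (k + N)) := by
      refine Summable.of_norm_bounded ((hs.mul_right C).mul_right 2) fun k => ?_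
      rw [mul_div_right_comm, norm_mul]
      refine mul_le_mul (hbd N k) ?_ (norm_nonneg _) ((norm_nonneg _).trans (hbd N k))
      refine (norm_sub_le _ _).trans ?_
      rw [norm_one, norm_pow]
      linarith [pow_le_one₀ (n := k) (norm_nonneg _) hq.le]
    have e2 (k : ℕ) : t (k + 1) * (1 - q ^ (k + 1)) / (1 - a * q ^ (k + 1 + N)) =
        t k * (b - q * q ^ k) / (1 - a * q ^ (k + (N + 1))) := by
      rw [ht, add_assoc, add_comm 1 N]
    have e3 : (∑' k, t k * (1 - q ^ k) / (1 - a * q ^ (k + N))) =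
        ∑' k, t k * (b - q * q ^ k) / (1 - a * q ^ (k + (N + 1))) := by
      rw [hs2.tsum_eq_zero_add]
      simp only [pow_zero, sub_self, mul_zero, zero_div, zero_add]
      exact tsum_congr e2
    have hs3 : Summable fun k => t k * (b - q * q ^ k) / (1 - a * q ^ (k + (N + 1))) :=
      ((summable_nat_add_iff 1).2 hs2).congr e2
    rw [← tsum_mul_right, tsum_congr e1, hst.tsum_sub (hs2.mul_left _), tsum_mul_left, e3,
      ← tsum_mul_left, ← hst.tsum_sub (hs3.mul_left _), ← tsum_mul_left]
    refine tsum_congr fun k => ?_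
    have := ha (k + (N + 1))
    field_simp
    ring
  have hfin (N : ℕ) : (∑' k, t k / (1 - a * q ^ k)) * ∏ i ∈ Finset.range N, (1 - a * q ^ i) =
      (∏ i ∈ Finset.range N, (1 - a * b * q ^ i)) * ∑' k, t k / (1 - a * q ^ (k + N)) := by
    induction N with
    | zero => simp
    | succ N ih =>
      rw [Finset.prod_range_succ, Finset.prod_range_succ]
      linear_combination (1 - a * q ^ N) * ih +
        (∏ i ∈ Finset.range N, (1 - a * b * q ^ i)) * hrec N
  have hl : Tendsto (fun N : ℕ => ∑' k, t k / (1 - a * q ^ (k + N))) atTop (𝓝 (∑' k, t k)) := by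
    refine tendsto_tsum_of_dominated_convergence (hs.mul_right C) (fun k => ?_)
      (Eventually.of_forall fun N k => hbd N k)
    have := (hlim1.comp (tendsto_add_atTop_nat k)).const_mul (t k)
    simp only [mul_one] at this
    refine this.congr fun N => ?_
    simp [div_eq_mul_inv, add_comm]
  have h1 := (tendsto_qPoch hq a).const_mul (∑' k, t k / (1 - a * q ^ k))
  have h2 := (tendsto_qPoch hq (a * b)).mul hl
  have h3 := tendsto_nhds_unique h1 (h2.congr fun N => (hfin N).symm)
  have h4 := tsum_mul_qPoch hq hb h0 ht
  linear_combination qPoch q b * h3 + qPoch q (a * b) * h4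

end Lambert

section Bilateral

variable {q : ℂ}

theorem qPoch_div_pow (hq : ‖q‖ < 1) (hq0 : q ≠ 0) {z : ℂ} (hz : z ≠ 0) (M : ℕ) :
    qPoch q (z / q ^ M) = (∏ i ∈ Finset.range M, (-(q ^ (i + 1))⁻¹)) * z ^ M *
      (∏ i ∈ Finset.range M, (1 - q / z * q ^ i)) * qPoch q z := by
  induction M with
  | zero => simp
  | succ M ih =>
    have h1 : z / q ^ (M + 1) * q = z / q ^ M := by field_simp; ring
    rw [qPoch_eq_mul hq, h1, ih, Finset.prod_range_succ, Finset.prod_range_succ, pow_succ z]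
    have h2 : 1 - z / q ^ (M + 1) = -(q ^ (M + 1))⁻¹ * z * (1 - q / z * q ^ M) := by
      field_simp; ring
    rw [h2]
    ring

/-- The bilateral Lambert series `∑ b ^ n / (1 - a q ^ n)`. -/
noncomputable def lambertSum (q a b : ℂ) : ℂ := ∑' n : ℤ, b ^ n / (1 - a * q ^ n)

theorem one_sub_mul_zpow_ne_zero (hq : ‖q‖ < 1) (hq0 : q ≠ 0) {a : ℂ} (ha : ‖a‖ < 1)
    (ha' : ‖q‖ < ‖a‖) (n : ℤ) : 1 - a * q ^ n ≠ 0 := by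
  have hq0' : 0 < ‖q‖ := norm_pos_iff.2 hq0
  intro h
  have h1 : ‖a‖ * ‖q‖ ^ n = 1 := by
    rw [← norm_zpow, ← norm_mul, ← sub_eq_zero.1 h, norm_one]
  rcases le_or_gt 0 n with hn | hn
  · have : ‖q‖ ^ n ≤ 1 := by
      lift n to ℕ using hn
      rw [zpow_natCast]
      exact pow_le_one₀ hq0'.le hq.le
    nlinarith [norm_nonneg a]
  · have h2 : ‖q‖ ^ (-1 : ℤ) ≤ ‖q‖ ^ n := zpow_le_zpow_right_of_le_one₀ hq0' hq.le (by omega)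
    rw [zpow_neg_one] at h2
    have h3 : 1 < ‖a‖ * ‖q‖⁻¹ := by rwa [← div_eq_mul_inv, one_lt_div hq0']
    nlinarith [norm_nonneg a]

theorem exists_norm_inv_le {u : ℕ → ℂ} {l : ℂ} (hu : Tendsto u atTop (𝓝 l)) (hl : l ≠ 0) :
    ∃ C, ∀ n, ‖(u n)⁻¹‖ ≤ C := by
  obtain ⟨C, hC⟩ := (hu.inv₀ hl).norm.bddAbove_range
  exact ⟨C, fun n => hC ⟨n, rfl⟩⟩

theorem summable_norm_lambertSum (hq : ‖q‖ < 1) (hq0 : q ≠ 0) {a b : ℂ} (ha0 : a ≠ 0)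
    (hb : ‖b‖ < 1) (hb' : ‖q‖ < ‖b‖) : Summable fun n : ℤ => ‖b ^ n / (1 - a * q ^ n)‖ := by
  have hb0 : b ≠ 0 := norm_pos_iff.1 ((norm_nonneg q).trans_lt hb')
  have h1 : Tendsto (fun n : ℕ => q ^ n) atTop (𝓝 0) :=
    tendsto_pow_atTop_nhds_zero_of_norm_lt_one hq
  obtain ⟨C, hC⟩ := exists_norm_inv_le ((h1.const_mul a).const_sub 1) (by simp)
  obtain ⟨D, hD⟩ := exists_norm_inv_le (h1.sub_const a) (by simpa using ha0)
  refine Summable.of_nat_of_neg ?_ ?_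
  · refine Summable.of_nonneg_of_le (fun n => norm_nonneg _) (fun n => ?_)
      ((summable_geometric_of_lt_one (norm_nonneg b) hb).mul_right C)
    rw [zpow_natCast, zpow_natCast, div_eq_mul_inv, norm_mul, norm_pow]
    exact mul_le_mul_of_nonneg_left (hC n) (by positivity)
  · have hqb : ‖q / b‖ < 1 := by
      rw [norm_div, div_lt_one (norm_pos_iff.2 hb0)]; exact hb'
    refine Summable.of_nonneg_of_le (fun n => norm_nonneg _) (fun n => ?_)
      ((summable_geometric_of_lt_one (norm_nonneg _) hqb).mul_right D)
    have : b ^ (-(n : ℤ)) / (1 - a * q ^ (-(n : ℤ))) = (q / b) ^ n * (q ^ n - a)⁻¹ := by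
      have hqn : q ^ n ≠ 0 := pow_ne_zero _ hq0
      rw [zpow_neg, zpow_neg, zpow_natCast, zpow_natCast, div_pow]
      have : (1 - a * (q ^ n)⁻¹) = (q ^ n - a) * (q ^ n)⁻¹ := by field_simp
      rw [this, div_eq_mul_inv, mul_inv, inv_inv]
      ring
    rw [this, norm_mul, norm_pow]
    exact mul_le_mul_of_nonneg_left (hD n) (by positivity)

theorem lambertSum_mul_qPoch (hq : ‖q‖ < 1) (hq0 : q ≠ 0) {a b : ℂ} (ha : ‖a‖ < 1)
    (ha' : ‖q‖ < ‖a‖) (hb : ‖b‖ < 1) (hb' : ‖q‖ < ‖b‖) :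
    lambertSum q a b * (qPoch q a * qPoch q (q / a) * qPoch q b * qPoch q (q / b)) =
      qPoch q q ^ 2 * (qPoch q (a * b) * qPoch q (q / (a * b))) := by
  have ha0 : a ≠ 0 := norm_pos_iff.1 ((norm_nonneg q).trans_lt ha')
  have hb0 : b ≠ 0 := norm_pos_iff.1 ((norm_nonneg q).trans_lt hb')
  have hpa : qPoch q a ≠ 0 := qPoch_ne_zero_of_norm_lt_one hq ha
  have hpb : qPoch q b ≠ 0 := qPoch_ne_zero_of_norm_lt_one hq hb
  have hpq : qPoch q q ≠ 0 := qPoch_ne_zero_of_norm_lt_one hq hq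
  have hqa : ‖q / a‖ < 1 := by rw [norm_div, div_lt_one (norm_pos_iff.2 ha0)]; exact ha'
  have hpqa : qPoch q (q / a) ≠ 0 := qPoch_ne_zero_of_norm_lt_one hq hqa
  let t : ℕ → ℂ := fun k => ∏ i ∈ Finset.range k, ((b - q * q ^ i) / (1 - q * q ^ i))
  have hne (i : ℕ) : 1 - q * q ^ i ≠ 0 := by
    refine one_sub_ne_zero_of_norm_lt_one ?_
    rw [← pow_succ', norm_pow]
    exact pow_lt_one₀ (norm_nonneg _) hq (by simp)
  have ht (n : ℕ) : t (n + 1) * (1 - q ^ (n + 1)) = t n * (b - q * q ^ n) := by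
    simp only [t, Finset.prod_range_succ]
    have := hne n
    rw [pow_succ']
    field_simp
  let w : ℕ → ℂ := fun k => (∏ i ∈ Finset.range k, (1 - q / b * q ^ i)) /
    ∏ i ∈ Finset.range k, (1 - q * q ^ i)
  have hw : Tendsto w atTop (𝓝 (qPoch q (q / b) / qPoch q q)) :=
    (tendsto_qPoch hq _).div (tendsto_qPoch hq _) hpq
  have htw (k : ℕ) : t k = b ^ k * w k := by
    simp only [t, w, Finset.prod_div_distrib, mul_div_assoc']
    congr 1
    rw [← Finset.card_range k, ← Finset.prod_const, Finset.card_range, ← Finset.prod_mul_distrib]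
    exact Finset.prod_congr rfl fun i _ => by field_simp
  have hlim := tendsto_tsum_shift (summable_norm_lambertSum hq hq0 ha0 hb hb') hw
  have hM (M : ℕ) : (∑' k : ℕ, b ^ ((k : ℤ) - M) / (1 - a * q ^ ((k : ℤ) - M)) * w k) *
      (qPoch q a * qPoch q b * ∏ i ∈ Finset.range M, (1 - q / a * q ^ i)) =
      (∏ i ∈ Finset.range M, (1 - q / (a * b) * q ^ i)) * qPoch q (a * b) * qPoch q q := by
    have hqM : q ^ M ≠ 0 := pow_ne_zero _ hq0
    have e0 (k : ℕ) : a / q ^ M * q ^ k = a * q ^ ((k : ℤ) - M) := by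
      rw [zpow_sub₀ hq0, zpow_natCast, zpow_natCast]; ring
    have e1 : (∑' k : ℕ, b ^ ((k : ℤ) - M) / (1 - a * q ^ ((k : ℤ) - M)) * w k) =
        (b ^ M)⁻¹ * ∑' k, t k / (1 - a / q ^ M * q ^ k) := by
      rw [← tsum_mul_left]
      refine tsum_congr fun k => ?_
      rw [e0, htw, zpow_sub₀ hb0, zpow_natCast, zpow_natCast]
      ring
    have e2 := tsum_lambert_mul_qPoch hq (a := a / q ^ M) hb
      (fun i => by rw [e0]; exact one_sub_mul_zpow_ne_zero hq hq0 ha ha' _)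
      (by simp [t]) ht
    have e3 : a / q ^ M * b = a * b / q ^ M := by ring
    rw [e3, qPoch_div_pow hq hq0 ha0, qPoch_div_pow hq hq0 (mul_ne_zero ha0 hb0)] at e2
    have hE : (∏ i ∈ Finset.range M, (-(q ^ (i + 1))⁻¹)) ≠ 0 :=
      Finset.prod_ne_zero_iff.2 fun i _ => neg_ne_zero.2 (inv_ne_zero (pow_ne_zero _ hq0))
    have haM : a ^ M ≠ 0 := pow_ne_zero _ ha0
    have hbM : b ^ M ≠ 0 := pow_ne_zero _ hb0
    rw [e1]
    refine mul_left_cancel₀ (mul_ne_zero (mul_ne_zero hE haM) hbM) ?_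
    rw [mul_pow] at e2
    linear_combination e2 + (∏ i ∈ Finset.range M, (-(q ^ (i + 1))⁻¹)) * a ^ M *
      (∑' k, t k / (1 - a / q ^ M * q ^ k)) *
      (qPoch q a * qPoch q b * ∏ i ∈ Finset.range M, (1 - q / a * q ^ i)) * mul_inv_cancel₀ hbM
  have h1 := hlim.mul ((tendsto_qPoch hq (q / a)).const_mul (qPoch q a * qPoch q b))
  have h2 := ((tendsto_qPoch hq (q / (a * b))).mul_const (qPoch q (a * b))).mul_const (qPoch q q)
  have h3 := tendsto_nhds_unique (h1.congr hM) h2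
  have h4 : (∑' n : ℤ, b ^ n / (1 - a * q ^ n)) = lambertSum q a b := rfl
  rw [h4] at h3
  field_simp at h3
  rw [mul_comm b a] at h3
  linear_combination h3

end Bilateral

section Theta

/-- The theta series `∑ p ^ (n ^ 2) w ^ n`. -/
noncomputable def thetaSum (p w : ℂ) : ℂ := ∑' n : ℤ, p ^ (n ^ 2) * w ^ n

variable {p w : ℂ}

theorem summable_norm_pow_sq_mul_pow (hp : ‖p‖ < 1) (w : ℂ) :
    Summable fun n : ℕ => ‖p ^ (n ^ 2) * w ^ n‖ := by
  have hlim : Tendsto (fun n : ℕ => ‖p ^ (2 * n + 1) * w‖) atTop (𝓝 0) := by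
    have h1 : Tendsto (fun n : ℕ => p ^ n) atTop (𝓝 0) :=
      tendsto_pow_atTop_nhds_zero_of_norm_lt_one hp
    have h2 : Tendsto (fun n : ℕ => 2 * n + 1) atTop atTop :=
      tendsto_atTop_atTop.2 fun b => ⟨b, fun a ha => by omega⟩
    simpa using ((h1.comp h2).mul_const w).norm
  have hev : ∀ᶠ n : ℕ in atTop, ‖p ^ ((n + 1) ^ 2) * w ^ (n + 1)‖ ≤
      1 / 2 * ‖p ^ (n ^ 2) * w ^ n‖ := by
    filter_upwards [hlim.eventually (gt_mem_nhds (by norm_num : (0 : ℝ) < 1 / 2))] with n hn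
    have : p ^ ((n + 1) ^ 2) * w ^ (n + 1) = (p ^ (2 * n + 1) * w) * (p ^ (n ^ 2) * w ^ n) := by
      ring
    rw [this, norm_mul]
    exact mul_le_mul_of_nonneg_right hn.le (norm_nonneg _)
  refine summable_of_ratio_norm_eventually_le (r := 1 / 2) (by norm_num)
    (f := fun n : ℕ => ‖p ^ (n ^ 2) * w ^ n‖) ?_
  simpa using hev

theorem summable_norm_thetaSum (hp : ‖p‖ < 1) (w : ℂ) :
    Summable fun n : ℤ => ‖p ^ (n ^ 2) * w ^ n‖ := by
  refine Summable.of_nat_of_neg ?_ ?_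
  · refine (summable_norm_pow_sq_mul_pow hp w).congr fun n => ?_
    norm_cast
  · refine (summable_norm_pow_sq_mul_pow hp w⁻¹).congr fun n => ?_
    rw [zpow_neg, zpow_natCast, inv_pow, neg_sq]
    norm_cast

theorem summable_thetaSum (hp : ‖p‖ < 1) (w : ℂ) :
    Summable fun n : ℤ => p ^ (n ^ 2) * w ^ n :=
  (summable_norm_thetaSum hp w).of_norm

theorem thetaSum_inv (p w : ℂ) : thetaSum p w⁻¹ = thetaSum p w := by
  rw [thetaSum, thetaSum, ← (Equiv.neg ℤ).tsum_eq]
  refine tsum_congr fun n => ?_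
  simp

theorem thetaSum_sq_mul (hp0 : p ≠ 0) (hw : w ≠ 0) :
    thetaSum p (p ^ 2 * w) = w⁻¹ * p⁻¹ * thetaSum p w := by
  rw [thetaSum, thetaSum, ← tsum_mul_left, ← (Equiv.subRight (1 : ℤ)).tsum_eq]
  refine tsum_congr fun n => ?_
  simp only [Equiv.subRight_apply]
  rw [mul_zpow, ← zpow_natCast, ← zpow_mul, ← mul_assoc, ← zpow_add₀ hp0, zpow_sub_one₀ hw]
  have : p ^ ((n - 1) ^ 2 + (2 : ℕ) * (n - 1)) = p⁻¹ * p ^ (n ^ 2) := by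
    rw [← zpow_neg_one, ← zpow_add₀ hp0]
    congr 1
    push_cast
    ring
  rw [this]
  ring

/-- The Jacobi triple product identity. -/
theorem thetaSum_eq_qPoch (hp : ‖p‖ < 1) (hp0 : p ≠ 0) {z : ℂ} (hz : z ≠ 0) :
    thetaSum p (-z / p) = qPoch (p ^ 2) z * qPoch (p ^ 2) (p ^ 2 / z) * qPoch (p ^ 2) (p ^ 2) := by
  obtain ⟨q, hq⟩ : ∃ q, q = p ^ 2 := ⟨_, rfl⟩
  rw [← hq]
  have hq1 : ‖q‖ < 1 := by
    rw [hq, norm_pow]; exact pow_lt_one₀ (norm_nonneg _) hp (by simp)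
  have hq0 : q ≠ 0 := by rw [hq]; exact pow_ne_zero _ hp0
  have hpq : qPoch q q ≠ 0 := qPoch_ne_zero_of_norm_lt_one hq1 hq1
  let f : ℤ → ℂ := fun n => p ^ (n ^ 2) * (-z / p) ^ n
  have hzp : -z / p ≠ 0 := div_ne_zero (neg_ne_zero.2 hz) hp0
  have hf0 (n : ℤ) : f n ≠ 0 := mul_ne_zero (zpow_ne_zero _ hp0) (zpow_ne_zero _ hzp)
  have hf (n : ℤ) : f (n + 1) = f n * (-z * q ^ n) := by
    simp only [f]
    have e1 : p ^ ((n + 1) ^ 2) = p ^ (n ^ 2) * (q ^ n * p) := by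
      rw [hq, ← zpow_natCast, ← zpow_mul, ← zpow_add_one₀ hp0, ← zpow_add₀ hp0]
      congr 1
      push_cast
      ring
    rw [e1, zpow_add_one₀ hzp]
    field_simp
  have hne (i : ℕ) : 1 - q * q ^ i ≠ 0 := by
    refine one_sub_ne_zero_of_norm_lt_one ?_
    rw [← pow_succ', norm_pow]
    exact pow_lt_one₀ (norm_nonneg _) hq1 (by simp)
  let w : ℕ → ℂ := fun k => (∏ i ∈ Finset.range k, (1 - q * q ^ i))⁻¹
  have hw : Tendsto w atTop (𝓝 (qPoch q q)⁻¹) := (tendsto_qPoch hq1 _).inv₀ hpq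
  have hlim := tendsto_tsum_shift (f := f) (summable_norm_thetaSum hp _) hw
  have hM (M : ℕ) : f (-M) * qPoch q (z / q ^ M) =
      (∏ i ∈ Finset.range M, (1 - q / z * q ^ i)) * qPoch q z := by
    induction M with
    | zero => simp [f]
    | succ M ih =>
      have h1 : z / q ^ (M + 1) * q = z / q ^ M := by field_simp; ring
      rw [qPoch_eq_mul hq1, h1, Finset.prod_range_succ]
      have h2 := hf (-(M + 1 : ℕ))
      have h3 : (-(M + 1 : ℕ) : ℤ) + 1 = -M := by push_cast; ring
      rw [h3, zpow_neg, zpow_natCast] at h2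
      rw [h2] at ih
      have hqM : q ^ (M + 1) ≠ 0 := pow_ne_zero _ hq0
      have h4 : 1 - z / q ^ (M + 1) = -z * (q ^ (M + 1))⁻¹ * (1 - q / z * q ^ M) := by
        field_simp; ring
      rw [h4]
      linear_combination (1 - q / z * q ^ M) * ih
  have hsum (M : ℕ) : ∑' k : ℕ, f ((k : ℤ) - M) * w k =
      (∏ i ∈ Finset.range M, (1 - q / z * q ^ i)) * qPoch q z := by
    have h := tsum_mul_qPoch hq1 (α := 0) (β := z / q ^ M) (by simp)
      (t := fun k => f ((k : ℤ) - M) * w k / f (-M)) (by simp [w, hf0]) (fun k => ?_)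
    · rw [← hM, ← h, tsum_div_const]
      have : qPoch q 0 = 1 := by simp [qPoch]
      rw [this]
      have := hf0 (-M)
      field_simp
    · have e : ((k + 1 : ℕ) : ℤ) - M = ((k : ℤ) - M) + 1 := by push_cast; ring
      simp only [w]
      rw [e, hf, Finset.prod_range_succ, zpow_sub₀ hq0, zpow_natCast, zpow_natCast, mul_inv]
      have := hne k
      rw [← pow_succ'] at *
      field_simp
      ring
  have h2 := (tendsto_qPoch hq1 (q / z)).mul_const (qPoch q z)
  have h3 := tendsto_nhds_unique (hlim.congr hsum) h2
  have h4 : ∑' n, f n = thetaSum p (-z / p) := rfl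
  rw [h4] at h3
  field_simp at h3
  rw [← neg_div] at h3
  linear_combination h3

end Theta

section ThetaProducts

variable {p : ℂ}

theorem thetaSum_mul_of_bijective {ι : Type*} [Fintype ι] {p₁ p₂ P Q x y : ℂ} (hp₁ : ‖p₁‖ < 1)
    (hp₂ : ‖p₂‖ < 1) (hP : ‖P‖ < 1) (hQ : ‖Q‖ < 1) {e : ι × (ℤ × ℤ) → ℤ × ℤ}
    (he : Function.Bijective e) {c X Y : ι → ℂ}
    (h : ∀ k i j, p₁ ^ ((e (k, (i, j))).1 ^ 2) * x ^ (e (k, (i, j))).1 *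
      (p₂ ^ ((e (k, (i, j))).2 ^ 2) * y ^ (e (k, (i, j))).2) =
        c k * (P ^ (i ^ 2) * X k ^ i * (Q ^ (j ^ 2) * Y k ^ j))) :
    thetaSum p₁ x * thetaSum p₂ y = ∑ k, c k * (thetaSum P (X k) * thetaSum Q (Y k)) := by
  have hs : Summable fun u : ℤ × ℤ =>
      p₁ ^ (u.1 ^ 2) * x ^ u.1 * (p₂ ^ (u.2 ^ 2) * y ^ u.2) :=
    summable_mul_of_summable_norm (f := fun n : ℤ => p₁ ^ (n ^ 2) * x ^ n)
      (g := fun n : ℤ => p₂ ^ (n ^ 2) * y ^ n) (summable_norm_thetaSum hp₁ x)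
      (summable_norm_thetaSum hp₂ y)
  have hs2 := (Equiv.ofBijective e he).summable_iff.2 hs
  have h1 := tsum_mul_tsum_of_summable_norm (summable_norm_thetaSum hp₁ x)
    (summable_norm_thetaSum hp₂ y)
  have h2 := (Equiv.ofBijective e he).tsum_eq fun u : ℤ × ℤ =>
      p₁ ^ (u.1 ^ 2) * x ^ u.1 * (p₂ ^ (u.2 ^ 2) * y ^ u.2)
  have h3 := hs2.tsum_prod
  refine h1.trans (h2.symm.trans (h3.trans ((tsum_fintype _).trans
    (Finset.sum_congr rfl fun k _ => ?_))))
  have h4 := tsum_mul_tsum_of_summable_norm (summable_norm_thetaSum hP (X k))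
    (summable_norm_thetaSum hQ (Y k))
  rw [thetaSum, thetaSum, h4, ← tsum_mul_left]
  exact tsum_congr fun u => h k u.1 u.2

theorem exists_exp_eq {z : ℂ} (hz : z ≠ 0) : ∃ w, Complex.exp w = z :=
  ⟨Complex.log z, Complex.exp_log hz⟩

theorem thetaSum_mul_thetaSum (hp : ‖p‖ < 1) (hp0 : p ≠ 0) {x y : ℂ} (hx : x ≠ 0) (hy : y ≠ 0) :
    thetaSum p x * thetaSum p y = thetaSum (p ^ 2) (x * y) * thetaSum (p ^ 2) (x / y) +
      p * x * (thetaSum (p ^ 2) (p ^ 2 * (x * y)) * thetaSum (p ^ 2) (p ^ 2 * (x / y))) := by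
  have hp2 : ‖p ^ 2‖ < 1 := by
    rw [norm_pow]; exact pow_lt_one₀ (norm_nonneg _) hp (by simp)
  let e : Fin 2 × (ℤ × ℤ) → ℤ × ℤ := fun u => (u.2.1 + u.2.2 + (u.1 : ℕ), u.2.1 - u.2.2)
  have he : Function.Bijective e := by
    constructor
    · rintro ⟨k, i, j⟩ ⟨k', i', j'⟩ h
      simp only [e, Prod.mk.injEq] at h
      have := k.2
      have := k'.2
      ext <;> simp only <;> omega
    · rintro ⟨m, n⟩
      refine ⟨(⟨((m + n) % 2).toNat, by omega⟩, ((m + n) / 2, (m + n) / 2 - n)), ?_⟩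
      simp only [e, Prod.mk.injEq]
      omega
  have := thetaSum_mul_of_bijective (x := x) (y := y) hp hp hp2 hp2 he (c := ![1, p * x])
    (X := ![x * y, p ^ 2 * (x * y)]) (Y := ![x / y, p ^ 2 * (x / y)]) (fun k i j => ?_)
  · rw [this]
    simp
  · obtain ⟨p, rfl⟩ := exists_exp_eq hp0
    obtain ⟨x, rfl⟩ := exists_exp_eq hx
    obtain ⟨y, rfl⟩ := exists_exp_eq hy
    fin_cases k <;>
    · simp [e, ← Complex.exp_int_mul, ← Complex.exp_nat_mul, ← Complex.exp_add, ← Complex.exp_sub]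
      congr 1
      ring

theorem thetaSum_mul_thetaSum_sq (hp : ‖p‖ < 1) (hp0 : p ≠ 0) {x y : ℂ} (hx : x ≠ 0)
    (hy : y ≠ 0) :
    thetaSum p x * thetaSum (p ^ 2) y = thetaSum (p ^ 3) (x * y) * thetaSum (p ^ 6) (y / x ^ 2) +
      p * x * (thetaSum (p ^ 3) (p ^ 2 * (x * y)) * thetaSum (p ^ 6) (y / x ^ 2 / p ^ 4)) +
      p / x * (thetaSum (p ^ 3) (x * y / p ^ 2) * thetaSum (p ^ 6) (p ^ 4 * (y / x ^ 2))) := by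
  have hpn (n : ℕ) (hn : n ≠ 0) : ‖p ^ n‖ < 1 := by
    rw [norm_pow]; exact pow_lt_one₀ (norm_nonneg _) hp hn
  let e : Fin 3 × (ℤ × ℤ) → ℤ × ℤ := fun u =>
    (u.2.1 + ((u.1 : ℕ) - 1) - 2 * u.2.2, u.2.1 + u.2.2)
  have he : Function.Bijective e := by
    constructor
    · rintro ⟨k, i, j⟩ ⟨k', i', j'⟩ h
      simp only [e, Prod.mk.injEq] at h
      have := k.2
      have := k'.2
      ext <;> simp only <;> omega
    · rintro ⟨m, n⟩
      refine ⟨(⟨((m + 2 * n + 1) % 3).toNat, by omega⟩,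
        ((m + 2 * n + 1) / 3, n - (m + 2 * n + 1) / 3)), ?_⟩
      simp only [e, Prod.mk.injEq]
      omega
  have := thetaSum_mul_of_bijective (x := x) (y := y) hp (hpn 2 (by simp)) (hpn 3 (by simp))
    (hpn 6 (by simp)) he (c := ![p / x, 1, p * x])
    (X := ![x * y / p ^ 2, x * y, p ^ 2 * (x * y)])
    (Y := ![p ^ 4 * (y / x ^ 2), y / x ^ 2, y / x ^ 2 / p ^ 4]) (fun k i j => ?_)
  · rw [this]
    simp [Fin.sum_univ_succ]
    ring
  · obtain ⟨p, rfl⟩ := exists_exp_eq hp0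
    obtain ⟨x, rfl⟩ := exists_exp_eq hx
    obtain ⟨y, rfl⟩ := exists_exp_eq hy
    fin_cases k <;>
    · simp [e, ← Complex.exp_int_mul, ← Complex.exp_nat_mul, ← Complex.exp_add, ← Complex.exp_sub]
      congr 1
      ring

end ThetaProducts

section Winquist

variable {p : ℂ}

/-- The theta function `∑ (-1) ^ n q ^ (n (n - 1) / 2) a ^ n` with nome `q = p ^ 2`. -/
noncomputable def jTheta (p a : ℂ) : ℂ := thetaSum p (-a / p)

/-- The first of the two odd theta functions of weight `3` in Winquist's identity. -/
noncomputable def winquistB (p a : ℂ) : ℂ :=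
  thetaSum (p ^ 3) (-a ^ 3 / p) - a * thetaSum (p ^ 3) (-(p * a ^ 3))

/-- The second of the two odd theta functions of weight `3` in Winquist's identity. -/
noncomputable def winquistA (p a : ℂ) : ℂ := -(a⁻¹ * thetaSum (p ^ 3) (-a ^ 3 / p ^ 3))

/-- The antisymmetric combination occurring in Winquist's identity. -/
noncomputable def winquistD (p a b : ℂ) : ℂ :=
  winquistB p a * winquistA p b - winquistA p a * winquistB p b

theorem norm_pow_lt_one (hp : ‖p‖ < 1) {n : ℕ} (hn : n ≠ 0) : ‖p ^ n‖ < 1 := by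
  rw [norm_pow]; exact pow_lt_one₀ (norm_nonneg _) hp hn

theorem jTheta_mul_thetaSum_sq (hp : ‖p‖ < 1) (hp0 : p ≠ 0) {a : ℂ} (ha : a ≠ 0) :
    jTheta p a * thetaSum (p ^ 2) (a ^ 2) = thetaSum (p ^ 6) (p ^ 2) * winquistB p a +
      p ^ 2 * thetaSum (p ^ 6) (p ^ 6) * winquistA p a := by
  have hx : -a / p ≠ 0 := div_ne_zero (neg_ne_zero.2 ha) hp0
  have h := thetaSum_mul_thetaSum_sq hp hp0 hx (pow_ne_zero 2 ha)
  have e1 : -a / p * a ^ 2 = -a ^ 3 / p := by field_simp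
  have e2 : a ^ 2 / (-a / p) ^ 2 = p ^ 2 := by field_simp
  have e3 : p ^ 2 * (-a ^ 3 / p) = -(p * a ^ 3) := by field_simp
  have e4 : p ^ 2 / p ^ 4 = (p ^ 2)⁻¹ := by field_simp
  have e5 : -a ^ 3 / p / p ^ 2 = -a ^ 3 / p ^ 3 := by field_simp
  have e6 : p ^ 4 * p ^ 2 = p ^ 6 := by ring
  rw [e1, e2, e3, e4, e5, e6, thetaSum_inv] at h
  rw [jTheta, h, winquistA, winquistB]
  field_simp
  ring

theorem jTheta_mul_thetaSum_sq_shift (hp : ‖p‖ < 1) (hp0 : p ≠ 0) {a : ℂ} (ha : a ≠ 0) :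
    jTheta p a * (a * thetaSum (p ^ 2) (p ^ 2 * a ^ 2)) =
      -(thetaSum (p ^ 6) (p ^ 4) * winquistB p a) - thetaSum (p ^ 6) 1 * winquistA p a := by
  have hx : -a / p ≠ 0 := div_ne_zero (neg_ne_zero.2 ha) hp0
  have h := thetaSum_mul_thetaSum_sq hp hp0 hx
    (mul_ne_zero (pow_ne_zero 2 hp0) (pow_ne_zero 2 ha))
  have e1 : -a / p * (p ^ 2 * a ^ 2) = -(p * a ^ 3) := by field_simp
  have e2 : p ^ 2 * a ^ 2 / (-a / p) ^ 2 = p ^ 4 := by field_simp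
  have e3 : p ^ 2 * -(p * a ^ 3) = (p ^ 3) ^ 2 * (-a ^ 3 / p ^ 3) := by field_simp
  have e4 : p ^ 4 / p ^ 4 = 1 := by field_simp
  have e5 : -(p * a ^ 3) / p ^ 2 = -a ^ 3 / p := by field_simp
  have e6 : p ^ 4 * p ^ 4 = (p ^ 6) ^ 2 * (p ^ 4)⁻¹ := by field_simp
  have hp4 : (p ^ 4)⁻¹ ≠ 0 := inv_ne_zero (pow_ne_zero _ hp0)
  have hx3 : -a ^ 3 / p ^ 3 ≠ 0 :=
    div_ne_zero (neg_ne_zero.2 (pow_ne_zero _ ha)) (pow_ne_zero _ hp0)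
  rw [e1, e2, e3, e4, e5, e6, thetaSum_sq_mul (pow_ne_zero 3 hp0) hx3,
    thetaSum_sq_mul (pow_ne_zero 6 hp0) hp4, thetaSum_inv] at h
  rw [jTheta, mul_left_comm, h, winquistA, winquistB]
  field_simp
  ring

theorem jTheta_mul_jTheta_div (hp : ‖p‖ < 1) (hp0 : p ≠ 0) {a b : ℂ} (ha : a ≠ 0)
    (hb : b ≠ 0) :
    jTheta p (a * b) * jTheta p (a / b) =
      a * (a * thetaSum (p ^ 2) (p ^ 2 * a ^ 2) * thetaSum (p ^ 2) (b ^ 2) -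
        thetaSum (p ^ 2) (a ^ 2) * (b * thetaSum (p ^ 2) (p ^ 2 * b ^ 2))) := by
  have hx : -(a * b) / p ≠ 0 := div_ne_zero (neg_ne_zero.2 (mul_ne_zero ha hb)) hp0
  have hy : -(a / b) / p ≠ 0 := div_ne_zero (neg_ne_zero.2 (div_ne_zero ha hb)) hp0
  have h := thetaSum_mul_thetaSum hp hp0 hx hy
  have e1 : -(a * b) / p * (-(a / b) / p) = a ^ 2 / p ^ 2 := by field_simp
  have e2 : -(a * b) / p / (-(a / b) / p) = b ^ 2 := by field_simp
  have e3 : p ^ 2 * (a ^ 2 / p ^ 2) = a ^ 2 := by field_simp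
  have e4 : p ^ 2 * a ^ 2 = (p ^ 2) ^ 2 * (a ^ 2 / p ^ 2) := by field_simp
  rw [e1, e2, e3] at h
  rw [jTheta, jTheta, h, e4, thetaSum_sq_mul (pow_ne_zero 2 hp0)
    (div_ne_zero (pow_ne_zero 2 ha) (pow_ne_zero 2 hp0))]
  field_simp
  ring

theorem qPoch_eq_prod (q z : ℂ) (hq : ‖q‖ < 1) {m : ℕ} (hm : m ≠ 0) :
    qPoch q z = ∏ k ∈ Finset.range m, qPoch (q ^ m) (z * q ^ k) := by
  have hqm : ‖q ^ m‖ < 1 := norm_pow_lt_one hq hm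
  have h1 : Tendsto (fun N : ℕ => ∏ i ∈ Finset.range (N * m), (1 - z * q ^ i)) atTop
      (𝓝 (qPoch q z)) :=
    (tendsto_qPoch hq z).comp (tendsto_atTop_atTop.2 fun b =>
      ⟨b, fun a hab => hab.trans (Nat.le_mul_of_pos_right a (Nat.pos_of_ne_zero hm))⟩)
  have h2 := tendsto_finsetProd (Finset.range m)
    fun k _ => tendsto_qPoch hqm (z * q ^ k)
  refine tendsto_nhds_unique h1 (h2.congr fun N => ?_)
  induction N with
  | zero => simp
  | succ N ih =>
    rw [Nat.succ_mul, Finset.prod_range_add, ← ih, ← Finset.prod_mul_distrib]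
    refine Finset.prod_congr rfl fun k _ => ?_
    rw [Finset.prod_range_succ]
    have : z * q ^ (N * m + k) = z * q ^ k * (q ^ m) ^ N := by
      rw [← pow_mul, pow_add, mul_comm m N]
      ring
    rw [this]

theorem thetaSum_cube_eq (hp : ‖p‖ < 1) (hp0 : p ≠ 0) :
    thetaSum (p ^ 3) (-(p⁻¹)) = qPoch (p ^ 2) (p ^ 2) := by
  have h := thetaSum_eq_qPoch (norm_pow_lt_one hp (n := 3) (by simp)) (pow_ne_zero 3 hp0)
    (pow_ne_zero 2 hp0)
  have e1 : -p ^ 2 / p ^ 3 = -(p⁻¹) := by field_simp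
  rw [e1] at h
  rw [h, qPoch_eq_prod (p ^ 2) (p ^ 2) (norm_pow_lt_one hp (by simp)) (m := 3) (by simp)]
  simp only [Finset.prod_range_succ, Finset.prod_range_zero]
  have e2 : (p ^ 3) ^ 2 / p ^ 2 = p ^ 2 * (p ^ 2) ^ 1 := by field_simp
  have e3 : (p ^ 3) ^ 2 = p ^ 2 * (p ^ 2) ^ 2 := by ring
  have e4 : (p ^ 2) ^ 3 = (p ^ 3) ^ 2 := by ring
  rw [e2, e4, ← e3, pow_zero, mul_one, one_mul]

/-- Winquist's identity. -/
theorem winquist (hp : ‖p‖ < 1) (hp0 : p ≠ 0) {a b : ℂ} (ha : a ≠ 0) (hb : b ≠ 0) :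
    jTheta p a * jTheta p b * jTheta p (a * b) * jTheta p (a / b) =
      a * qPoch (p ^ 2) (p ^ 2) ^ 2 * winquistD p a b := by
  have hpi : -(p⁻¹) ≠ 0 := neg_ne_zero.2 (inv_ne_zero hp0)
  have h := thetaSum_mul_thetaSum (norm_pow_lt_one hp (n := 3) (by simp)) (pow_ne_zero 3 hp0)
    hpi hpi
  have e1 : (-(p⁻¹)) * (-(p⁻¹)) = (p ^ 2)⁻¹ := by field_simp
  have e2 : (p ^ 3) ^ 2 = p ^ 6 := by ring
  have e3 : p ^ 6 * (p ^ 2)⁻¹ = p ^ 4 := by field_simp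
  have e4 : p ^ 3 * -(p⁻¹) = -p ^ 2 := by field_simp
  rw [thetaSum_cube_eq hp hp0, e1, e2, e3, e4, div_self hpi, mul_one, thetaSum_inv] at h
  rw [winquistD]
  linear_combination jTheta p a * jTheta p b * jTheta_mul_jTheta_div hp hp0 ha hb +
    a * (jTheta p b * thetaSum (p ^ 2) (b ^ 2)) * jTheta_mul_thetaSum_sq_shift hp hp0 ha -
    a * (jTheta p a * thetaSum (p ^ 2) (a ^ 2)) * jTheta_mul_thetaSum_sq_shift hp hp0 hb +
    a * (-(thetaSum (p ^ 6) (p ^ 4) * winquistB p a) - thetaSum (p ^ 6) 1 * winquistA p a) *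
      jTheta_mul_thetaSum_sq hp hp0 hb -
    a * (-(thetaSum (p ^ 6) (p ^ 4) * winquistB p b) - thetaSum (p ^ 6) 1 * winquistA p b) *
      jTheta_mul_thetaSum_sq hp hp0 ha -
    a * (winquistB p a * winquistA p b - winquistA p a * winquistB p b) * h

end Winquist

section Dissection

variable {p : ℂ}

theorem thetaSum_dissect (hp : ‖p‖ < 1) (hp0 : p ≠ 0) {w : ℂ} (hw : w ≠ 0) (c : ℤ) :
    thetaSum p w = ∑ k : Fin 11, p ^ ((c - ((k : ℕ) - 5)) ^ 2) * w ^ (c - ((k : ℕ) - 5)) *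
      thetaSum (p ^ 121) (p ^ (-22 * (c - ((k : ℕ) - 5))) * w ^ (-11 : ℤ)) := by
  let e : Fin 11 × ℤ → ℤ := fun u => c - ((u.1 : ℕ) - 5) - 11 * u.2
  have he : Function.Bijective e := by
    constructor
    · rintro ⟨k, i⟩ ⟨k', i'⟩ h
      simp only [e] at h
      have := k.2
      have := k'.2
      ext <;> simp only <;> omega
    · intro m
      refine ⟨(⟨((c + 5 - m) % 11).toNat, by omega⟩, (c + 5 - m) / 11), ?_⟩
      simp only [e]
      omega
  have hs := (Equiv.ofBijective e he).summable_iff.2 (summable_thetaSum hp w)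
  have h2 := (Equiv.ofBijective e he).tsum_eq fun n : ℤ => p ^ (n ^ 2) * w ^ n
  have h3 := hs.tsum_prod
  refine h2.symm.trans (h3.trans ((tsum_fintype _).trans (Finset.sum_congr rfl fun k _ => ?_)))
  rw [thetaSum, ← tsum_mul_left]
  refine tsum_congr fun i => ?_
  simp only [Function.comp, Equiv.ofBijective_apply, e]
  generalize (c - ((k : ℕ) - 5) : ℤ) = d
  obtain ⟨p, rfl⟩ := exists_exp_eq hp0
  obtain ⟨w, rfl⟩ := exists_exp_eq hw
  simp [← Complex.exp_int_mul, ← Complex.exp_nat_mul, ← Complex.exp_add, ← Complex.exp_neg]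
  congr 1
  ring

theorem neg_one_zpow_sub (c s : ℤ) : (-1 : ℂ) ^ (c - s) = (-1) ^ c * (-1) ^ s := by
  rw [zpow_sub₀ (by norm_num), div_eq_mul_inv, ← inv_zpow, inv_neg_one]

theorem winquistB_inv (p : ℂ) {a : ℂ} (ha : a ≠ 0) :
    winquistB p a⁻¹ = -(a⁻¹ * winquistB p a) := by
  have e1 : -a⁻¹ ^ 3 / p = (-(p * a ^ 3))⁻¹ := by
    rw [inv_neg, mul_inv, inv_pow, neg_div, div_eq_mul_inv, mul_comm]
  have e2 : -(p * a⁻¹ ^ 3) = (-a ^ 3 / p)⁻¹ := by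
    rw [inv_div, inv_pow, div_neg, div_eq_mul_inv]
  rw [winquistB, winquistB, e1, e2, thetaSum_inv, thetaSum_inv]
  field_simp
  ring

theorem winquistA_inv (hp0 : p ≠ 0) {a : ℂ} (ha : a ≠ 0) :
    winquistA p a⁻¹ = -(a⁻¹ * winquistA p a) := by
  have hx3 : -a ^ 3 / p ^ 3 ≠ 0 :=
    div_ne_zero (neg_ne_zero.2 (pow_ne_zero _ ha)) (pow_ne_zero _ hp0)
  have e1 : -a⁻¹ ^ 3 / p ^ 3 = ((p ^ 3) ^ 2 * (-a ^ 3 / p ^ 3))⁻¹ := by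
    field_simp
  rw [winquistA, winquistA, e1, thetaSum_inv, thetaSum_sq_mul (pow_ne_zero 3 hp0) hx3]
  field_simp

theorem winquistB_one (p : ℂ) : winquistB p 1 = 0 := by
  have := winquistB_inv p one_ne_zero
  rw [inv_one, one_mul] at this
  exact self_eq_neg.1 this

theorem winquistA_one (hp0 : p ≠ 0) : winquistA p 1 = 0 := by
  have := winquistA_inv hp0 one_ne_zero
  rw [inv_one, one_mul] at this
  exact self_eq_neg.1 this

theorem winquistB_dissect_aux (hp : ‖p‖ < 1) (hp0 : p ≠ 0) {a : ℂ} (ha : a ^ 11 = 1) :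
    winquistB p a = ∑ k : Fin 11, (-1) ^ (((k : ℕ) : ℤ) - 5) *
      p ^ (10 + 3 * (((k : ℕ) : ℤ) - 5) ^ 2 - 11 * (((k : ℕ) : ℤ) - 5)) *
      a ^ (6 - 3 * (((k : ℕ) : ℤ) - 5)) *
      winquistB (p ^ 121) ((p ^ 22) ^ (((k : ℕ) : ℤ) - 5)) := by
  have ha0 : a ≠ 0 := fun h => by simp [h] at ha
  have hw1 : -a ^ 3 / p ≠ 0 := div_ne_zero (neg_ne_zero.2 (pow_ne_zero _ ha0)) hp0
  have hw2 : -(p * a ^ 3) ≠ 0 := neg_ne_zero.2 (mul_ne_zero hp0 (pow_ne_zero _ ha0))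
  have hp3 := norm_pow_lt_one hp (n := 3) (by simp)
  have e1 : (-a ^ 3 / p) ^ (-11 : ℤ) = -p ^ 11 := by
    have : (-a ^ 3 / p) ^ (-11 : ℤ) = -(p ^ 11 * (a ^ 11)⁻¹ ^ 3) := by
      rw [zpow_neg, show (11 : ℤ) = ((11 : ℕ) : ℤ) from rfl, zpow_natCast]
      field_simp
    rw [this, ha, inv_one, one_pow, mul_one]
  have e2 : (-(p * a ^ 3)) ^ (-11 : ℤ) = -(p ^ 11)⁻¹ := by
    have : (-(p * a ^ 3)) ^ (-11 : ℤ) = -((p ^ 11)⁻¹ * (a ^ 11)⁻¹ ^ 3) := by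
      rw [zpow_neg, show (11 : ℤ) = ((11 : ℕ) : ℤ) from rfl, zpow_natCast]
      field_simp
    rw [this, ha, inv_one, one_pow, mul_one]
  rw [winquistB, thetaSum_dissect hp3 (pow_ne_zero 3 hp0) hw1 2,
    thetaSum_dissect hp3 (pow_ne_zero 3 hp0) hw2 (-2), e1, e2, Finset.mul_sum,
    ← Finset.sum_sub_distrib]
  refine Finset.sum_congr rfl fun k _ => ?_
  generalize (((k : ℕ) : ℤ) - 5) = s
  rw [winquistB]
  have t1 : (p ^ 3) ^ (-22 * (2 - s)) * -p ^ 11 = -((p ^ 22) ^ s) ^ 3 / p ^ 121 := by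
    obtain ⟨p, rfl⟩ := exists_exp_eq hp0
    rw [mul_neg, neg_div]
    simp only [← Complex.exp_int_mul, ← Complex.exp_nat_mul, ← Complex.exp_add,
      ← Complex.exp_sub]
    congr 2
    push_cast
    ring
  have t2 : (p ^ 3) ^ (-22 * (-2 - s)) * -(p ^ 11)⁻¹ = -(p ^ 121 * ((p ^ 22) ^ s) ^ 3) := by
    obtain ⟨p, rfl⟩ := exists_exp_eq hp0
    rw [mul_neg]
    simp only [← Complex.exp_int_mul, ← Complex.exp_nat_mul, ← Complex.exp_add,
      ← Complex.exp_neg]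
    congr 2
    push_cast
    ring
  have t3 : (p ^ 3) ^ 121 = (p ^ 121) ^ 3 := by ring
  have u1 : (p ^ 3) ^ ((2 - s) ^ 2) * (-a ^ 3 / p) ^ (2 - s) =
      (-1) ^ s * p ^ (10 + 3 * s ^ 2 - 11 * s) * a ^ (6 - 3 * s) := by
    have : -a ^ 3 / p = -1 * (a ^ 3 / p) := by ring
    rw [this, mul_zpow, neg_one_zpow_sub]
    have : (p ^ 3) ^ ((2 - s) ^ 2) * (a ^ 3 / p) ^ (2 - s) =
      p ^ (10 + 3 * s ^ 2 - 11 * s) * a ^ (6 - 3 * s) := by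
      obtain ⟨p, rfl⟩ := exists_exp_eq hp0
      obtain ⟨a, rfl⟩ := exists_exp_eq ha0
      simp only [← Complex.exp_int_mul, ← Complex.exp_nat_mul, ← Complex.exp_add,
        ← Complex.exp_sub]
      congr 1
      push_cast
      ring
    norm_num
    linear_combination (-1) ^ s * this
  have u2 : a * ((p ^ 3) ^ ((-2 - s) ^ 2) * (-(p * a ^ 3)) ^ (-2 - s)) =
      (-1) ^ s * p ^ (10 + 3 * s ^ 2 - 11 * s) * a ^ (6 - 3 * s) * (p ^ 22) ^ s := by
    have : -(p * a ^ 3) = -1 * (p * a ^ 3) := by ring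
    rw [this, mul_zpow, neg_one_zpow_sub]
    have : a ^ 11 * (a * ((p ^ 3) ^ ((-2 - s) ^ 2) * (p * a ^ 3) ^ (-2 - s))) =
      p ^ (10 + 3 * s ^ 2 - 11 * s) * a ^ (6 - 3 * s) * (p ^ 22) ^ s := by
      obtain ⟨p, rfl⟩ := exists_exp_eq hp0
      obtain ⟨a, rfl⟩ := exists_exp_eq ha0
      simp only [← Complex.exp_int_mul, ← Complex.exp_nat_mul, ← Complex.exp_add]
      congr 1
      push_cast
      ring
    rw [ha] at this
    norm_num
    linear_combination (-1) ^ s * this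
  rw [t1, t2, t3, u1]
  linear_combination (-thetaSum ((p ^ 121) ^ 3) (-(p ^ 121 * ((p ^ 22) ^ s) ^ 3))) * u2

theorem winquistA_dissect_aux (hp : ‖p‖ < 1) (hp0 : p ≠ 0) {a : ℂ} (ha : a ^ 11 = 1) :
    winquistA p a = ∑ k : Fin 11, p ^ 80 * ((-1) ^ (((k : ℕ) : ℤ) - 5) *
      p ^ (10 + 3 * (((k : ℕ) : ℤ) - 5) ^ 2 - 11 * (((k : ℕ) : ℤ) - 5)) *
      a ^ (6 - 3 * (((k : ℕ) : ℤ) - 5)) *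
      winquistA (p ^ 121) ((p ^ 22) ^ (((k : ℕ) : ℤ) - 5))) := by
  have ha0 : a ≠ 0 := fun h => by simp [h] at ha
  have hw1 : -a ^ 3 / p ^ 3 ≠ 0 :=
    div_ne_zero (neg_ne_zero.2 (pow_ne_zero _ ha0)) (pow_ne_zero _ hp0)
  have hp3 := norm_pow_lt_one hp (n := 3) (by simp)
  have e1 : (-a ^ 3 / p ^ 3) ^ (-11 : ℤ) = -p ^ 33 := by
    have : (-a ^ 3 / p ^ 3) ^ (-11 : ℤ) = -(p ^ 33 * (a ^ 11)⁻¹ ^ 3) := by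
      rw [zpow_neg, show (11 : ℤ) = ((11 : ℕ) : ℤ) from rfl, zpow_natCast]
      field_simp
    rw [this, ha, inv_one, one_pow, mul_one]
  rw [winquistA, thetaSum_dissect hp3 (pow_ne_zero 3 hp0) hw1 6, e1, Finset.mul_sum,
    ← Finset.sum_neg_distrib]
  refine Finset.sum_congr rfl fun k _ => ?_
  generalize (((k : ℕ) : ℤ) - 5) = s
  rw [winquistA]
  have t1 : (p ^ 3) ^ (-22 * (6 - s)) * -p ^ 33 =
      -((p ^ 22) ^ s) ^ 3 / (p ^ 121) ^ 3 := by
    obtain ⟨p, rfl⟩ := exists_exp_eq hp0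
    rw [mul_neg, neg_div]
    simp only [← Complex.exp_int_mul, ← Complex.exp_nat_mul, ← Complex.exp_add,
      ← Complex.exp_sub]
    congr 2
    push_cast
    ring
  have t3 : (p ^ 3) ^ 121 = (p ^ 121) ^ 3 := by ring
  have u1 : a⁻¹ * ((p ^ 3) ^ ((6 - s) ^ 2) * (-a ^ 3 / p ^ 3) ^ (6 - s)) =
      p ^ 80 * ((-1) ^ s * p ^ (10 + 3 * s ^ 2 - 11 * s) * a ^ (6 - 3 * s) *
        ((p ^ 22) ^ s)⁻¹) := by
    have : -a ^ 3 / p ^ 3 = -1 * (a ^ 3 / p ^ 3) := by ring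
    rw [this, mul_zpow, neg_one_zpow_sub]
    have : a⁻¹ * ((p ^ 3) ^ ((6 - s) ^ 2) * (a ^ 3 / p ^ 3) ^ (6 - s)) =
      a ^ 11 * (p ^ 80 * (p ^ (10 + 3 * s ^ 2 - 11 * s) * a ^ (6 - 3 * s) * ((p ^ 22) ^ s)⁻¹)) := by
      obtain ⟨p, rfl⟩ := exists_exp_eq hp0
      obtain ⟨a, rfl⟩ := exists_exp_eq ha0
      simp only [← Complex.exp_int_mul, ← Complex.exp_nat_mul, ← Complex.exp_add,
        ← Complex.exp_sub, ← Complex.exp_neg]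
      congr 1
      push_cast
      ring
    rw [ha] at this
    norm_num
    linear_combination (-1) ^ s * this
  rw [t1, t3]
  linear_combination (-thetaSum ((p ^ 121) ^ 3) (-((p ^ 22) ^ s) ^ 3 / (p ^ 121) ^ 3)) * u1

end Dissection

section Dissection

variable {p : ℂ}

theorem sum_dissect_odd (hp0 : p ≠ 0) {a : ℂ} (ha : a ^ 11 = 1) {f : ℂ → ℂ}
    (hf : ∀ x, x ≠ 0 → f x⁻¹ = -(x⁻¹ * f x)) (hf1 : f 1 = 0) :
    ∑ k : Fin 11, (-1) ^ (((k : ℕ) : ℤ) - 5) *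
      p ^ (10 + 3 * (((k : ℕ) : ℤ) - 5) ^ 2 - 11 * (((k : ℕ) : ℤ) - 5)) *
      a ^ (6 - 3 * (((k : ℕ) : ℤ) - 5)) * f ((p ^ 22) ^ (((k : ℕ) : ℤ) - 5)) =
    -(p ^ 2 * (a ^ 3 - a ^ 9) * f (p ^ 22)) + (1 - a) * f ((p ^ 22) ^ 2) -
      p ^ 4 * (a ^ 8 - a ^ 4) * f ((p ^ 22) ^ 3) + p ^ 14 * (a ^ 5 - a ^ 7) * f ((p ^ 22) ^ 4) -
      p ^ 30 * (a ^ 2 - a ^ 10) * f ((p ^ 22) ^ 5) := by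
  have ha0 : a ≠ 0 := fun h => by simp [h] at ha
  have hX : p ^ 22 ≠ 0 := pow_ne_zero _ hp0
  have hfn (n : ℕ) : f ((p ^ 22) ^ (-(n : ℤ))) = -(((p ^ 22) ^ n)⁻¹ * f ((p ^ 22) ^ n)) := by
    rw [zpow_neg, zpow_natCast, hf _ (pow_ne_zero _ hX)]
  have h (m r : ℕ) : a ^ (11 * m + r) = a ^ r := by rw [pow_add, pow_mul, ha, one_pow, one_mul]
  have t0 := hfn 5
  have t1 := hfn 4
  have t2 := hfn 3
  have t3 := hfn 2
  have t4 := hfn 1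
  have z (x : ℂ) (n : ℕ) [n.AtLeastTwo] : x ^ (OfNat.ofNat n : ℤ) = x ^ n := zpow_natCast x n
  have a0 : (a ^ 9)⁻¹ = a ^ 2 := by
    rw [inv_eq_of_mul_eq_one_left]
    rw [← ha]; ring
  have a1 : (a ^ 6)⁻¹ = a ^ 5 := by
    rw [inv_eq_of_mul_eq_one_left]
    rw [← ha]; ring
  have a2 : (a ^ 3)⁻¹ = a ^ 8 := by
    rw [inv_eq_of_mul_eq_one_left]
    rw [← ha]; ring
  push_cast at t0 t1 t2 t3 t4
  rw [Fin.sum_univ_eq_sum_range (fun k => (-1 : ℂ) ^ ((k : ℤ) - 5) *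
      p ^ (10 + 3 * ((k : ℤ) - 5) ^ 2 - 11 * ((k : ℤ) - 5)) *
      a ^ (6 - 3 * ((k : ℤ) - 5)) * f ((p ^ 22) ^ ((k : ℤ) - 5)))]
  simp only [Finset.sum_range_succ, Finset.sum_range_zero]
  norm_num [z] at t0 t1 t2 t3 t4 ⊢
  have b1 := h 1 7
  have b2 := h 1 10
  have b3 := h 1 4
  have b4 := h 1 1
  norm_num at b1 b2 b3 b4
  rw [t0, t1, t2, t3, t4, hf1, a0, a1, a2, b1, b2, b3, b4]
  generalize f (p ^ 22) = F1, f ((p ^ 22) ^ 2) = F2, f ((p ^ 22) ^ 3) = F3,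
    f ((p ^ 22) ^ 4) = F4, f ((p ^ 22) ^ 5) = F5
  field_simp
  ring

theorem winquistB_dissect (hp : ‖p‖ < 1) (hp0 : p ≠ 0) {a : ℂ} (ha : a ^ 11 = 1) :
    winquistB p a = -(p ^ 2 * (a ^ 3 - a ^ 9) * winquistB (p ^ 121) (p ^ 22)) +
      (1 - a) * winquistB (p ^ 121) ((p ^ 22) ^ 2) -
      p ^ 4 * (a ^ 8 - a ^ 4) * winquistB (p ^ 121) ((p ^ 22) ^ 3) +
      p ^ 14 * (a ^ 5 - a ^ 7) * winquistB (p ^ 121) ((p ^ 22) ^ 4) -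
      p ^ 30 * (a ^ 2 - a ^ 10) * winquistB (p ^ 121) ((p ^ 22) ^ 5) := by
  rw [winquistB_dissect_aux hp hp0 ha]
  exact sum_dissect_odd hp0 ha (fun x hx => winquistB_inv _ hx) (winquistB_one _)

theorem winquistA_dissect (hp : ‖p‖ < 1) (hp0 : p ≠ 0) {a : ℂ} (ha : a ^ 11 = 1) :
    winquistA p a = p ^ 80 * (-(p ^ 2 * (a ^ 3 - a ^ 9) * winquistA (p ^ 121) (p ^ 22)) +
      (1 - a) * winquistA (p ^ 121) ((p ^ 22) ^ 2) -
      p ^ 4 * (a ^ 8 - a ^ 4) * winquistA (p ^ 121) ((p ^ 22) ^ 3) +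
      p ^ 14 * (a ^ 5 - a ^ 7) * winquistA (p ^ 121) ((p ^ 22) ^ 4) -
      p ^ 30 * (a ^ 2 - a ^ 10) * winquistA (p ^ 121) ((p ^ 22) ^ 5)) := by
  have hp121 : p ^ 121 ≠ 0 := pow_ne_zero _ hp0
  rw [winquistA_dissect_aux hp hp0 ha, ← Finset.mul_sum]
  congr 1
  exact sum_dissect_odd hp0 ha (fun x hx => winquistA_inv hp121 hx) (winquistA_one hp121)

end Dissection

section RootOfUnityProducts

variable {q ζ : ℂ}

theorem IsPrimitiveRoot.prod_range_one_sub_pow_mul {n : ℕ} (hn : 0 < n)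
    (hζ : IsPrimitiveRoot ζ n) (w : ℂ) :
    ∏ k ∈ Finset.range n, (1 - ζ ^ k * w) = 1 - w ^ n := by
  have h := hζ.pow_sub_pow_eq_prod_sub_mul 1 w hn
  rw [one_pow] at h
  rw [h]
  refine Finset.prod_nbij (fun k => ζ ^ k) (fun k _ => ?_) (fun i hi j hj h => ?_)
    (fun x hx => ?_) fun k _ => rfl
  · rw [Polynomial.mem_nthRootsFinset hn, ← pow_mul, mul_comm, pow_mul, hζ.pow_eq_one, one_pow]
  · exact hζ.pow_inj (Finset.mem_range.1 hi) (Finset.mem_range.1 hj) h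
  · have : NeZero n := ⟨hn.ne'⟩
    obtain ⟨i, hi, rfl⟩ := hζ.eq_pow_of_pow_eq_one ((Polynomial.mem_nthRootsFinset hn _).1 hx)
    exact ⟨i, Finset.mem_coe.2 (Finset.mem_range.2 hi), rfl⟩

theorem IsPrimitiveRoot.prod_range_qPoch {n : ℕ} (hn : 0 < n) (hq : ‖q‖ < 1)
    (hζ : IsPrimitiveRoot ζ n) (z : ℂ) :
    ∏ k ∈ Finset.range n, qPoch q (ζ ^ k * z) = qPoch (q ^ n) (z ^ n) := by
  refine tendsto_nhds_unique (tendsto_finsetProd _ fun k _ => tendsto_qPoch hq (ζ ^ k * z)) ?_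
  refine (tendsto_qPoch (norm_pow_lt_one hq hn.ne') (z ^ n)).congr fun N => ?_
  rw [Finset.prod_comm]
  refine Finset.prod_congr rfl fun i _ => ?_
  rw [← pow_mul, mul_comm n i, pow_mul, ← mul_pow, ← hζ.prod_range_one_sub_pow_mul hn]
  exact Finset.prod_congr rfl fun k _ => by rw [mul_assoc]

end RootOfUnityProducts

section JTheta

variable {p : ℂ}

theorem jTheta_eq_qPoch (hp : ‖p‖ < 1) (hp0 : p ≠ 0) {z : ℂ} (hz : z ≠ 0) :
    jTheta p z = qPoch (p ^ 2) z * qPoch (p ^ 2) (p ^ 2 / z) * qPoch (p ^ 2) (p ^ 2) :=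
  thetaSum_eq_qPoch hp hp0 hz

theorem jTheta_eq_one_sub_mul (hp : ‖p‖ < 1) (hp0 : p ≠ 0) {z : ℂ} (hz : z ≠ 0) :
    jTheta p z = (1 - z) * (qPoch (p ^ 2) (z * p ^ 2) * qPoch (p ^ 2) (z⁻¹ * p ^ 2)) *
      qPoch (p ^ 2) (p ^ 2) := by
  rw [jTheta_eq_qPoch hp hp0 hz, qPoch_eq_mul (norm_pow_lt_one hp two_ne_zero) z,
    div_eq_inv_mul]
  ring

theorem jTheta_inv (hp : ‖p‖ < 1) (hp0 : p ≠ 0) {z : ℂ} (hz : z ≠ 0) :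
    jTheta p z⁻¹ = -z⁻¹ * jTheta p z := by
  rw [jTheta_eq_one_sub_mul hp hp0 hz, jTheta_eq_one_sub_mul hp hp0 (inv_ne_zero hz), inv_inv]
  field_simp
  ring

/-- Product expansion of the theta function at an eleventh root of unity. -/
theorem winquistD_root_mul (hp : ‖p‖ < 1) (hp0 : p ≠ 0) {ζ : ℂ} (hζ : IsPrimitiveRoot ζ 11) :
    -ζ ^ 9 * (qPoch (p ^ 2) (ζ * p ^ 2) * qPoch (p ^ 2) (ζ⁻¹ * p ^ 2)) *
        winquistD p (ζ ^ 5) (ζ ^ 2) =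
      (1 - ζ ^ 2) * (1 - ζ ^ 3) * (1 - ζ ^ 4) * (1 - ζ ^ 5) * qPoch (p ^ 2) (p ^ 2) *
        qPoch (p ^ 22) (p ^ 22) := by
  have hζ0 : ζ ≠ 0 := hζ.ne_zero (by norm_num)
  have h11 := hζ.pow_eq_one
  have hq : ‖p ^ 2‖ < 1 := norm_pow_lt_one hp two_ne_zero
  have hE : qPoch (p ^ 2) (p ^ 2) ≠ 0 := qPoch_ne_zero_of_norm_lt_one hq hq
  have hw := winquist hp hp0 (pow_ne_zero 5 hζ0) (pow_ne_zero 2 hζ0)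
  have e7 : ζ ^ 5 * ζ ^ 2 = (ζ ^ 4)⁻¹ := by
    apply eq_inv_of_mul_eq_one_left; rw [← h11]; ring
  have e3 : ζ ^ 5 / ζ ^ 2 = ζ ^ 3 := by field_simp
  have hi : (ζ ^ 4)⁻¹ = ζ ^ 7 := by
    rw [inv_eq_of_mul_eq_one_right]; rw [← h11]; ring
  rw [e7, e3, jTheta_inv hp hp0 (pow_ne_zero 4 hζ0), hi] at hw
  have hpr := hζ.prod_range_qPoch (by norm_num) hq (p ^ 2)
  have k1 : (ζ ^ 1)⁻¹ = ζ ^ 10 := by rw [inv_eq_of_mul_eq_one_right]; rw [← h11]; ring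
  have k2 : (ζ ^ 2)⁻¹ = ζ ^ 9 := by rw [inv_eq_of_mul_eq_one_right]; rw [← h11]; ring
  have k3 : (ζ ^ 3)⁻¹ = ζ ^ 8 := by rw [inv_eq_of_mul_eq_one_right]; rw [← h11]; ring
  have k5 : (ζ ^ 5)⁻¹ = ζ ^ 6 := by rw [inv_eq_of_mul_eq_one_right]; rw [← h11]; ring
  have h22 : (p ^ 2) ^ 11 = p ^ 22 := by ring
  simp only [Finset.prod_range_succ, Finset.prod_range_zero, h22, pow_zero, one_mul] at hpr
  rw [jTheta_eq_one_sub_mul hp hp0 (pow_ne_zero 2 hζ0),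
    jTheta_eq_one_sub_mul hp hp0 (pow_ne_zero 3 hζ0),
    jTheta_eq_one_sub_mul hp hp0 (pow_ne_zero 4 hζ0),
    jTheta_eq_one_sub_mul hp hp0 (pow_ne_zero 5 hζ0), hi, k2, k3, k5] at hw
  rw [pow_one] at k1 hpr
  rw [k1, ← hpr]
  generalize winquistD p (ζ ^ 5) (ζ ^ 2) = D at *
  generalize qPoch (p ^ 2) (p ^ 2) = E at *
  clear hpr
  generalize qPoch (p ^ 2) (ζ * p ^ 2) = u1, qPoch (p ^ 2) (ζ ^ 2 * p ^ 2) = u2,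
    qPoch (p ^ 2) (ζ ^ 3 * p ^ 2) = u3, qPoch (p ^ 2) (ζ ^ 4 * p ^ 2) = u4,
    qPoch (p ^ 2) (ζ ^ 5 * p ^ 2) = u5, qPoch (p ^ 2) (ζ ^ 6 * p ^ 2) = u6,
    qPoch (p ^ 2) (ζ ^ 7 * p ^ 2) = u7, qPoch (p ^ 2) (ζ ^ 8 * p ^ 2) = u8,
    qPoch (p ^ 2) (ζ ^ 9 * p ^ 2) = u9, qPoch (p ^ 2) (ζ ^ 10 * p ^ 2) = u10 at *
  apply mul_left_cancel₀ (pow_ne_zero 2 hE)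
  linear_combination (ζ ^ 4 * u1 * u10) * hw +
    (E ^ 4 * (1 - ζ ^ 2) * (1 - ζ ^ 3) * (1 - ζ ^ 4) * (1 - ζ ^ 5) *
      (u1 * u2 * u3 * u4 * u5 * u6 * u7 * u8 * u9 * u10)) * h11

end JTheta

section LambertTheta

variable {p : ℂ}

theorem qPoch_ne_zero_pow (hp : ‖p‖ < 1) {m n : ℕ} (hm : m ≠ 0) (hn : n ≠ 0) :
    qPoch (p ^ m) (p ^ n) ≠ 0 :=
  qPoch_ne_zero_of_norm_lt_one (norm_pow_lt_one hp hm) (norm_pow_lt_one hp hn)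

theorem jTheta_pow_eq (hp : ‖p‖ < 1) (hp0 : p ≠ 0) {k : ℕ} (hk : k ≤ 11) :
    jTheta (p ^ 121) ((p ^ 22) ^ k) =
      qPoch (p ^ 242) (p ^ (22 * k)) * qPoch (p ^ 242) (p ^ (22 * (11 - k))) *
        qPoch (p ^ 242) (p ^ 242) := by
  rw [jTheta_eq_qPoch (norm_pow_lt_one hp (by norm_num)) (pow_ne_zero _ hp0)
    (pow_ne_zero _ (pow_ne_zero _ hp0))]
  have h1 : (p ^ 121) ^ 2 = p ^ 242 := by ring
  have h2 : p ^ 242 / p ^ (22 * k) = p ^ (22 * (11 - k)) := by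
    rw [div_eq_iff (pow_ne_zero _ hp0), ← pow_add]
    congr 1
    omega
  rw [h1, ← pow_mul, h2]

theorem jTheta_pow_sub (hp : ‖p‖ < 1) (hp0 : p ≠ 0) {k : ℕ} (hk : k ≤ 11) :
    jTheta (p ^ 121) ((p ^ 22) ^ (11 - k)) = jTheta (p ^ 121) ((p ^ 22) ^ k) := by
  rw [jTheta_pow_eq hp hp0 hk, jTheta_pow_eq hp hp0 (Nat.sub_le 11 k), Nat.sub_sub_self hk]
  ring

theorem jTheta_pow_ne_zero (hp : ‖p‖ < 1) (hp0 : p ≠ 0) {k : ℕ} (hk : k < 11) (hk0 : k ≠ 0) :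
    jTheta (p ^ 121) ((p ^ 22) ^ k) ≠ 0 := by
  rw [jTheta_pow_eq hp hp0 hk.le]
  exact mul_ne_zero (mul_ne_zero (qPoch_ne_zero_pow hp (by norm_num) (by omega))
    (qPoch_ne_zero_pow hp (by norm_num) (by omega))) (qPoch_ne_zero_pow hp (by norm_num)
      (by norm_num))

theorem prod_jTheta_pow (hp : ‖p‖ < 1) (hp0 : p ≠ 0) :
    jTheta (p ^ 121) ((p ^ 22) ^ 1) * jTheta (p ^ 121) ((p ^ 22) ^ 2) *
        jTheta (p ^ 121) ((p ^ 22) ^ 3) * jTheta (p ^ 121) ((p ^ 22) ^ 4) *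
        jTheta (p ^ 121) ((p ^ 22) ^ 5) =
      qPoch (p ^ 22) (p ^ 22) * qPoch (p ^ 242) (p ^ 242) ^ 4 := by
  rw [qPoch_eq_prod (p ^ 22) (p ^ 22) (norm_pow_lt_one hp (by norm_num)) (m := 11) (by norm_num)]
  simp only [Finset.prod_range_succ, Finset.prod_range_zero]
  have h (k : ℕ) : p ^ 22 * (p ^ 22) ^ k = p ^ (22 * (k + 1)) := by ring
  have h1 : (p ^ 22) ^ 11 = p ^ 242 := by ring
  simp only [h, h1]
  rw [jTheta_pow_eq hp hp0 (k := 1) (by norm_num), jTheta_pow_eq hp hp0 (k := 2) (by norm_num),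
    jTheta_pow_eq hp hp0 (k := 3) (by norm_num), jTheta_pow_eq hp hp0 (k := 4) (by norm_num),
    jTheta_pow_eq hp hp0 (k := 5) (by norm_num)]
  norm_num
  ring

theorem lambertSum_mul_jTheta (hp : ‖p‖ < 1) (hp0 : p ≠ 0) {α β : ℕ} (hα : α ≠ 0) (hβ : β ≠ 0)
    (h : α + β < 11) :
    lambertSum (p ^ 242) ((p ^ 22) ^ α) ((p ^ 22) ^ β) *
        (jTheta (p ^ 121) ((p ^ 22) ^ α) * jTheta (p ^ 121) ((p ^ 22) ^ β)) =
      qPoch (p ^ 242) (p ^ 242) ^ 3 * jTheta (p ^ 121) ((p ^ 22) ^ (α + β)) := by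
  have hpos : 0 < ‖p‖ := norm_pos_iff.2 hp0
  have hlt {k : ℕ} (hk : k < 11) : ‖p ^ 242‖ < ‖(p ^ 22) ^ k‖ := by
    rw [norm_pow, norm_pow, norm_pow, ← pow_mul]
    exact pow_lt_pow_right_of_lt_one₀ hpos hp (by omega)
  have hdiv {k : ℕ} (hk : k ≤ 11) : p ^ 242 / p ^ (22 * k) = p ^ (22 * (11 - k)) := by
    rw [div_eq_iff (pow_ne_zero _ hp0), ← pow_add]
    congr 1
    omega
  have hl := lambertSum_mul_qPoch (q := p ^ 242) (norm_pow_lt_one hp (by norm_num))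
    (pow_ne_zero _ hp0) (a := (p ^ 22) ^ α) (b := (p ^ 22) ^ β)
    (norm_pow_lt_one (norm_pow_lt_one hp (by norm_num)) hα) (hlt (by omega))
    (norm_pow_lt_one (norm_pow_lt_one hp (by norm_num)) hβ) (hlt (by omega))
  rw [← pow_add] at hl
  rw [jTheta_pow_eq hp hp0 (k := α) (by omega), jTheta_pow_eq hp hp0 (k := β) (by omega),
    jTheta_pow_eq hp hp0 (k := α + β) (by omega)]
  simp only [← pow_mul (p)] at hl ⊢
  rw [hdiv (by omega), hdiv (by omega), hdiv (by omega)] at hl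
  linear_combination qPoch (p ^ 242) (p ^ 242) ^ 2 * hl

theorem winquistD_pow_mul (hp : ‖p‖ < 1) (hp0 : p ≠ 0) {s t α β : ℕ} (hα : α ≠ 0) (hβ : β ≠ 0)
    (h : α + β < 11) (hts : t < s)
    (hJ : ∀ j : ℕ → ℂ, (∀ k ≤ 11, j (11 - k) = j k) →
      j s * j t * j (s + t) * j (s - t) * (j α * j β) =
        j (α + β) * (j 1 * j 2 * j 3 * j 4 * j 5)) :
    winquistD (p ^ 121) ((p ^ 22) ^ s) ((p ^ 22) ^ t) * qPoch (p ^ 242) (p ^ 242) *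
        (p ^ 22) ^ s =
      qPoch (p ^ 22) (p ^ 22) * lambertSum (p ^ 242) ((p ^ 22) ^ α) ((p ^ 22) ^ β) := by
  have hX : p ^ 22 ≠ 0 := pow_ne_zero _ hp0
  have hw := winquist (norm_pow_lt_one hp (n := 121) (by norm_num)) (pow_ne_zero _ hp0)
    (pow_ne_zero s hX) (pow_ne_zero t hX)
  have h1 : (p ^ 121) ^ 2 = p ^ 242 := by ring
  have h2 : (p ^ 22) ^ s / (p ^ 22) ^ t = (p ^ 22) ^ (s - t) := (pow_sub₀ _ hX hts.le).symm ▸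
    div_eq_mul_inv _ _
  rw [h1, h2, ← pow_add] at hw
  have hJ' := hJ (fun k => jTheta (p ^ 121) ((p ^ 22) ^ k)) fun k hk => jTheta_pow_sub hp hp0 hk
  have hl := lambertSum_mul_jTheta hp hp0 hα hβ h
  have hj1 := jTheta_pow_ne_zero hp hp0 (k := α) (by omega) hα
  have hj2 := jTheta_pow_ne_zero hp hp0 (k := β) (by omega) hβ
  have hE := qPoch_ne_zero_pow hp (m := 242) (n := 242) (by norm_num) (by norm_num)
  have hpr := prod_jTheta_pow hp hp0
  rw [hpr] at hJ'
  apply mul_right_cancel₀ (mul_ne_zero hE (mul_ne_zero hj1 hj2))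
  linear_combination -(jTheta (p ^ 121) ((p ^ 22) ^ α) * jTheta (p ^ 121) ((p ^ 22) ^ β)) * hw +
    hJ' - qPoch (p ^ 22) (p ^ 22) * qPoch (p ^ 242) (p ^ 242) * hl

end LambertTheta

section CrankDissection

variable {p : ℂ}

/-- The eleven-dissection of the crank product at a primitive eleventh root of unity, with the
components expressed by generalized Lambert series. -/
theorem crank_dissection (hp : ‖p‖ < 1) (hp0 : p ≠ 0) {ζ : ℂ} (hζ : IsPrimitiveRoot ζ 11) :
    qPoch (p ^ 2) (p ^ 2) * qPoch (p ^ 242) (p ^ 242) =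
      qPoch (p ^ 2) (ζ * p ^ 2) * qPoch (p ^ 2) (ζ⁻¹ * p ^ 2) *
        (lambertSum (p ^ 242) ((p ^ 22) ^ 1) ((p ^ 22) ^ 5) +
          (ζ + ζ ^ 10 - 1) * p ^ 2 * lambertSum (p ^ 242) ((p ^ 22) ^ 3) ((p ^ 22) ^ 2) +
          (ζ ^ 2 + ζ ^ 9) * p ^ 4 * lambertSum (p ^ 242) ((p ^ 22) ^ 7) ((p ^ 22) ^ 1) +
          (1 + ζ ^ 3 + ζ ^ 8) * p ^ 6 * lambertSum (p ^ 242) ((p ^ 22) ^ 8) ((p ^ 22) ^ 1) +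
          (1 + ζ ^ 2 + ζ ^ 9 + ζ ^ 4 + ζ ^ 7) * p ^ 8 *
            lambertSum (p ^ 242) ((p ^ 22) ^ 9) ((p ^ 22) ^ 1) -
          (ζ ^ 2 + ζ ^ 9 + ζ ^ 4 + ζ ^ 7) * p ^ 10 *
            lambertSum (p ^ 242) ((p ^ 22) ^ 5) ((p ^ 22) ^ 2) +
          (ζ + ζ ^ 10 + ζ ^ 4 + ζ ^ 7) * p ^ 14 *
            lambertSum (p ^ 242) ((p ^ 22) ^ 3) ((p ^ 22) ^ 4) +
          (ζ + ζ ^ 10 + ζ ^ 3 + ζ ^ 8 + ζ ^ 4 + ζ ^ 7) * p ^ 38 *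
            lambertSum (p ^ 242) ((p ^ 22) ^ 4) ((p ^ 22) ^ 6) -
          (1 + ζ ^ 4 + ζ ^ 7) * p ^ 18 * lambertSum (p ^ 242) ((p ^ 22) ^ 7) ((p ^ 22) ^ 2) -
          (ζ ^ 3 + ζ ^ 8) * p ^ 20 * lambertSum (p ^ 242) ((p ^ 22) ^ 5) ((p ^ 22) ^ 3)) := by
  have hw := winquistD_root_mul hp hp0 hζ
  have h11 := hζ.pow_eq_one
  have hΦ : ∑ i ∈ Finset.range 11, ζ ^ i = 0 := hζ.geom_sum_eq_zero (by norm_num)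
  simp only [Finset.sum_range_succ, Finset.sum_range_zero] at hΦ
  have hne (k : ℕ) (hk : k ≠ 0) (hk' : k < 11) : 1 - ζ ^ k ≠ 0 :=
    fun h => hζ.pow_ne_one_of_pos_of_lt hk hk' (sub_eq_zero.1 h).symm
  have hE : (1 - ζ ^ 2) * (1 - ζ ^ 3) * (1 - ζ ^ 4) * (1 - ζ ^ 5) ≠ 0 := by
    simp [hne]
  have hP : qPoch (p ^ 22) (p ^ 22) ≠ 0 := qPoch_ne_zero_pow hp (by norm_num) (by norm_num)
  simp only [zero_add, pow_zero, pow_one] at hΦ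
  have z0 : 1 * ((1 - ζ ^ 2) * (1 - ζ ^ 3) * (1 - ζ ^ 4) * (1 - ζ ^ 5)) =
      -ζ ^ 9 * (-((ζ ^ 5) ^ 2 - (ζ ^ 5) ^ 10) * (1 - ζ ^ 2) -
        (1 - ζ ^ 5) * -((ζ ^ 2) ^ 2 - (ζ ^ 2) ^ 10)) := by
    clear * - hΦ; grind
  have z1 : (ζ + ζ ^ 10 - 1) * ((1 - ζ ^ 2) * (1 - ζ ^ 3) * (1 - ζ ^ 4) * (1 - ζ ^ 5)) =
      -ζ ^ 9 * (-((ζ ^ 5) ^ 2 - (ζ ^ 5) ^ 10) * -((ζ ^ 2) ^ 3 - (ζ ^ 2) ^ 9) -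
        -((ζ ^ 5) ^ 3 - (ζ ^ 5) ^ 9) * -((ζ ^ 2) ^ 2 - (ζ ^ 2) ^ 10)) := by
    clear * - hΦ; grind
  have z2 : (ζ ^ 2 + ζ ^ 9) * ((1 - ζ ^ 2) * (1 - ζ ^ 3) * (1 - ζ ^ 4) * (1 - ζ ^ 5)) =
      -ζ ^ 9 * (-((ζ ^ 5) ^ 2 - (ζ ^ 5) ^ 10) * -((ζ ^ 2) ^ 8 - (ζ ^ 2) ^ 4) -
        -((ζ ^ 5) ^ 8 - (ζ ^ 5) ^ 4) * -((ζ ^ 2) ^ 2 - (ζ ^ 2) ^ 10)) := by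
    clear * - hΦ; grind
  have z3 : (1 + ζ ^ 3 + ζ ^ 8) * ((1 - ζ ^ 2) * (1 - ζ ^ 3) * (1 - ζ ^ 4) * (1 - ζ ^ 5)) =
      -ζ ^ 9 * (((ζ ^ 5) ^ 5 - (ζ ^ 5) ^ 7) * (1 - ζ ^ 2) -
        (1 - ζ ^ 5) * ((ζ ^ 2) ^ 5 - (ζ ^ 2) ^ 7)) := by
    clear * - hΦ; grind
  have z4 : (1 + ζ ^ 2 + ζ ^ 9 + ζ ^ 4 + ζ ^ 7) *
        ((1 - ζ ^ 2) * (1 - ζ ^ 3) * (1 - ζ ^ 4) * (1 - ζ ^ 5)) =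
      -ζ ^ 9 * (((ζ ^ 5) ^ 5 - (ζ ^ 5) ^ 7) * -((ζ ^ 2) ^ 3 - (ζ ^ 2) ^ 9) -
        -((ζ ^ 5) ^ 3 - (ζ ^ 5) ^ 9) * ((ζ ^ 2) ^ 5 - (ζ ^ 2) ^ 7)) := by
    clear * - hΦ; grind
  have z5 : -(ζ ^ 2 + ζ ^ 9 + ζ ^ 4 + ζ ^ 7) *
        ((1 - ζ ^ 2) * (1 - ζ ^ 3) * (1 - ζ ^ 4) * (1 - ζ ^ 5)) =
      -ζ ^ 9 * (((ζ ^ 5) ^ 5 - (ζ ^ 5) ^ 7) * -((ζ ^ 2) ^ 8 - (ζ ^ 2) ^ 4) -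
        -((ζ ^ 5) ^ 8 - (ζ ^ 5) ^ 4) * ((ζ ^ 2) ^ 5 - (ζ ^ 2) ^ 7)) := by
    clear * - hΦ; grind
  have z7 : (ζ + ζ ^ 10 + ζ ^ 4 + ζ ^ 7) * ((1 - ζ ^ 2) * (1 - ζ ^ 3) * (1 - ζ ^ 4) * (1 - ζ ^ 5)) =
      -ζ ^ 9 * (-((ζ ^ 5) ^ 2 - (ζ ^ 5) ^ 10) * ((ζ ^ 2) ^ 5 - (ζ ^ 2) ^ 7) -
        ((ζ ^ 5) ^ 5 - (ζ ^ 5) ^ 7) * -((ζ ^ 2) ^ 2 - (ζ ^ 2) ^ 10)) := by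
    clear * - hΦ; grind
  have z8 : (ζ + ζ ^ 10 + ζ ^ 3 + ζ ^ 8 + ζ ^ 4 + ζ ^ 7) *
        ((1 - ζ ^ 2) * (1 - ζ ^ 3) * (1 - ζ ^ 4) * (1 - ζ ^ 5)) =
      -ζ ^ 9 * ((1 - ζ ^ 5) * -((ζ ^ 2) ^ 3 - (ζ ^ 2) ^ 9) -
        -((ζ ^ 5) ^ 3 - (ζ ^ 5) ^ 9) * (1 - ζ ^ 2)) := by
    clear * - hΦ; grind
  have z9 : -(1 + ζ ^ 4 + ζ ^ 7) * ((1 - ζ ^ 2) * (1 - ζ ^ 3) * (1 - ζ ^ 4) * (1 - ζ ^ 5)) =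
      -ζ ^ 9 * (-((ζ ^ 5) ^ 8 - (ζ ^ 5) ^ 4) * (1 - ζ ^ 2) -
        (1 - ζ ^ 5) * -((ζ ^ 2) ^ 8 - (ζ ^ 2) ^ 4)) := by
    clear * - hΦ; grind
  have z10 : -(ζ ^ 3 + ζ ^ 8) * ((1 - ζ ^ 2) * (1 - ζ ^ 3) * (1 - ζ ^ 4) * (1 - ζ ^ 5)) =
      -ζ ^ 9 * (-((ζ ^ 5) ^ 8 - (ζ ^ 5) ^ 4) * -((ζ ^ 2) ^ 3 - (ζ ^ 2) ^ 9) -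
        -((ζ ^ 5) ^ 3 - (ζ ^ 5) ^ 9) * -((ζ ^ 2) ^ 8 - (ζ ^ 2) ^ 4)) := by
    clear * - hΦ; grind
  have r0 := winquistD_pow_mul hp hp0 (s := 5) (t := 2) (α := 1) (β := 5) (by norm_num)
    (by norm_num) (by norm_num) (by norm_num) (fun j hj => by
      have h6 := hj 5; have h7 := hj 4; norm_num at h6 h7 ⊢; rw [h6, h7]; ring)
  have r1 := winquistD_pow_mul hp hp0 (s := 5) (t := 1) (α := 3) (β := 2) (by norm_num)
    (by norm_num) (by norm_num) (by norm_num) (fun j hj => by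
      have h6 := hj 5; have h7 := hj 4; norm_num at h6 h7 ⊢; rw [h6]; ring)
  have r2 := winquistD_pow_mul hp hp0 (s := 5) (t := 3) (α := 7) (β := 1) (by norm_num)
    (by norm_num) (by norm_num) (by norm_num) (fun j hj => by
      have h7 := hj 4; norm_num at h7 ⊢; rw [h7]; ring)
  have r3 := winquistD_pow_mul hp hp0 (s := 4) (t := 2) (α := 8) (β := 1) (by norm_num)
    (by norm_num) (by norm_num) (by norm_num) (fun j hj => by
      have h6 := hj 5; have h8 := hj 3; have h9 := hj 2
      norm_num at h6 h8 h9 ⊢; rw [h6, h8, h9]; ring)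
  have r4 := winquistD_pow_mul hp hp0 (s := 4) (t := 1) (α := 9) (β := 1) (by norm_num)
    (by norm_num) (by norm_num) (by norm_num) (fun j hj => by
      have h9 := hj 2; have h10 := hj 1; norm_num at h9 h10 ⊢; rw [h9, h10]; ring)
  have r5 := winquistD_pow_mul hp hp0 (s := 4) (t := 3) (α := 5) (β := 2) (by norm_num)
    (by norm_num) (by norm_num) (by norm_num) (fun j hj => by
      norm_num; ring)
  have r7 := winquistD_pow_mul hp hp0 (s := 5) (t := 4) (α := 3) (β := 4) (by norm_num)
    (by norm_num) (by norm_num) (by norm_num) (fun j hj => by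
      have h7 := hj 4; have h9 := hj 2; norm_num at h7 h9 ⊢; rw [h7, h9]; ring)
  have r8 := winquistD_pow_mul hp hp0 (s := 2) (t := 1) (α := 4) (β := 6) (by norm_num)
    (by norm_num) (by norm_num) (by norm_num) (fun j hj => by
      have h6 := hj 5; have h10 := hj 1; norm_num at h6 h10 ⊢; rw [h6, h10]; ring)
  have r9 := winquistD_pow_mul hp hp0 (s := 3) (t := 2) (α := 7) (β := 2) (by norm_num)
    (by norm_num) (by norm_num) (by norm_num) (fun j hj => by
      have h7 := hj 4; have h9 := hj 2; norm_num at h7 h9 ⊢; rw [h7, h9]; ring)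
  have r10 := winquistD_pow_mul hp hp0 (s := 3) (t := 1) (α := 5) (β := 3) (by norm_num)
    (by norm_num) (by norm_num) (by norm_num) (fun j hj => by
      have h8 := hj 3; norm_num at h8 ⊢; rw [h8]; ring)
  rw [winquistD, winquistB_dissect hp hp0 (a := ζ ^ 5) (by rw [pow_right_comm, h11, one_pow]),
    winquistB_dissect hp hp0 (a := ζ ^ 2) (by rw [pow_right_comm, h11, one_pow]),
    winquistA_dissect hp hp0 (a := ζ ^ 5) (by rw [pow_right_comm, h11, one_pow]),
    winquistA_dissect hp hp0 (a := ζ ^ 2) (by rw [pow_right_comm, h11, one_pow])] at hw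
  simp only [winquistD, pow_one] at r0 r1 r2 r3 r4 r5 r7 r8 r9 r10
  simp only [pow_one]
  apply mul_left_cancel₀ (mul_ne_zero hE hP)
  clear hE hP hne hΦ h11 hζ
  generalize (1 - ζ ^ 2) * (1 - ζ ^ 3) * (1 - ζ ^ 4) * (1 - ζ ^ 5) = E at *
  generalize (ζ + ζ ^ 10 + ζ ^ 3 + ζ ^ 8 + ζ ^ 4 + ζ ^ 7) = k8,
    (1 + ζ ^ 2 + ζ ^ 9 + ζ ^ 4 + ζ ^ 7) = k4,
    (ζ ^ 2 + ζ ^ 9 + ζ ^ 4 + ζ ^ 7) = k5,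
    (ζ + ζ ^ 10 + ζ ^ 4 + ζ ^ 7) = k7,
    (1 + ζ ^ 4 + ζ ^ 7) = k9,
    (1 + ζ ^ 3 + ζ ^ 8) = k3,
    (ζ + ζ ^ 10 - 1) = k1,
    (ζ ^ 3 + ζ ^ 8) = k10 at *
  generalize ζ ^ 2 + ζ ^ 9 = k2 at *
  generalize ((ζ ^ 5) ^ 3 - (ζ ^ 5) ^ 9) = c1,
    (1 - ζ ^ 5) = c2,
    ((ζ ^ 5) ^ 8 - (ζ ^ 5) ^ 4) = c3,
    ((ζ ^ 5) ^ 5 - (ζ ^ 5) ^ 7) = c4,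
    ((ζ ^ 5) ^ 2 - (ζ ^ 5) ^ 10) = c5,
    ((ζ ^ 2) ^ 3 - (ζ ^ 2) ^ 9) = d1,
    (1 - ζ ^ 2) = d2,
    ((ζ ^ 2) ^ 8 - (ζ ^ 2) ^ 4) = d3,
    ((ζ ^ 2) ^ 5 - (ζ ^ 2) ^ 7) = d4,
    ((ζ ^ 2) ^ 2 - (ζ ^ 2) ^ 10) = d5 at *
  generalize qPoch (p ^ 2) (ζ * p ^ 2) * qPoch (p ^ 2) (ζ⁻¹ * p ^ 2) = U,
    -ζ ^ 9 = m at *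
  generalize winquistA (p ^ 121) (p ^ 22) = A1,
    winquistA (p ^ 121) ((p ^ 22) ^ 2) = A2,
    winquistA (p ^ 121) ((p ^ 22) ^ 3) = A3,
    winquistA (p ^ 121) ((p ^ 22) ^ 4) = A4,
    winquistA (p ^ 121) ((p ^ 22) ^ 5) = A5,
    winquistB (p ^ 121) (p ^ 22) = B1,
    winquistB (p ^ 121) ((p ^ 22) ^ 2) = B2,
    winquistB (p ^ 121) ((p ^ 22) ^ 3) = B3,
    winquistB (p ^ 121) ((p ^ 22) ^ 4) = B4,
    winquistB (p ^ 121) ((p ^ 22) ^ 5) = B5 at *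
  generalize lambertSum (p ^ 242) (p ^ 22) ((p ^ 22) ^ 5) = l0,
    lambertSum (p ^ 242) ((p ^ 22) ^ 3) ((p ^ 22) ^ 2) = l1,
    lambertSum (p ^ 242) ((p ^ 22) ^ 7) (p ^ 22) = l2,
    lambertSum (p ^ 242) ((p ^ 22) ^ 8) (p ^ 22) = l3,
    lambertSum (p ^ 242) ((p ^ 22) ^ 9) (p ^ 22) = l4,
    lambertSum (p ^ 242) ((p ^ 22) ^ 5) ((p ^ 22) ^ 2) = l5,
    lambertSum (p ^ 242) ((p ^ 22) ^ 3) ((p ^ 22) ^ 4) = l7,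
    lambertSum (p ^ 242) ((p ^ 22) ^ 4) ((p ^ 22) ^ 6) = l8,
    lambertSum (p ^ 242) ((p ^ 22) ^ 7) ((p ^ 22) ^ 2) = l9,
    lambertSum (p ^ 242) ((p ^ 22) ^ 5) ((p ^ 22) ^ 3) = l10 at *
  generalize qPoch (p ^ 242) (p ^ 242) = QQ,
    qPoch (p ^ 22) (p ^ 22) = PX,
    qPoch (p ^ 2) (p ^ 2) = Q at *
  linear_combination -QQ * hw - U * QQ *
      (p ^ 110 * (B5 * A2 - A5 * B2) * z0 + p ^ 112 * (B5 * A1 - A5 * B1) * z1 +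
      p ^ 114 * (B5 * A3 - A5 * B3) * z2 + p ^ 94 * (B4 * A2 - A4 * B2) * z3 +
      p ^ 96 * (B4 * A1 - A4 * B1) * z4 + p ^ 98 * (B4 * A3 - A4 * B3) * z5 +
      p ^ 124 * (B5 * A4 - A5 * B4) * z7 + p ^ 82 * (B2 * A1 - A2 * B1) * z8 +
      p ^ 84 * (B3 * A2 - A3 * B2) * z9 + p ^ 86 * (B3 * A1 - A3 * B1) * z10) +
      U * E * ((p ^ 0) * r0 + (k1 * p ^ 2) * r1 + (k2 * p ^ 4) * r2 + (k3 * p ^ 6) * r3 +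
      (k4 * p ^ 8) * r4 + (-k5 * p ^ 10) * r5 + (k7 * p ^ 14) * r7 + (k8 * p ^ 38) * r8 +
      (-k9 * p ^ 18) * r9 + (-k10 * p ^ 20) * r10)

end CrankDissection

section NonnegSeries

/-- `f` is given on `(0, 1)` by a convergent power series with nonnegative coefficients. -/
def HasNonnegSeries (f : ℝ → ℂ) : Prop :=
  ∃ τ : ℕ → ℝ, (∀ n, 0 ≤ τ n) ∧
    ∀ x : ℝ, 0 < x → x < 1 → HasSum (fun n => ((τ n * x ^ n : ℝ) : ℂ)) (f x)

variable {f g : ℝ → ℂ}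

theorem HasNonnegSeries.congr (hf : HasNonnegSeries f)
    (h : ∀ x : ℝ, 0 < x → x < 1 → f x = g x) : HasNonnegSeries g := by
  obtain ⟨τ, h0, hs⟩ := hf
  exact ⟨τ, h0, fun x hx hx' => h x hx hx' ▸ hs x hx hx'⟩

theorem hasNonnegSeries_monomial {c : ℝ} (hc : 0 ≤ c) (k : ℕ) :
    HasNonnegSeries fun x => ((c * x ^ k : ℝ) : ℂ) := by
  refine ⟨fun n => if n = k then c else 0, fun n => ?_, fun x _ _ => ?_⟩
  · dsimp only; split_ifs
    exacts [hc, le_rfl]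
  · convert hasSum_ite_eq k (((c * x ^ k : ℝ) : ℂ)) using 2 with n
    by_cases h : n = k <;> simp [h]

theorem HasNonnegSeries.of_hasSum {ι : Type*} {g : ι → ℝ → ℂ} (hg : ∀ i, HasNonnegSeries (g i))
    (h : ∀ x : ℝ, 0 < x → x < 1 → HasSum (fun i => g i x) (f x)) : HasNonnegSeries f := by
  choose τ h0 hτ using hg
  have hreal (i : ι) (x : ℝ) (hx : 0 < x) (hx' : x < 1) :
      ∃ r : ℝ, 0 ≤ r ∧ g i x = r ∧ HasSum (fun n => τ i n * x ^ n) r := by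
    have hs : Summable fun n => τ i n * x ^ n :=
      Complex.summable_ofReal.1 (hτ i x hx hx').summable
    refine ⟨∑' n, τ i n * x ^ n, tsum_nonneg fun n => mul_nonneg (h0 i n) (by positivity),
      ?_, hs.hasSum⟩
    exact (hτ i x hx hx').unique (Complex.hasSum_ofReal.2 hs.hasSum)
  have hsum (x : ℝ) (hx : 0 < x) (hx' : x < 1) :
      Summable fun p : ι × ℕ => τ p.1 p.2 * x ^ p.2 := by
    rw [summable_prod_of_nonneg fun p => mul_nonneg (h0 _ _) (by positivity)]
    refine ⟨fun i => ?_, ?_⟩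
    · obtain ⟨r, -, -, hr⟩ := hreal i x hx hx'
      exact hr.summable
    · refine Complex.summable_ofReal.1 ((h x hx hx').summable.congr fun i => ?_)
      obtain ⟨r, -, hr, hr'⟩ := hreal i x hx hx'
      rw [hr, hr'.tsum_eq]
  have hcoef (n : ℕ) : Summable fun i => τ i n := by
    have h1 := ((hsum (1 / 2) (by norm_num) (by norm_num)).comp_injective
      (i := fun i : ι => (i, n)) fun i j hij => (Prod.mk.inj hij).1).mul_right ((2 : ℝ) ^ n)
    refine h1.congr fun i => ?_
    simp only [Function.comp, one_div, inv_pow]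
    field_simp
  refine ⟨fun n => ∑' i, τ i n, fun n => tsum_nonneg fun i => h0 i n, fun x hx hx' => ?_⟩
  have hs := hsum x hx hx'
  obtain ⟨R, hR⟩ := hs
  have e1 : f x = (R : ℂ) := by
    refine (h x hx hx').unique ((Complex.hasSum_ofReal.2 hR).prod_fiberwise fun i => ?_)
    exact hτ i x hx hx'
  rw [e1]
  refine Complex.hasSum_ofReal.2 (((Equiv.prodComm ℕ ι).hasSum_iff.2 hR).prod_fiberwise fun n => ?_)
  exact (hcoef n).hasSum.mul_right (x ^ n)

theorem HasNonnegSeries.mul (hf : HasNonnegSeries f) (hg : HasNonnegSeries g) :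
    HasNonnegSeries fun x => f x * g x := by
  obtain ⟨τ, h0, hτ⟩ := hf
  obtain ⟨σ, h0', hσ⟩ := hg
  refine HasNonnegSeries.of_hasSum
    (g := fun (p : ℕ × ℕ) x => ((τ p.1 * σ p.2 * x ^ (p.1 + p.2) : ℝ) : ℂ))
    (fun p => hasNonnegSeries_monomial (mul_nonneg (h0 p.1) (h0' p.2)) (p.1 + p.2))
    fun x hx hx' => ?_
  have h1 := hτ x hx hx'
  have h2 := hσ x hx hx'
  have n1 : Summable fun n => ‖((τ n * x ^ n : ℝ) : ℂ)‖ := h1.summable.norm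
  have n2 : Summable fun n => ‖((σ n * x ^ n : ℝ) : ℂ)‖ := h2.summable.norm
  have n3 := summable_mul_of_summable_norm n1 n2
  have h3 := h1.mul h2 n3
  have e : (fun p : ℕ × ℕ => ((τ p.1 * σ p.2 * x ^ (p.1 + p.2) : ℝ) : ℂ)) =
      fun p => ((τ p.1 * x ^ p.1 : ℝ) : ℂ) * ((σ p.2 * x ^ p.2 : ℝ) : ℂ) := by
    funext p
    push_cast
    ring
  rw [e]
  exact h3

theorem HasNonnegSeries.sum {ι : Type*} (s : Finset ι) {g : ι → ℝ → ℂ}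
    (hg : ∀ i, HasNonnegSeries (g i)) : HasNonnegSeries fun x => ∑ i ∈ s, g i x := by
  refine HasNonnegSeries.of_hasSum (ι := s) (fun i => hg i) fun x _ _ => ?_
  exact Finset.hasSum s fun i => g i x

theorem hasNonnegSeries_one : HasNonnegSeries fun _ => 1 :=
  (hasNonnegSeries_monomial zero_le_one 0).congr fun x _ _ => by simp

theorem hasNonnegSeries_pow (k : ℕ) : HasNonnegSeries fun x => (x : ℂ) ^ k :=
  (hasNonnegSeries_monomial zero_le_one k).congr fun x _ _ => by simp

theorem norm_ofReal_pow_lt_one {x : ℝ} (hx : 0 < x) (hx' : x < 1) {k : ℕ} (hk : k ≠ 0) :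
    ‖(x : ℂ) ^ k‖ < 1 := by
  rw [norm_pow, Complex.norm_real, Real.norm_of_nonneg hx.le]
  exact pow_lt_one₀ hx.le hx' hk

theorem hasNonnegSeries_inv_one_sub {k : ℕ} (hk : k ≠ 0) :
    HasNonnegSeries fun x => (1 - (x : ℂ) ^ k)⁻¹ := by
  refine HasNonnegSeries.of_hasSum (fun j : ℕ => hasNonnegSeries_pow (k * j)) fun x hx hx' => ?_
  simp only [pow_mul]
  exact hasSum_geometric_of_norm_lt_one (norm_ofReal_pow_lt_one hx hx' hk)

theorem hasNonnegSeries_inv_prod {k : ℕ} (hk : k ≠ 0) (n : ℕ) :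
    HasNonnegSeries fun x => (∏ i ∈ Finset.range n, (1 - ((x : ℂ) ^ k) ^ (i + 1)))⁻¹ := by
  induction n with
  | zero => exact hasNonnegSeries_one.congr fun x _ _ => by simp
  | succ n ih =>
    refine (ih.mul (hasNonnegSeries_inv_one_sub
      (Nat.mul_ne_zero hk n.succ_ne_zero))).congr fun x _ _ => ?_
    rw [Finset.prod_range_succ, mul_inv, pow_mul]

/-- Euler's expansion shows that `1 / (x ^ (2 * k); x ^ k)_∞` has nonnegative coefficients. -/
theorem hasNonnegSeries_inv_qPoch {k : ℕ} (hk : k ≠ 0) :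
    HasNonnegSeries fun x => (qPoch ((x : ℂ) ^ k) (((x : ℂ) ^ k) ^ 2))⁻¹ := by
  refine HasNonnegSeries.of_hasSum (fun n : ℕ =>
    (hasNonnegSeries_pow (k * (2 * n))).mul (hasNonnegSeries_inv_prod hk n)) fun x hx hx' => ?_
  have hq := norm_ofReal_pow_lt_one hx hx' hk
  obtain ⟨q, hqe⟩ : ∃ q : ℂ, q = (x : ℂ) ^ k := ⟨_, rfl⟩
  simp only [pow_mul, ← hqe]
  rw [← hqe] at hq
  have hq2 : ‖q ^ 2‖ < 1 := norm_pow_lt_one hq two_ne_zero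
  have hne (n : ℕ) : 1 - q ^ (n + 1) ≠ 0 :=
    one_sub_ne_zero_of_norm_lt_one (norm_pow_lt_one hq n.succ_ne_zero)
  let t : ℕ → ℂ := fun n => (q ^ 2) ^ n * (∏ i ∈ Finset.range n, (1 - q ^ (i + 1)))⁻¹
  have ht (n : ℕ) : t (n + 1) * (1 - q ^ (n + 1)) = t n * (q ^ 2 - 0 * q ^ n) := by
    simp only [t, Finset.prod_range_succ, mul_inv]
    have := hne n
    field_simp
    ring
  have hs := (summable_norm_of_qbinomial_recursion hq hq2 ht).of_norm
  have h := tsum_mul_qPoch hq hq2 (by simp [t]) ht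
  have h0 : qPoch q 0 = 1 := by simp [qPoch]
  rw [h0] at h
  rw [← eq_inv_of_mul_eq_one_left h]
  exact hs.hasSum

end NonnegSeries

section LambertPositivity

variable {x : ℝ} {α β δ : ℕ}

theorem summable_of_le_mul_pow (hx : 0 < x) (hx' : x < 1) (hα : α ≠ 0) (hβ : β ≠ 0)
    {e : ℕ × ℕ → ℕ} (he : ∀ p, α * p.1 + β * p.2 ≤ e p) :
    Summable fun p : ℕ × ℕ => (x : ℂ) ^ e p := by
  have h1 : Summable fun n : ℕ => (x ^ α) ^ n :=
    summable_geometric_of_lt_one (by positivity) (pow_lt_one₀ hx.le hx' hα)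
  have h2 : Summable fun n : ℕ => (x ^ β) ^ n :=
    summable_geometric_of_lt_one (by positivity) (pow_lt_one₀ hx.le hx' hβ)
  refine Summable.of_norm_bounded (h1.mul_of_nonneg h2 (fun n => by positivity)
    fun n => by positivity) fun p => ?_
  rw [norm_pow, Complex.norm_real, Real.norm_of_nonneg hx.le, ← pow_mul, ← pow_mul, ← pow_add]
  exact pow_le_pow_of_le_one hx.le hx'.le (he p)

theorem hasSum_of_eq_mul_pow {a b s : ℂ} {f : ℕ → ℂ} (hb : ‖b‖ < 1) (hf : ∀ j, f j = a * b ^ j)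
    (hs : s = a * (1 - b)⁻¹) : HasSum f s := by
  rw [funext hf, hs]
  exact (hasSum_geometric_of_norm_lt_one hb).mul_left a

theorem hasSum_lambertSum_natCast (hx : 0 < x) (hx' : x < 1) (hα : α ≠ 0) (n : ℕ) :
    HasSum (fun j : ℕ => (x : ℂ) ^ (β * n + α * j + (α + β + δ) * (n * j)))
      (((x : ℂ) ^ β) ^ (n : ℤ) / (1 - (x : ℂ) ^ α * ((x : ℂ) ^ (α + β + δ)) ^ (n : ℤ))) := by
  have hlt := norm_ofReal_pow_lt_one hx hx' (k := α + (α + β + δ) * n) (by omega)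
  refine hasSum_of_eq_mul_pow (a := (x : ℂ) ^ (β * n)) hlt (fun j => ?_) ?_
  · rw [← pow_mul, ← pow_add]
    congr 1
    ring
  · rw [zpow_natCast, zpow_natCast, ← pow_mul, ← pow_mul, ← pow_add, div_eq_mul_inv]

theorem div_one_sub_inv_mul {K : Type*} [Field K] {u v : K} (hu : u ≠ 0) (hv : v ≠ 0)
    (h : 1 - u * v ≠ 0) : u⁻¹ / (1 - (u * v)⁻¹) = -v * (1 - u * v)⁻¹ := by
  have h3 : 1 - (u * v)⁻¹ ≠ 0 := by
    intro h'
    apply h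
    rw [sub_eq_zero] at h' ⊢
    rw [← inv_inv (u * v), ← h', inv_one]
  rw [div_eq_iff h3]
  field_simp
  ring

theorem hasSum_lambertSum_negSucc (hx : 0 < x) (hx' : x < 1) (hβ : β ≠ 0) (n : ℕ) :
    HasSum (fun j : ℕ => -(x : ℂ) ^ (β * (n + 1) * j + α * (j + 1) * n + δ * (n + 1) * (j + 1)))
      (((x : ℂ) ^ β) ^ (-((n : ℤ) + 1)) /
        (1 - (x : ℂ) ^ α * ((x : ℂ) ^ (α + β + δ)) ^ (-((n : ℤ) + 1)))) := by
  have hx0 : (x : ℂ) ≠ 0 := Complex.ofReal_ne_zero.2 hx.ne'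
  have h : β * (n + 1) ≠ 0 := Nat.mul_ne_zero hβ n.succ_ne_zero
  have hlt := norm_ofReal_pow_lt_one hx hx' (k := β * (n + 1) + (α * n + δ * (n + 1))) (by omega)
  refine hasSum_of_eq_mul_pow (a := -(x : ℂ) ^ (α * n + δ * (n + 1))) hlt (fun j => ?_) ?_
  · rw [neg_mul, ← pow_mul, ← pow_add]
    congr 2
    ring
  · have hne := one_sub_ne_zero_of_norm_lt_one hlt
    have e1 : ((x : ℂ) ^ β) ^ (-((n : ℤ) + 1)) = ((x : ℂ) ^ (β * (n + 1)))⁻¹ := by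
      rw [zpow_neg, ← Nat.cast_succ, zpow_natCast, ← pow_mul]
    have e2 : (x : ℂ) ^ α * ((x : ℂ) ^ (α + β + δ)) ^ (-((n : ℤ) + 1)) =
        ((x : ℂ) ^ (β * (n + 1) + (α * n + δ * (n + 1))))⁻¹ := by
      rw [zpow_neg, ← Nat.cast_succ, zpow_natCast, ← pow_mul, ← div_eq_mul_inv,
        div_eq_iff (pow_ne_zero _ hx0), eq_inv_mul_iff_mul_eq₀ (pow_ne_zero _ hx0), ← pow_add]
      congr 1
      simp only [Nat.succ_eq_add_one]
      ring
    rw [e1, e2]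
    rw [pow_add] at hne ⊢
    exact (div_one_sub_inv_mul (pow_ne_zero _ hx0) (pow_ne_zero _ hx0) hne)

theorem exists_hasSum_lambertSum (hx : 0 < x) (hx' : x < 1) (hα : α ≠ 0) (hβ : β ≠ 0) :
    ∃ A B : ℂ,
      HasSum (fun p : ℕ × ℕ => (x : ℂ) ^ (β * p.1 + α * p.2 + (α + β + δ) * (p.1 * p.2))) A ∧
      HasSum (fun p : ℕ × ℕ => (x : ℂ) ^ (β * (p.1 + 1) * p.2 + α * (p.2 + 1) * p.1 +
        δ * (p.1 + 1) * (p.2 + 1))) B ∧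
      lambertSum ((x : ℂ) ^ (α + β + δ)) ((x : ℂ) ^ α) ((x : ℂ) ^ β) = A - B := by
  have s1 := summable_of_le_mul_pow hx hx' hβ hα
    (e := fun p : ℕ × ℕ => β * p.1 + α * p.2 + (α + β + δ) * (p.1 * p.2))
    fun p => Nat.le_add_right _ _
  have s2 := summable_of_le_mul_pow hx hx' hα hβ
    (e := fun p : ℕ × ℕ => β * (p.1 + 1) * p.2 + α * (p.2 + 1) * p.1 +
        δ * (p.1 + 1) * (p.2 + 1)) fun p => by
      have h1 : α * (p.2 + 1) * p.1 = α * p.1 + α * p.2 * p.1 := by ring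
      have h2 : β * (p.1 + 1) * p.2 = β * p.2 + β * p.1 * p.2 := by ring
      have := Nat.zero_le (δ * (p.1 + 1) * (p.2 + 1))
      have := Nat.zero_le (α * p.2 * p.1)
      have := Nat.zero_le (β * p.1 * p.2)
      omega
  obtain ⟨A, hA⟩ := s1
  obtain ⟨B, hB⟩ := s2
  refine ⟨A, B, hA, hB, ?_⟩
  have hB' : HasSum (fun p : ℕ × ℕ => -(x : ℂ) ^ (β * (p.1 + 1) * p.2 + α * (p.2 + 1) * p.1 +
      δ * (p.1 + 1) * (p.2 + 1))) (-B) := hB.neg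
  have f1 := hA.prod_fiberwise (hasSum_lambertSum_natCast hx hx' hα)
  have f2 := hB'.prod_fiberwise (hasSum_lambertSum_negSucc hx hx' hβ)
  have f3 := HasSum.of_nat_of_neg_add_one (f := fun n : ℤ => ((x : ℂ) ^ β) ^ n /
    (1 - (x : ℂ) ^ α * ((x : ℂ) ^ (α + β + δ)) ^ n)) f1 f2
  rw [lambertSum, sub_eq_add_neg]
  exact f3.tsum_eq

theorem hasNonnegSeries_lambertSum_div_one_sub {k : ℕ} (hα : α ≠ 0) (hβ : β ≠ 0) :
    HasNonnegSeries fun x => lambertSum ((x : ℂ) ^ (α + (k + 1) * β)) ((x : ℂ) ^ α)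
      ((x : ℂ) ^ β) * (1 - (x : ℂ) ^ (α + (k + 1) * β))⁻¹ := by
  obtain ⟨M, hM⟩ : ∃ M, M = α + (k + 1) * β := ⟨_, rfl⟩
  have hM' : M = α + β + k * β := by rw [hM]; ring
  let e₁ : (ℕ × ℕ) × Fin (k + 1) ≃ ℕ × ℕ :=
    ((Equiv.prodAssoc ℕ ℕ (Fin (k + 1))).trans (Equiv.prodCongr (Equiv.refl ℕ)
      ((Equiv.prodCongr (Equiv.refl ℕ) Fin.revPerm).trans (Nat.divModEquiv (k + 1)).symm))).trans
      (Equiv.prodComm ℕ ℕ)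
  let e₂ : (ℕ × ℕ) × Fin (k + 1) ≃ ℕ × ℕ :=
    (Equiv.prodCongr (Equiv.prodComm ℕ ℕ) (Equiv.refl _)).trans
      ((Equiv.prodAssoc ℕ ℕ (Fin (k + 1))).trans (Equiv.prodCongr (Equiv.refl ℕ)
      (Nat.divModEquiv (k + 1)).symm) |>.trans (Equiv.prodComm ℕ ℕ))
  have he₁ (s u : ℕ) (r : Fin (k + 1)) : e₁ ((s, u), r) = (u * (k + 1) + (k - r), s) := by
    simp [e₁, Nat.divModEquiv, Fin.val_rev]
  have he₂ (s u : ℕ) (r : Fin (k + 1)) : e₂ ((s, u), r) = (s * (k + 1) + r, u) := by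
    simp [e₂, Nat.divModEquiv]
  refine HasNonnegSeries.of_hasSum (ι := (ℕ × ℕ) × Fin (k + 1))
    (g := fun p x => (x : ℂ) ^ (β * (e₁ p).1 + α * (e₁ p).2 + M * ((e₁ p).1 * (e₁ p).2)) *
      ∑ j ∈ Finset.range (p.2 * (p.1.1 + p.1.2 + 1)), (x : ℂ) ^ (M * j))
    (fun p => (hasNonnegSeries_pow _).mul (HasNonnegSeries.sum _ fun j => hasNonnegSeries_pow _))
    fun x hx hx' => ?_
  obtain ⟨A, B, hA, hB, hl⟩ := exists_hasSum_lambertSum (δ := k * β) hx hx' hα hβ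
  rw [← hM, hM', hl]
  have hne : 1 - (x : ℂ) ^ M ≠ 0 :=
    one_sub_ne_zero_of_norm_lt_one (norm_ofReal_pow_lt_one hx hx' (by omega))
  rw [← hM'] at hA ⊢
  have h := ((e₁.hasSum_iff.2 hA).sub (e₂.hasSum_iff.2 hB)).mul_right (1 - (x : ℂ) ^ M)⁻¹
  refine Eq.subst (motive := fun F => HasSum F _) (funext fun p => ?_) h
  symm
  obtain ⟨⟨s, u⟩, r⟩ := p
  rw [eq_mul_inv_iff_mul_eq₀ hne]
  simp only [Function.comp, pow_mul (x : ℂ) M]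
  rw [mul_assoc, geom_sum_mul_neg, mul_sub, mul_one, ← pow_mul, ← pow_add, he₁, he₂]
  congr 2
  obtain ⟨v, hv⟩ : ∃ v, k = r + v := Nat.exists_eq_add_of_le (Nat.lt_succ_iff.1 r.2)
  have hv' : k - r = v := by omega
  dsimp only
  rw [hv']
  clear he₁ he₂ h hv'
  generalize (r : ℕ) = w at *
  rw [hM, hv]
  ring

/-- The generalized Lambert series divided by the Euler product has nonnegative coefficients. -/
theorem hasNonnegSeries_lambertSum_div_qPoch {k : ℕ} (hα : α ≠ 0) (hβ : β ≠ 0) :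
    HasNonnegSeries fun x => lambertSum ((x : ℂ) ^ (α + (k + 1) * β)) ((x : ℂ) ^ α)
      ((x : ℂ) ^ β) / qPoch ((x : ℂ) ^ (α + (k + 1) * β)) ((x : ℂ) ^ (α + (k + 1) * β)) := by
  have hM : α + (k + 1) * β ≠ 0 := by omega
  refine ((hasNonnegSeries_lambertSum_div_one_sub (k := k) hα hβ).mul
    (hasNonnegSeries_inv_qPoch hM)).congr fun x hx hx' => ?_
  rw [qPoch_eq_mul (norm_ofReal_pow_lt_one hx hx' hM) ((x : ℂ) ^ (α + (k + 1) * β)), ← pow_two,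
    div_eq_mul_inv, mul_inv, mul_assoc]

theorem exists_sub_lambertSum_div_qPoch (hα : α ≠ 0) (hβ : β ≠ 0) :
    ∃ f g : ℝ → ℂ, HasNonnegSeries f ∧ HasNonnegSeries g ∧ ∀ x : ℝ, 0 < x → x < 1 →
      lambertSum ((x : ℂ) ^ (α + β + δ)) ((x : ℂ) ^ α) ((x : ℂ) ^ β) /
        qPoch ((x : ℂ) ^ (α + β + δ)) ((x : ℂ) ^ (α + β + δ)) = f x - g x := by
  have hM : α + β + δ ≠ 0 := by omega
  have hE := (hasNonnegSeries_inv_qPoch hM).mul (hasNonnegSeries_inv_one_sub hM)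
  have hA : HasNonnegSeries fun x => ∑' p : ℕ × ℕ,
      (x : ℂ) ^ (β * p.1 + α * p.2 + (α + β + δ) * (p.1 * p.2)) := by
    refine HasNonnegSeries.of_hasSum (g := fun (p : ℕ × ℕ) x =>
      (x : ℂ) ^ (β * p.1 + α * p.2 + (α + β + δ) * (p.1 * p.2)))
      (fun p => hasNonnegSeries_pow _) fun x hx hx' => ?_
    obtain ⟨A, B, hA, hB, hl⟩ := exists_hasSum_lambertSum (δ := δ) hx hx' hα hβ
    exact hA.summable.hasSum
  have hB : HasNonnegSeries fun x => ∑' p : ℕ × ℕ, (x : ℂ) ^ (β * (p.1 + 1) * p.2 +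
      α * (p.2 + 1) * p.1 + δ * (p.1 + 1) * (p.2 + 1)) := by
    refine HasNonnegSeries.of_hasSum (g := fun (p : ℕ × ℕ) x => (x : ℂ) ^ (β * (p.1 + 1) * p.2 +
      α * (p.2 + 1) * p.1 + δ * (p.1 + 1) * (p.2 + 1)))
      (fun p => hasNonnegSeries_pow _) fun x hx hx' => ?_
    obtain ⟨A, B, hA, hB, hl⟩ := exists_hasSum_lambertSum (δ := δ) hx hx' hα hβ
    exact hB.summable.hasSum
  refine ⟨_, _, hA.mul hE, hB.mul hE, fun x hx hx' => ?_⟩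
  obtain ⟨A, B, hA, hB, hl⟩ := exists_hasSum_lambertSum (δ := δ) hx hx' hα hβ
  rw [hA.tsum_eq, hB.tsum_eq, hl, qPoch_eq_mul (norm_ofReal_pow_lt_one hx hx' hM)
    ((x : ℂ) ^ (α + β + δ)), ← pow_two, div_eq_mul_inv, mul_inv]
  ring

end LambertPositivity

section CrankSeries

theorem hasSum_of_residues {m : ℕ} (hm : m ≠ 0) {f S : ℕ → ℂ}
    (h : ∀ r < m, HasSum (fun n => f (m * n + r)) (S r)) :
    HasSum f (∑ r ∈ Finset.range m, S r) := by
  have h1 : ∀ r ∈ Finset.range m, HasSum (fun N => if N % m = r then f N else 0) (S r) := by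
    intro r hr
    rw [Finset.mem_range] at hr
    have hinj : Function.Injective fun n => m * n + r := fun a b hab =>
      Nat.eq_of_mul_eq_mul_left (Nat.pos_of_ne_zero hm) (Nat.add_right_cancel hab)
    rw [← hinj.hasSum_iff]
    · have e : (fun N => if N % m = r then f N else 0) ∘ (fun n => m * n + r) =
          fun n => f (m * n + r) := by
        funext n
        simp [Nat.mod_eq_of_lt hr]
      rw [e]
      exact h r hr
    · intro N hN
      rw [if_neg]
      rintro rfl
      exact hN ⟨N / m, Nat.div_add_mod N m⟩
  have h2 := hasSum_sum h1
  have e : (fun N => ∑ r ∈ Finset.range m, if N % m = r then f N else 0) = f := by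
    funext N
    rw [Finset.sum_ite_eq, if_pos (Finset.mem_range.2 (Nat.mod_lt _ (Nat.pos_of_ne_zero hm)))]
  rwa [e] at h2

/-- The coefficients of `1, ζ, …, ζ ^ 10` in the component of the crank generating function
supported on the residue class `r` modulo `11`. -/
def crankClassCoeffs : ℕ → List ℤ
  | 0 => [1]
  | 1 => [-1, 1, 0, 0, 0, 0, 0, 0, 0, 0, 1]
  | 2 => [0, 0, 1, 0, 0, 0, 0, 0, 0, 1]
  | 3 => [1, 0, 0, 1, 0, 0, 0, 0, 1]
  | 4 => [1, 0, 1, 0, 1, 0, 0, 1, 0, 1]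
  | 5 => [0, 0, -1, 0, -1, 0, 0, -1, 0, -1]
  | 7 => [0, 1, 0, 0, 1, 0, 0, 1, 0, 0, 1]
  | 8 => [0, 1, 0, 1, 1, 0, 0, 1, 1, 0, 1]
  | 9 => [-1, 0, 0, 0, -1, 0, 0, -1]
  | 10 => [0, 0, 0, -1, 0, 0, 0, 0, -1]
  | _ => []

noncomputable def crankClassValue (ζ : ℂ) (r : ℕ) : ℂ :=
  ∑ b ∈ Finset.range 11, ((crankClassCoeffs r).getD b 0 : ℂ) * ζ ^ b

/-- The Lambert quotients attached to the residue classes modulo `11`. -/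
noncomputable def crankClassQuotient (α β : ℕ) (x : ℝ) : ℂ :=
  lambertSum ((x : ℂ) ^ 11) ((x : ℂ) ^ α) ((x : ℂ) ^ β) / qPoch ((x : ℂ) ^ 11) ((x : ℂ) ^ 11)

noncomputable def crankClassFun : ℕ → ℝ → ℂ
  | 0 => crankClassQuotient 1 5
  | 1 => crankClassQuotient 3 2
  | 2 => crankClassQuotient 7 1
  | 3 => crankClassQuotient 8 1
  | 4 => crankClassQuotient 9 1
  | 5 => crankClassQuotient 5 2
  | 7 => crankClassQuotient 3 4
  | 8 => fun x => x * crankClassQuotient 4 6 x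
  | 9 => crankClassQuotient 7 2
  | 10 => crankClassQuotient 5 3
  | _ => fun _ => 0

theorem exists_hasSum_crankClassFun (r : ℕ) : ∃ τ : ℕ → ℝ, (r ≠ 8 → ∀ n, 0 ≤ τ n) ∧
    ∀ x : ℝ, 0 < x → x < 1 → HasSum (fun n => ((τ n * x ^ n : ℝ) : ℂ)) (crankClassFun r x) := by
  have key : ∀ {f : ℝ → ℂ}, HasNonnegSeries f → ∃ τ : ℕ → ℝ, (r ≠ 8 → ∀ n, 0 ≤ τ n) ∧
      ∀ x : ℝ, 0 < x → x < 1 → HasSum (fun n => ((τ n * x ^ n : ℝ) : ℂ)) (f x) :=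
    fun ⟨τ, h0, h⟩ => ⟨τ, fun _ => h0, h⟩
  unfold crankClassFun
  split
  · exact key (hasNonnegSeries_lambertSum_div_qPoch (k := 1) (α := 1) (β := 5) (by simp) (by simp))
  · exact key (hasNonnegSeries_lambertSum_div_qPoch (k := 3) (α := 3) (β := 2) (by simp) (by simp))
  · exact key (hasNonnegSeries_lambertSum_div_qPoch (k := 3) (α := 7) (β := 1) (by simp) (by simp))
  · exact key (hasNonnegSeries_lambertSum_div_qPoch (k := 2) (α := 8) (β := 1) (by simp) (by simp))
  · exact key (hasNonnegSeries_lambertSum_div_qPoch (k := 1) (α := 9) (β := 1) (by simp) (by simp))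
  · exact key (hasNonnegSeries_lambertSum_div_qPoch (k := 2) (α := 5) (β := 2) (by simp) (by simp))
  · exact key (hasNonnegSeries_lambertSum_div_qPoch (k := 1) (α := 3) (β := 4) (by simp) (by simp))
  · obtain ⟨f, g, ⟨σ, -, hσ⟩, ⟨τ, -, hτ⟩, h⟩ :=
      exists_sub_lambertSum_div_qPoch (α := 4) (β := 6) (δ := 1) (by simp) (by simp)
    refine ⟨fun n => Nat.casesOn n 0 fun n => σ n - τ n, fun h => absurd rfl h,
      fun x hx hx' => ?_⟩
    have h1 := ((hσ x hx hx').sub (hτ x hx hx')).mul_left (x : ℂ)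
    rw [← h x hx hx'] at h1
    rw [← hasSum_nat_add_iff' 1]
    have e : (fun n => (((Nat.casesOn (n + 1) 0 fun n => σ n - τ n : ℝ) * x ^ (n + 1) : ℝ) : ℂ)) =
        fun n => (x : ℂ) * (((σ n * x ^ n : ℝ) : ℂ) - ((τ n * x ^ n : ℝ) : ℂ)) := by
      funext n
      push_cast
      ring
    rw [e]
    rw [Finset.sum_range_one]
    refine Eq.subst (motive := fun a => HasSum _ a) ?_ h1
    simp [crankClassQuotient]
  · exact key (hasNonnegSeries_lambertSum_div_qPoch (k := 1) (α := 7) (β := 2) (by simp) (by simp))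
  · exact key (hasNonnegSeries_lambertSum_div_qPoch (k := 1) (α := 5) (β := 3) (by simp) (by simp))
  · refine ⟨0, fun _ n => le_rfl, fun x _ _ => ?_⟩
    simp

theorem sum_crankClassFun_mul {x : ℝ} (hx : 0 < x) (hx' : x < 1) {ζ : ℂ}
    (hζ : IsPrimitiveRoot ζ 11) :
    (∑ r ∈ Finset.range 11, crankClassValue ζ r * (x : ℂ) ^ r * crankClassFun r (x ^ 11)) *
      (qPoch x (ζ * x) * qPoch x (ζ⁻¹ * x)) = qPoch x x := by
  obtain ⟨p, hp, rfl⟩ : ∃ p : ℝ, 0 < p ∧ p ^ 2 = x := ⟨√x, Real.sqrt_pos.2 hx, Real.sq_sqrt hx.le⟩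
  have hp1 : p < 1 := by nlinarith
  have hpn : ‖(p : ℂ)‖ < 1 := by
    rw [Complex.norm_real, Real.norm_of_nonneg hp.le]
    exact hp1
  have h := crank_dissection hpn (Complex.ofReal_ne_zero.2 hp.ne') hζ
  have hE : qPoch ((p : ℂ) ^ 242) ((p : ℂ) ^ 242) ≠ 0 :=
    qPoch_ne_zero_of_norm_lt_one (norm_pow_lt_one hpn (by norm_num))
      (norm_pow_lt_one hpn (by norm_num))
  have e1 : ((((p ^ 2) ^ 11 : ℝ)) : ℂ) = (p : ℂ) ^ 22 := by push_cast; ring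
  have e2 : ((p : ℂ) ^ 22) ^ 11 = (p : ℂ) ^ 242 := by ring
  simp only [Finset.sum_range_succ, Finset.sum_range_zero, crankClassFun, crankClassQuotient,
    crankClassValue, crankClassCoeffs, e1, e2]
  push_cast
  simp only [List.getD_cons_zero, List.getD_cons_succ, List.getD_nil]
  rw [← mul_left_inj' hE, h]
  clear h hζ
  generalize qPoch ((p : ℂ) ^ 242) ((p : ℂ) ^ 242) = E, qPoch ((p : ℂ) ^ 2) (ζ * (p : ℂ) ^ 2) = u,
    qPoch ((p : ℂ) ^ 2) (ζ⁻¹ * (p : ℂ) ^ 2) = v,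
    lambertSum ((p : ℂ) ^ 242) (((p : ℂ) ^ 22) ^ 1) (((p : ℂ) ^ 22) ^ 5) = l₀,
    lambertSum ((p : ℂ) ^ 242) (((p : ℂ) ^ 22) ^ 3) (((p : ℂ) ^ 22) ^ 2) = l₁,
    lambertSum ((p : ℂ) ^ 242) (((p : ℂ) ^ 22) ^ 7) (((p : ℂ) ^ 22) ^ 1) = l₂,
    lambertSum ((p : ℂ) ^ 242) (((p : ℂ) ^ 22) ^ 8) (((p : ℂ) ^ 22) ^ 1) = l₃,
    lambertSum ((p : ℂ) ^ 242) (((p : ℂ) ^ 22) ^ 9) (((p : ℂ) ^ 22) ^ 1) = l₄,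
    lambertSum ((p : ℂ) ^ 242) (((p : ℂ) ^ 22) ^ 5) (((p : ℂ) ^ 22) ^ 2) = l₅,
    lambertSum ((p : ℂ) ^ 242) (((p : ℂ) ^ 22) ^ 3) (((p : ℂ) ^ 22) ^ 4) = l₆,
    lambertSum ((p : ℂ) ^ 242) (((p : ℂ) ^ 22) ^ 4) (((p : ℂ) ^ 22) ^ 6) = l₇,
    lambertSum ((p : ℂ) ^ 242) (((p : ℂ) ^ 22) ^ 7) (((p : ℂ) ^ 22) ^ 2) = l₈,
    lambertSum ((p : ℂ) ^ 242) (((p : ℂ) ^ 22) ^ 5) (((p : ℂ) ^ 22) ^ 3) = l₉ at *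
  norm_num only [Int.cast_zero, Int.cast_one, Int.cast_neg]
  field_simp
  ring

theorem exists_crank_series : ∃ τ : ℕ → ℕ → ℝ, (∀ r, r ≠ 8 → ∀ n, 0 ≤ τ r n) ∧
    ∀ ζ : ℂ, IsPrimitiveRoot ζ 11 → ∀ x : ℝ, 0 < x → x < 1 → ∃ S : ℂ,
      HasSum (fun n : ℕ => crankClassValue ζ (n % 11) * τ (n % 11) (n / 11) * (x : ℂ) ^ n) S ∧
      S * (qPoch x (ζ * x) * qPoch x (ζ⁻¹ * x)) = qPoch x x := by
  choose τ h0 hτ using exists_hasSum_crankClassFun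
  refine ⟨τ, h0, fun ζ hζ x hx hx' => ⟨_, hasSum_of_residues (by norm_num) fun r hr => ?_,
    sum_crankClassFun_mul hx hx' hζ⟩⟩
  have h := (hτ r (x ^ 11) (by positivity) (pow_lt_one₀ hx.le hx' (by norm_num))).mul_left
    (crankClassValue ζ r * (x : ℂ) ^ r)
  refine Eq.subst (motive := fun F => HasSum F _) (funext fun n => ?_) h
  rw [Nat.mul_add_mod, Nat.mod_eq_of_lt hr, Nat.mul_add_div (by norm_num), Nat.div_eq_of_lt hr,
    add_zero, pow_add, pow_mul]
  push_cast
  ring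

end CrankSeries

section EulerSeries

open PowerSeries

variable {R : Type*} [CommRing R]

noncomputable def eulerPartial (c : R) (m : ℕ) : R⟦X⟧ :=
  ∏ i ∈ Finset.range m, (1 - C c * X ^ (i + 1))

/-- The formal power series `∏ (1 - c X ^ i)`, the product being over `i ≥ 1`. -/
noncomputable def eulerSeries (c : R) : R⟦X⟧ :=
  PowerSeries.mk fun n => coeff n (eulerPartial c n)

theorem coeff_eulerPartial_succ (c : R) (m n : ℕ) :
    coeff n (eulerPartial c (m + 1)) = coeff n (eulerPartial c m) -
      if m + 1 ≤ n then c * coeff (n - (m + 1)) (eulerPartial c m) else 0 := by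
  rw [eulerPartial, Finset.prod_range_succ, ← eulerPartial, mul_sub, mul_one, map_sub,
    show eulerPartial c m * (C c * X ^ (m + 1)) = C c * (X ^ (m + 1) * eulerPartial c m) by ring,
    coeff_C_mul, coeff_X_pow_mul']
  split_ifs <;> simp

theorem coeff_eulerPartial_of_le (c : R) {m n : ℕ} (h : n ≤ m) :
    coeff n (eulerPartial c m) = coeff n (eulerSeries c) := by
  induction m, h using Nat.le_induction with
  | base => rw [eulerSeries, coeff_mk]
  | succ m hm ih => rw [coeff_eulerPartial_succ, if_neg (by omega), sub_zero, ih]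

theorem eulerSeries_ne_zero [Nontrivial R] (c : R) : eulerSeries c ≠ 0 := by
  intro h
  have h1 := congrArg (coeff 0) h
  simp [eulerSeries, eulerPartial] at h1

theorem coeff_eulerPartial_neg_one_nonneg (m n : ℕ) : 0 ≤ coeff n (eulerPartial (-1 : ℝ) m) := by
  induction m generalizing n with
  | zero =>
    rw [eulerPartial, Finset.prod_range_zero, coeff_one]
    positivity
  | succ m ih =>
    rw [coeff_eulerPartial_succ]
    split_ifs
    · linarith [ih n, ih (n - (m + 1))]
    · linarith [ih n]

theorem coeff_eulerPartial_neg_one_mono (n : ℕ) :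
    Monotone fun m => coeff n (eulerPartial (-1 : ℝ) m) := by
  refine monotone_nat_of_le_succ fun m => ?_
  rw [coeff_eulerPartial_succ]
  split_ifs
  · linarith [coeff_eulerPartial_neg_one_nonneg m (n - (m + 1))]
  · linarith

theorem coeff_eulerPartial_neg_one_le (m n : ℕ) :
    coeff n (eulerPartial (-1 : ℝ) m) ≤ coeff n (eulerSeries (-1 : ℝ)) := by
  rw [← coeff_eulerPartial_of_le (-1 : ℝ) (le_max_right m n)]
  exact coeff_eulerPartial_neg_one_mono n (le_max_left m n)

theorem norm_coeff_eulerPartial_le {c : ℂ} (hc : ‖c‖ ≤ 1) (m n : ℕ) :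
    ‖coeff n (eulerPartial c m)‖ ≤ coeff n (eulerPartial (-1 : ℝ) m) := by
  induction m generalizing n with
  | zero =>
    rw [eulerPartial, eulerPartial, Finset.prod_range_zero, Finset.prod_range_zero, coeff_one,
      coeff_one]
    split_ifs <;> simp
  | succ m ih =>
    rw [coeff_eulerPartial_succ, coeff_eulerPartial_succ]
    refine (norm_sub_le _ _).trans ?_
    split_ifs
    · have h : ‖c * coeff (n - (m + 1)) (eulerPartial c m)‖ ≤
          coeff (n - (m + 1)) (eulerPartial (-1 : ℝ) m) := by
        rw [norm_mul]
        exact (mul_le_of_le_one_left (norm_nonneg _) hc).trans (ih _)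
      linarith [ih n]
    · simpa using ih n

theorem hasSum_sum_mul_antidiagonal {a b : ℕ → ℂ} {S T : ℂ} (ha : HasSum a S) (hb : HasSum b T) :
    HasSum (fun n => ∑ p ∈ Finset.HasAntidiagonal.antidiagonal n, a p.1 * b p.2) (S * T) := by
  have n1 : Summable fun n => ‖a n‖ := ha.summable.norm
  have n2 : Summable fun n => ‖b n‖ := hb.summable.norm
  have h1 : (∑' n, a n) * ∑' n, b n =
      ∑' n, ∑ p ∈ Finset.HasAntidiagonal.antidiagonal n, a p.1 * b p.2 :=
    tsum_mul_tsum_eq_tsum_sum_antidiagonal_of_summable_norm n1 n2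
  have h2 : Summable fun n => ‖∑ p ∈ Finset.HasAntidiagonal.antidiagonal n, a p.1 * b p.2‖ :=
    summable_norm_sum_mul_antidiagonal_of_summable_norm n1 n2
  have h3 : Summable fun n => ∑ p ∈ Finset.HasAntidiagonal.antidiagonal n, a p.1 * b p.2 :=
    Summable.of_norm h2
  have h4 := h3.hasSum
  rwa [← h1, ha.tsum_eq, hb.tsum_eq] at h4

/-- Evaluation of power series is multiplicative. -/
theorem hasSum_coeff_mul {φ ψ : ℂ⟦X⟧} {x S T : ℂ} (hφ : HasSum (fun n => coeff n φ * x ^ n) S)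
    (hψ : HasSum (fun n => coeff n ψ * x ^ n) T) :
    HasSum (fun n => coeff n (φ * ψ) * x ^ n) (S * T) := by
  refine Eq.subst (motive := fun F => HasSum F _) (funext fun n => ?_)
    (hasSum_sum_mul_antidiagonal hφ hψ)
  rw [coeff_mul, Finset.sum_mul]
  refine Finset.sum_congr rfl fun p hp => ?_
  rw [← Finset.HasAntidiagonal.mem_antidiagonal.1 hp, pow_add]
  ring

theorem hasSum_coeff_eulerPartial [TopologicalSpace R] [IsTopologicalRing R] (c x : R) (m : ℕ) :
    HasSum (fun n => coeff n (eulerPartial c m) * x ^ n)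
      (∏ i ∈ Finset.range m, (1 - c * x ^ (i + 1))) := by
  induction m with
  | zero =>
    have h := hasSum_ite_eq 0 (1 : R)
    have e : (fun n => coeff n (eulerPartial c 0) * x ^ n) = fun n => if n = 0 then 1 else 0 := by
      funext n
      rw [eulerPartial, Finset.prod_range_zero, coeff_one]
      split_ifs with h
      · rw [h, pow_zero, mul_one]
      · rw [zero_mul]
    rwa [e, Finset.prod_range_zero]
  | succ m ih =>
    have h1 : HasSum (fun n => (if m + 1 ≤ n then c * coeff (n - (m + 1)) (eulerPartial c m) else 0) *
        x ^ n) ((∏ i ∈ Finset.range m, (1 - c * x ^ (i + 1))) * (c * x ^ (m + 1))) := by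
      rw [← hasSum_nat_add_iff' (m + 1), Finset.sum_eq_zero, sub_zero]
      · have e : (fun n => (if m + 1 ≤ n + (m + 1) then
            c * coeff (n + (m + 1) - (m + 1)) (eulerPartial c m) else 0) * x ^ (n + (m + 1))) =
            fun n => coeff n (eulerPartial c m) * x ^ n * (c * x ^ (m + 1)) := by
          funext n
          rw [if_pos (by omega), Nat.add_sub_cancel, pow_add]
          ring
        rw [e]
        exact ih.mul_right _
      · intro i hi
        rw [if_neg (by simpa using hi), zero_mul]
    have h2 := ih.sub h1
    rw [Finset.prod_range_succ, mul_sub, mul_one]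
    refine Eq.subst (motive := fun F => HasSum F _) (funext fun n => ?_) h2
    rw [coeff_eulerPartial_succ, sub_mul]

theorem summable_coeff_eulerSeries_neg_one {x : ℝ} (hx : 0 < x) (hx' : x < 1) :
    Summable fun n => coeff n (eulerSeries (-1 : ℝ)) * x ^ n := by
  have hnn (n : ℕ) : 0 ≤ coeff n (eulerSeries (-1 : ℝ)) * x ^ n :=
    mul_nonneg ((coeff_eulerPartial_neg_one_nonneg 0 n).trans (coeff_eulerPartial_neg_one_le 0 n))
      (by positivity)
  refine summable_of_sum_range_le (c := Real.exp (∑' i : ℕ, x ^ (i + 1))) hnn fun m => ?_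
  have hg : Summable fun i : ℕ => x ^ (i + 1) :=
    (summable_nat_add_iff 1).2 (summable_geometric_of_lt_one hx.le hx')
  calc ∑ n ∈ Finset.range m, coeff n (eulerSeries (-1 : ℝ)) * x ^ n
      = ∑ n ∈ Finset.range m, coeff n (eulerPartial (-1 : ℝ) m) * x ^ n :=
        Finset.sum_congr rfl fun n hn => by
          rw [coeff_eulerPartial_of_le (-1 : ℝ) (Finset.mem_range.1 hn).le]
    _ ≤ ∏ i ∈ Finset.range m, (1 - (-1) * x ^ (i + 1)) :=
        sum_le_hasSum _ (fun n _ => mul_nonneg (coeff_eulerPartial_neg_one_nonneg m n)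
          (by positivity)) (hasSum_coeff_eulerPartial (-1 : ℝ) x m)
    _ ≤ ∏ i ∈ Finset.range m, Real.exp (x ^ (i + 1)) := by
        refine Finset.prod_le_prod (fun i _ => ?_) fun i _ => ?_
        · have : 0 < x ^ (i + 1) := by positivity
          linarith
        · linarith [Real.add_one_le_exp (x ^ (i + 1))]
    _ = Real.exp (∑ i ∈ Finset.range m, x ^ (i + 1)) := (Real.exp_sum _ _).symm
    _ ≤ Real.exp (∑' i : ℕ, x ^ (i + 1)) :=
        Real.exp_le_exp.2 (hg.sum_le_tsum _ fun i _ => by positivity)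

/-- Evaluating the formal Euler product gives the analytic one. -/
theorem hasSum_coeff_eulerSeries {c : ℂ} (hc : ‖c‖ ≤ 1) {x : ℝ} (hx : 0 < x) (hx' : x < 1) :
    HasSum (fun n => coeff n (eulerSeries c) * (x : ℂ) ^ n) (qPoch x (c * x)) := by
  have hb := summable_coeff_eulerSeries_neg_one hx hx'
  have hle (m n : ℕ) : ‖coeff n (eulerPartial c m) * (x : ℂ) ^ n‖ ≤
      coeff n (eulerSeries (-1 : ℝ)) * x ^ n := by
    rw [norm_mul, norm_pow, Complex.norm_real, Real.norm_of_nonneg hx.le]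
    exact mul_le_mul_of_nonneg_right ((norm_coeff_eulerPartial_le hc m n).trans
      (coeff_eulerPartial_neg_one_le m n)) (by positivity)
  have h1 : Tendsto (fun m => ∑' n, coeff n (eulerPartial c m) * (x : ℂ) ^ n) atTop
      (𝓝 (∑' n, coeff n (eulerSeries c) * (x : ℂ) ^ n)) := by
    refine tendsto_tsum_of_dominated_convergence hb (fun n => ?_) (Eventually.of_forall hle)
    refine tendsto_atTop_of_eventually_const (i₀ := n) fun m hm => ?_
    rw [coeff_eulerPartial_of_le c hm]
  have hs : Summable fun n => coeff n (eulerSeries c) * (x : ℂ) ^ n := by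
    refine Summable.of_norm_bounded hb fun n => ?_
    rw [← coeff_eulerPartial_of_le c le_rfl]
    exact hle n n
  have hq : ‖(x : ℂ)‖ < 1 := by
    rw [Complex.norm_real, Real.norm_of_nonneg hx.le]
    exact hx'
  have h2 := tendsto_qPoch hq (c * x)
  have e : (fun m => ∑' n, coeff n (eulerPartial c m) * (x : ℂ) ^ n) =
      fun m => ∏ i ∈ Finset.range m, (1 - c * x * (x : ℂ) ^ i) := by
    funext m
    rw [(hasSum_coeff_eulerPartial c (x : ℂ) m).tsum_eq]
    exact Finset.prod_congr rfl fun i _ => by ring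
  rw [e] at h1
  rw [tendsto_nhds_unique h2 h1]
  exact hs.hasSum

theorem eq_zero_of_hasSum_mul_pow {a : ℕ → ℂ}
    (h : ∀ x : ℝ, 0 < x → x < 1 → HasSum (fun n => a n * (x : ℂ) ^ n) 0) (n : ℕ) : a n = 0 := by
  induction n using Nat.strong_induction_on with
  | _ n ih =>
    have h1 (x : ℝ) (hx : 0 < x) (hx' : x < 1) :
        HasSum (fun m => a (m + n) * (x : ℂ) ^ m) 0 := by
      have h2 := h x hx hx'
      rw [← hasSum_nat_add_iff' n, Finset.sum_eq_zero, sub_zero] at h2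
      · have hx0 : (x : ℂ) ^ n ≠ 0 := pow_ne_zero _ (Complex.ofReal_ne_zero.2 hx.ne')
        have h3 := h2.mul_right ((x : ℂ) ^ n)⁻¹
        rw [zero_mul] at h3
        refine Eq.subst (motive := fun F => HasSum F _) (funext fun m => ?_) h3
        rw [pow_add, ← mul_assoc, mul_assoc, mul_inv_cancel₀ hx0, mul_one]
      · intro i hi
        rw [ih i (Finset.mem_range.1 hi), zero_mul]
    have hb : Summable fun m => ‖a (m + n) * ((1 / 2 : ℝ) : ℂ) ^ m‖ :=
      (h1 (1 / 2) (by norm_num) (by norm_num)).summable.norm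
    have hlim : Tendsto (fun x : ℝ => ∑' m, a (m + n) * (x : ℂ) ^ m) (𝓝[>] 0)
        (𝓝 (∑' m, a (m + n) * ((0 : ℝ) : ℂ) ^ m)) := by
      refine tendsto_tsum_of_dominated_convergence hb (fun m => ?_) ?_
      · have hc : Continuous fun x : ℝ => a (m + n) * (x : ℂ) ^ m := by fun_prop
        exact (hc.tendsto 0).mono_left nhdsWithin_le_nhds
      · filter_upwards [Ioo_mem_nhdsGT (show (0 : ℝ) < 1 / 2 by norm_num)] with x hx m
        rw [norm_mul, norm_mul, norm_pow, norm_pow, Complex.norm_real, Complex.norm_real,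
          Real.norm_of_nonneg hx.1.le, Real.norm_of_nonneg (by norm_num : (0 : ℝ) ≤ 1 / 2)]
        exact mul_le_mul_of_nonneg_left (pow_le_pow_left₀ hx.1.le hx.2.le m) (norm_nonneg _)
    have h0 : (∑' m, a (m + n) * ((0 : ℝ) : ℂ) ^ m) = a n := by
      rw [tsum_eq_single 0 fun m hm => by rw [Complex.ofReal_zero, zero_pow hm, mul_zero], pow_zero,
        mul_one, zero_add]
    rw [h0] at hlim
    have hz : (fun x : ℝ => ∑' m, a (m + n) * (x : ℂ) ^ m) =ᶠ[𝓝[>] 0] fun _ => 0 := by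
      filter_upwards [Ioo_mem_nhdsGT (show (0 : ℝ) < 1 by norm_num)] with x hx
      exact (h1 x hx.1 hx.2).tsum_eq
    exact tendsto_nhds_unique hlim ((tendsto_congr' hz).2 tendsto_const_nhds)

/-- Power series convergent on `(0, 1)` are determined by their values there. -/
theorem eq_of_hasSum_coeff {φ ψ : ℂ⟦X⟧} {S : ℝ → ℂ}
    (hφ : ∀ x : ℝ, 0 < x → x < 1 → HasSum (fun n => coeff n φ * (x : ℂ) ^ n) (S x))
    (hψ : ∀ x : ℝ, 0 < x → x < 1 → HasSum (fun n => coeff n ψ * (x : ℂ) ^ n) (S x)) : φ = ψ := by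
  ext n
  have h := eq_zero_of_hasSum_mul_pow (a := fun n => coeff n φ - coeff n ψ) (fun x hx hx' => ?_) n
  · exact sub_eq_zero.1 h
  · have h1 := (hφ x hx hx').sub (hψ x hx hx')
    rw [sub_self] at h1
    refine Eq.subst (motive := fun F => HasSum F _) (funext fun m => ?_) h1
    rw [sub_mul]

/-- A formal crank-type identity follows from its analytic version. -/
theorem mul_eulerSeries_eq_of_hasSum {φ : ℂ⟦X⟧} {c d : ℂ} (hc : ‖c‖ ≤ 1) (hd : ‖d‖ ≤ 1)
    (h : ∀ x : ℝ, 0 < x → x < 1 → ∃ S : ℂ, HasSum (fun n => coeff n φ * (x : ℂ) ^ n) S ∧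
      S * (qPoch x (c * x) * qPoch x (d * x)) = qPoch x x) :
    φ * (eulerSeries c * eulerSeries d) = eulerSeries 1 := by
  refine eq_of_hasSum_coeff (S := fun x => qPoch x x) (fun x hx hx' => ?_) fun x hx hx' => ?_
  · obtain ⟨S, hS, e⟩ := h x hx hx'
    have h1 := hasSum_coeff_mul hS (hasSum_coeff_mul (hasSum_coeff_eulerSeries hc hx hx')
      (hasSum_coeff_eulerSeries hd hx hx'))
    rwa [e] at h1
  · have h1 := hasSum_coeff_eulerSeries (c := 1) (by simp) hx hx'
    rwa [one_mul] at h1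

end EulerSeries

section FormalQBinomial

open PowerSeries
open scoped PowerSeries.WithPiTopology

theorem hasSum_coeff_of_X_pow_dvd {t : ℕ → ℂ⟦X⟧} (h : ∀ n, X ^ n ∣ t n) (d : ℕ) :
    HasSum (fun n => coeff d (t n)) (∑ n ∈ Finset.range (d + 1), coeff d (t n)) :=
  hasSum_sum_of_ne_finset_zero fun n hn => X_pow_dvd_iff.1 (h n) d (by simpa using hn)

theorem summable_of_X_pow_dvd {t : ℕ → ℂ⟦X⟧} (h : ∀ n, X ^ n ∣ t n) : Summable t :=
  (WithPiTopology.summable_iff_summable_coeff ℂ).2 fun d =>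
    (hasSum_coeff_of_X_pow_dvd h d).summable

theorem coeff_tsum_of_X_pow_dvd {t : ℕ → ℂ⟦X⟧} (h : ∀ n, X ^ n ∣ t n) (d : ℕ) :
    coeff d (∑' n, t n) = ∑ n ∈ Finset.range (d + 1), coeff d (t n) :=
  ((WithPiTopology.hasSum_iff_hasSum_coeff ℂ).1 (summable_of_X_pow_dvd h).hasSum d).unique
    (hasSum_coeff_of_X_pow_dvd h d)

theorem tendsto_eulerPartial (c : ℂ) :
    Tendsto (eulerPartial c) atTop (𝓝 (eulerSeries c)) := by
  rw [WithPiTopology.tendsto_iff_coeff_tendsto]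
  exact fun d => tendsto_atTop_of_eventually_const (i₀ := d) fun m hm =>
    coeff_eulerPartial_of_le c hm

theorem tsum_mul_eq_of_formal_qbinomial {α β A B : ℂ⟦X⟧} {t : ℕ → ℂ⟦X⟧} (h0 : t 0 = 1)
    (hd : ∀ n, X ^ n ∣ t n) (ht : ∀ n, t (n + 1) * (1 - X ^ (n + 1)) = t n * (α - β * X ^ n))
    (hA : Tendsto (fun N : ℕ => ∏ i ∈ Finset.range N, (1 - α * X ^ i)) atTop (𝓝 A))
    (hB : Tendsto (fun N : ℕ => ∏ i ∈ Finset.range N, (1 - β * X ^ i)) atTop (𝓝 B)) :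
    (∑' n, t n) * A = B := by
  have hd' (N n : ℕ) : X ^ n ∣ t n * X ^ (n * N) := (hd n).mul_right _
  refine tsum_mul_eq_of_qbinomial_recursion ht (fun N => summable_of_X_pow_dvd (hd' N)) ?_ hA hB
  rw [WithPiTopology.tendsto_iff_coeff_tendsto]
  refine fun d => tendsto_atTop_of_eventually_const (i₀ := d + 1) fun N hN => ?_
  rw [coeff_tsum_of_X_pow_dvd (hd' N), Finset.sum_range_succ', Finset.sum_eq_zero, zero_add, h0,
    zero_mul, pow_zero, mul_one]
  intro n hn
  refine X_pow_dvd_iff.1 (Dvd.intro_left _ rfl) d ?_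
  nlinarith

theorem eulerPartial_one_mul_inv (n : ℕ) :
    eulerPartial (1 : ℂ) n * (eulerPartial (1 : ℂ) n)⁻¹ = 1 := by
  refine PowerSeries.mul_inv_cancel _ ?_
  rw [← coeff_zero_eq_constantCoeff_apply, coeff_eulerPartial_of_le _ n.zero_le]
  simp [eulerSeries, eulerPartial]

theorem inv_eulerPartial_one_succ (n : ℕ) :
    (eulerPartial (1 : ℂ) (n + 1))⁻¹ * (1 - X ^ (n + 1)) = (eulerPartial (1 : ℂ) n)⁻¹ := by
  have h1 := eulerPartial_one_mul_inv (n + 1)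
  have h2 := eulerPartial_one_mul_inv n
  have h3 : eulerPartial (1 : ℂ) (n + 1) = eulerPartial 1 n * (1 - X ^ (n + 1)) := by
    rw [eulerPartial, Finset.prod_range_succ, ← eulerPartial, map_one, one_mul]
  rw [h3] at h1 ⊢
  generalize (eulerPartial (1 : ℂ) n * (1 - X ^ (n + 1)))⁻¹ = u at *
  linear_combination (eulerPartial (1 : ℂ) n)⁻¹ * h1 - u * (1 - X ^ (n + 1)) * h2

theorem tsum_X_pow_mul_eulerSeries (z : ℂ) :
    (∑' n, C z ^ n * X ^ n * (eulerPartial (1 : ℂ) n)⁻¹) * eulerSeries z = 1 := by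
  refine tsum_mul_eq_of_formal_qbinomial (α := C z * X) (β := 0) ?_ (fun n => ?_) (fun n => ?_) ?_ ?_
  · simp [eulerPartial]
  · exact Dvd.intro (C z ^ n * (eulerPartial (1 : ℂ) n)⁻¹) (by ring)
  · rw [mul_assoc, inv_eulerPartial_one_succ]
    ring
  · refine (tendsto_eulerPartial z).congr fun N => Finset.prod_congr rfl fun i _ => by ring
  · simp

theorem tsum_X_pow_mul_eulerPartial {z : ℂ} (hz : z ≠ 0) :
    (1 - X) * (∑' n, C z⁻¹ ^ n * X ^ n * (eulerPartial z n * (eulerPartial (1 : ℂ) n)⁻¹)) *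
      eulerSeries z⁻¹ = eulerSeries 1 := by
  have hz' : C z⁻¹ * C z = 1 := by rw [← map_mul, inv_mul_cancel₀ hz, map_one]
  have hinv : (1 - X : ℂ⟦X⟧) * (1 - X)⁻¹ = 1 := PowerSeries.mul_inv_cancel _ (by simp)
  have h := tsum_mul_eq_of_formal_qbinomial (α := C z⁻¹ * X) (β := X ^ 2) (A := eulerSeries z⁻¹)
    (B := (1 - X)⁻¹ * eulerSeries 1)
    (t := fun n => C z⁻¹ ^ n * X ^ n * (eulerPartial z n * (eulerPartial (1 : ℂ) n)⁻¹))
    ?_ (fun n => ?_) (fun n => ?_) ?_ ?_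
  · rw [mul_assoc, h, ← mul_assoc, hinv, one_mul]
  · simp [eulerPartial]
  · exact Dvd.intro (C z⁻¹ ^ n * (eulerPartial z n * (eulerPartial (1 : ℂ) n)⁻¹)) (by ring)
  · have h1 : eulerPartial z (n + 1) = eulerPartial z n * (1 - C z * X ^ (n + 1)) := by
      rw [eulerPartial, Finset.prod_range_succ, ← eulerPartial]
    rw [h1]
    linear_combination (C z⁻¹ ^ (n + 1) * X ^ (n + 1) * eulerPartial z n *
      (1 - C z * X ^ (n + 1))) * inv_eulerPartial_one_succ n +
      (-C z⁻¹ ^ n * X ^ (2 * n + 2) * eulerPartial z n * (eulerPartial (1 : ℂ) n)⁻¹) * hz'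
  · refine (tendsto_eulerPartial z⁻¹).congr fun N => Finset.prod_congr rfl fun i _ => by ring
  · have h1 := ((tendsto_eulerPartial 1).comp (tendsto_add_atTop_nat 1)).const_mul ((1 - X)⁻¹ : ℂ⟦X⟧)
    refine h1.congr fun N => ?_
    rw [Function.comp, eulerPartial, Finset.prod_range_succ', map_one, mul_comm]
    simp only [one_mul, zero_add, pow_one]
    rw [mul_assoc, hinv, mul_one]
    exact Finset.prod_congr rfl fun i _ => by ring

end FormalQBinomial

section WeightedPartitions

open PowerSeries
open scoped PowerSeries.WithPiTopology

theorem coeff_genFun_pow (w : ℕ → ℂ) (N : ℕ) :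
    coeff N (Nat.Partition.genFun fun i c => w i ^ c) =
      ∑ π : Nat.Partition N, (π.parts.map w).prod := by
  rw [Nat.Partition.coeff_genFun]
  refine Finset.sum_congr rfl fun π _ => ?_
  rw [Finset.prod_multiset_map_count, Finsupp.prod, Multiset.toFinsupp_support]
  simp

theorem tendsto_prod_genFun_pow (w : ℕ → ℂ) :
    ∃ Q : ℕ → ℂ⟦X⟧, Tendsto Q atTop (𝓝 (Nat.Partition.genFun fun i c => w i ^ c)) ∧
      ∀ N, Q N * ∏ i ∈ Finset.range N, (1 - C (w (i + 1)) * X ^ (i + 1)) = 1 := by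
  refine ⟨_, (Nat.Partition.hasProd_genFun fun i c => w i ^ c).tendsto_prod_nat, fun N => ?_⟩
  rw [← Finset.prod_mul_distrib]
  refine Finset.prod_eq_one fun i _ => ?_
  have h0 : constantCoeff (C (w (i + 1)) * X ^ (i + 1)) = 0 := by simp
  have hs := WithPiTopology.summable_pow_of_constantCoeff_eq_zero h0
  have h1 := WithPiTopology.tsum_pow_mul_one_sub_of_constantCoeff_eq_zero h0
  rw [hs.tsum_eq_zero_add, pow_zero] at h1
  refine Eq.trans ?_ h1
  congr 3
  funext j
  rw [smul_eq_C_mul, map_pow]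
  ring

/-- The weight killing parts `1`, ignoring parts up to `n`, and counting larger parts by `y`. -/
def crankWeight (y : ℂ) (n i : ℕ) : ℂ := if i = 1 then 0 else if i ≤ n then 1 else y

/-- Generating function of partitions without ones, by number of parts exceeding `n`. -/
noncomputable def largePartSeries (y : ℂ) (n : ℕ) : ℂ⟦X⟧ :=
  Nat.Partition.genFun fun i c => crankWeight y n i ^ c

theorem largePartSeries_mul (y : ℂ) (n : ℕ) :
    largePartSeries y (n + 1) * eulerPartial 1 (n + 1) * eulerSeries y =
      (1 - X) * eulerPartial y (n + 1) := by
  obtain ⟨Q, hQ, hQ1⟩ := tendsto_prod_genFun_pow (crankWeight y (n + 1))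
  set H : ℕ → ℂ⟦X⟧ := fun N =>
    ∏ i ∈ Finset.range N, (1 - C (crankWeight y (n + 1) (i + 1)) * X ^ (i + 1)) with hH
  have h1 : (1 - X) * H (n + 1) = eulerPartial 1 (n + 1) := by
    rw [hH, eulerPartial]
    simp only []
    rw [Finset.prod_range_succ', Finset.prod_range_succ', mul_comm (1 - X : ℂ⟦X⟧)]
    congr 1
    · rw [Finset.prod_congr rfl (g := fun i => 1 - C (1 : ℂ) * X ^ (i + 1 + 1))]
      · simp [crankWeight]
      · intro i hi
        have hi' : i + 1 + 1 ≤ n + 1 := by have := Finset.mem_range.1 hi; omega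
        simp only [crankWeight, if_pos hi']
        simp
    · simp
  have h2 : ∀ N, n + 1 ≤ N →
      H N * eulerPartial y (n + 1) = H (n + 1) * eulerPartial y N := by
    intro N hN
    induction N, hN using Nat.le_induction with
    | base => rfl
    | succ N hN ih =>
      have e1 : H (N + 1) = H N * (1 - C y * X ^ (N + 1)) := by
        simp only [hH]
        rw [Finset.prod_range_succ, crankWeight, if_neg (by omega), if_neg (by omega)]
      have e2 : eulerPartial y (N + 1) = eulerPartial y N * (1 - C y * X ^ (N + 1)) := by
        rw [eulerPartial, Finset.prod_range_succ, ← eulerPartial]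
      rw [e1, e2]
      linear_combination (1 - C y * X ^ (N + 1)) * ih
  refine tendsto_nhds_unique ((hQ.mul_const _).mul (tendsto_eulerPartial y))
    (tendsto_const_nhds.congr' ?_)
  filter_upwards [eventually_ge_atTop (n + 1)] with N hN
  have h3 : Q N * H N = 1 := hQ1 N
  have h4 := h2 N hN
  linear_combination (-(1 - X) * eulerPartial y (n + 1)) * h3 + Q N * (1 - X) * h4 +
    Q N * eulerPartial y N * h1

end WeightedPartitions

section CrankGeneratingFunction

open PowerSeries
open scoped PowerSeries.WithPiTopology

theorem prod_map_crankWeight (y : ℂ) (n : ℕ) (s : Multiset ℕ) :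
    (s.map (crankWeight y n)).prod =
      if s.count 1 = 0 then y ^ (s.filter fun x => n < x).card else 0 := by
  induction s using Multiset.induction with
  | empty => simp
  | cons a s ih =>
    rw [Multiset.map_cons, Multiset.prod_cons, ih, Multiset.count_cons, Multiset.filter_cons,
      crankWeight]
    rcases eq_or_ne a 1 with rfl | ha
    · simp
    · rw [if_neg ha, if_neg (Ne.symm ha), add_zero]
      by_cases han : a ≤ n
      · rw [if_pos han, if_neg (not_lt.2 han), one_mul, zero_add]
      · rw [if_neg han, if_pos (not_le.1 han), Multiset.card_add, Multiset.card_singleton]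
        split_ifs
        · rw [pow_add, pow_one]
        · rw [mul_zero]

theorem coeff_largePartSeries (y : ℂ) (n N : ℕ) :
    coeff N (largePartSeries y n) = ∑ π : Nat.Partition N,
      if π.parts.count 1 = 0 then y ^ (π.parts.filter fun x => n < x).card else 0 := by
  rw [largePartSeries, coeff_genFun_pow]
  exact Finset.sum_congr rfl fun π _ => prod_map_crankWeight y n π.parts

theorem coeff_largePartSeries_zero (n N : ℕ) :
    coeff N (largePartSeries 0 n) = ∑ π : Nat.Partition N,
      if π.parts.count 1 = 0 then (if π.parts.sup ≤ n then (1 : ℂ) else 0) else 0 := by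
  rw [coeff_largePartSeries]
  refine Finset.sum_congr rfl fun π _ => if_congr Iff.rfl ?_ rfl
  rw [zero_pow_eq]
  refine if_congr ?_ rfl rfl
  rw [Multiset.card_eq_zero, Multiset.filter_eq_nil, Multiset.sup_le]
  simp only [not_lt]

theorem eulerSeries_zero : eulerSeries (0 : ℂ) = 1 := by
  refine tendsto_nhds_unique (tendsto_eulerPartial 0)
    (tendsto_const_nhds.congr fun m => ?_)
  simp [eulerPartial]

theorem largePartSeries_zero_eq (n : ℕ) :
    largePartSeries 0 (n + 1) = (1 - X) * (eulerPartial 1 (n + 1))⁻¹ := by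
  have h := largePartSeries_mul 0 (n + 1 - 1)
  have h1 := eulerPartial_one_mul_inv (n + 1)
  have h2 : eulerPartial (0 : ℂ) (n + 1) = 1 := by simp [eulerPartial]
  rw [Nat.add_sub_cancel, eulerSeries_zero, h2] at h
  linear_combination (eulerPartial (1 : ℂ) (n + 1))⁻¹ * h - largePartSeries 0 (n + 1) * h1

theorem sup_parts_le {N : ℕ} (π : Nat.Partition N) : π.parts.sup ≤ N :=
  Multiset.sup_le.2 fun _ hb => π.le_of_mem_parts hb

theorem two_le_sup_parts {N : ℕ} (π : Nat.Partition (N + 1)) (h : π.parts.count 1 = 0) :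
    2 ≤ π.parts.sup := by
  obtain ⟨a, ha⟩ : ∃ a, a ∈ π.parts := by
    refine Multiset.exists_mem_of_ne_zero fun h0 => ?_
    have := π.parts_sum
    rw [h0] at this
    simp at this
  have h1 := π.parts_pos ha
  have h2 : a ≠ 1 := fun h2 => Multiset.count_eq_zero.1 h (h2 ▸ ha)
  have h3 := Multiset.le_sup ha
  omega

theorem pow_eq_sum_of_two_le (z : ℂ) {s N : ℕ} (h : 2 ≤ s) (hN : s ≤ N + 1) :
    z ^ s = ∑ k ∈ Finset.range N,
      z ^ (k + 2) * ((if s ≤ k + 2 then (1 : ℂ) else 0) - if s ≤ k + 1 then 1 else 0) := by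
  rw [Finset.sum_eq_single (s - 2)]
  · rw [Nat.sub_add_cancel h, if_pos le_rfl, if_neg (by omega), sub_zero, mul_one]
  · intro k _ hk
    by_cases h1 : s ≤ k + 1
    · rw [if_pos h1, if_pos (by omega), sub_self, mul_zero]
    · rw [if_neg h1, if_neg (by omega), sub_self, mul_zero]
  · intro h1
    exact absurd (Finset.mem_range.2 (by omega)) h1

/-- Generating function of `z ^ crank` over partitions without ones. -/
noncomputable def noOnesSeries (z : ℂ) : ℂ⟦X⟧ :=
  mk fun N => ∑ π : Nat.Partition N, if π.parts.count 1 = 0 then z ^ π.parts.sup else 0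

theorem noOnesSeries_eq (z : ℂ) :
    noOnesSeries z + (C z - 1) * X =
      (1 - X) * ∑' n, C z ^ n * X ^ n * (eulerPartial (1 : ℂ) n)⁻¹ := by
  set t : ℕ → ℂ⟦X⟧ := fun n => (1 - X) * (C z ^ n * X ^ n * (eulerPartial (1 : ℂ) n)⁻¹) with ht
  have hd0 (n : ℕ) : X ^ n ∣ C z ^ n * X ^ n * (eulerPartial (1 : ℂ) n)⁻¹ :=
    Dvd.intro (C z ^ n * (eulerPartial (1 : ℂ) n)⁻¹) (by ring)
  have hd (n : ℕ) : X ^ n ∣ t n := (hd0 n).mul_left _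
  have hinv : (1 - X : ℂ⟦X⟧) * (1 - X)⁻¹ = 1 := PowerSeries.mul_inv_cancel _ (by simp)
  have ht0 : t 0 = 1 - X := by simp [ht, eulerPartial]
  have ht1 : t 1 = C z * X := by
    simp only [ht, eulerPartial, Finset.prod_range_one, map_one, zero_add, pow_one, one_mul]
    linear_combination C z * X * hinv
  have ht2 (k : ℕ) :
      t (k + 2) = C (z ^ (k + 2)) * (largePartSeries 0 (k + 2) - largePartSeries 0 (k + 1)) := by
    have h1 := inv_eulerPartial_one_succ (k + 1)
    rw [largePartSeries_zero_eq, largePartSeries_zero_eq, map_pow]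
    simp only [ht]
    linear_combination (-(1 - X) * C z ^ (k + 2)) * h1
  rw [← (summable_of_X_pow_dvd hd0).tsum_mul_left]
  change _ = ∑' n, t n
  ext N
  rw [coeff_tsum_of_X_pow_dvd hd]
  rcases N with _ | N
  · simp [noOnesSeries, ht0]
  · rw [Finset.sum_range_succ', Finset.sum_range_succ', ht0, zero_add, ht1]
    have h1 : coeff (N + 1) (noOnesSeries z) =
        ∑ k ∈ Finset.range N, coeff (N + 1) (t (k + 2)) := by
      simp only [ht2, coeff_C_mul, map_sub, noOnesSeries, coeff_mk]
      simp only [coeff_largePartSeries_zero,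
        show ∀ k, k + 2 = k + 1 + 1 from fun _ => rfl]
      simp only [← Finset.sum_sub_distrib, Finset.mul_sum]
      rw [Finset.sum_comm]
      refine Finset.sum_congr rfl fun π _ => ?_
      by_cases h : π.parts.count 1 = 0
      · simp only [if_pos h]
        exact pow_eq_sum_of_two_le z (two_le_sup_parts π h) (sup_parts_le π)
      · simp only [if_neg h, sub_self, mul_zero, Finset.sum_const_zero]
    rw [map_add, h1, add_assoc, ← map_add]
    rw [add_right_inj]
    have h2 : coeff (N + 1) (1 : ℂ⟦X⟧) = 0 := by simp [coeff_one]
    rw [show C z * X + (1 - X) = (C z - 1) * X + (1 : ℂ⟦X⟧) by ring, map_add _ _ (1 : ℂ⟦X⟧), h2,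
      add_zero]

/-- Deleting the ones of a partition with exactly `m` ones. -/
theorem sum_count_one_eq {N m : ℕ} (hm : 1 ≤ m) (hN : m ≤ N) (y : ℂ) :
    (∑ π : Nat.Partition N,
      if π.parts.count 1 = m then y ^ (π.parts.filter fun x => m < x).card else 0) =
      coeff (N - m) (largePartSeries y m) := by
  rw [coeff_largePartSeries, ← Finset.sum_filter, ← Finset.sum_filter]
  have hkey (s : Multiset ℕ) : s.filter (fun x => ¬ x = 1) + Multiset.replicate (s.count 1) 1 = s := by
    rw [← Multiset.filter_eq', add_comm, Multiset.filter_add_not]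
  symm
  refine Finset.sum_bij (fun π _ => ⟨π.parts + Multiset.replicate m 1, ?_, ?_⟩) ?_ ?_ ?_ ?_
  · intro i hi
    rcases Multiset.mem_add.1 hi with h | h
    · exact π.parts_pos h
    · rw [Multiset.eq_of_mem_replicate h]
      exact one_pos
  · rw [Multiset.sum_add, π.parts_sum, Multiset.sum_replicate]
    simp only [smul_eq_mul]
    omega
  · intro π h
    have h' := (Finset.mem_filter.1 h).2
    simp [h']
  · intro π₁ _ π₂ _ h
    have h' := congrArg Nat.Partition.parts h
    exact Nat.Partition.ext (add_right_cancel h')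
  · intro π h
    have h' := (Finset.mem_filter.1 h).2
    have hk := hkey π.parts
    rw [h'] at hk
    refine ⟨⟨π.parts.filter (fun x => ¬ x = 1), fun hi => ?_, ?_⟩, ?_, ?_⟩
    · exact π.parts_pos (Multiset.mem_filter.1 hi).1
    · have hs := congrArg Multiset.sum hk
      rw [Multiset.sum_add, π.parts_sum, Multiset.sum_replicate] at hs
      simp only [smul_eq_mul] at hs
      omega
    · simp
    · exact Nat.Partition.ext hk
  · intro π h
    have hf : (Multiset.replicate m 1).filter (fun x => m < x) = 0 := by
      rw [Multiset.filter_eq_nil]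
      intro a ha
      rw [Multiset.eq_of_mem_replicate ha]
      omega
    simp only [Multiset.filter_add, hf, add_zero]

/-- Generating function of `z ^ crank` over partitions with at least one part `1`. -/
noncomputable def someOnesSeries (z : ℂ) : ℂ⟦X⟧ :=
  mk fun N => ∑ π : Nat.Partition N, if π.parts.count 1 = 0 then 0 else
    z⁻¹ ^ π.parts.count 1 * z ^ (π.parts.filter fun x => π.parts.count 1 < x).card

theorem count_one_parts_le {N : ℕ} (π : Nat.Partition N) : π.parts.count 1 ≤ N := by
  have h := Multiset.card_nsmul_le_sum (s := π.parts) (a := 1) fun x hx => π.parts_pos hx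
  rw [π.parts_sum, smul_eq_mul, mul_one] at h
  exact (Multiset.count_le_card 1 π.parts).trans h

theorem someOnesSeries_eq (z : ℂ) :
    someOnesSeries z =
      ∑' n, C z⁻¹ ^ (n + 1) * X ^ (n + 1) * largePartSeries z (n + 1) := by
  have hd (n : ℕ) : X ^ n ∣ C z⁻¹ ^ (n + 1) * X ^ (n + 1) * largePartSeries z (n + 1) :=
    Dvd.intro (C z⁻¹ ^ (n + 1) * X * largePartSeries z (n + 1)) (by ring)
  ext N
  rw [coeff_tsum_of_X_pow_dvd hd, someOnesSeries, coeff_mk]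
  have h1 (m : ℕ) : coeff N (C z⁻¹ ^ (m + 1) * X ^ (m + 1) * largePartSeries z (m + 1)) =
      ∑ π : Nat.Partition N, if π.parts.count 1 = m + 1 then
        z⁻¹ ^ (m + 1) * z ^ (π.parts.filter fun x => m + 1 < x).card else 0 := by
    rw [mul_assoc, ← map_pow, coeff_C_mul, coeff_X_pow_mul']
    split_ifs with h
    · rw [← sum_count_one_eq (Nat.le_add_left 1 m) h, Finset.mul_sum]
      exact Finset.sum_congr rfl fun π _ => by rw [mul_ite, mul_zero]
    · rw [mul_zero]
      symm
      refine Finset.sum_eq_zero fun π _ => if_neg fun hc => h ?_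
      exact hc ▸ count_one_parts_le π
  simp only [h1]
  rw [Finset.sum_comm]
  refine Finset.sum_congr rfl fun π _ => ?_
  have hle := count_one_parts_le π
  by_cases h : π.parts.count 1 = 0
  · rw [if_pos h]
    symm
    exact Finset.sum_eq_zero fun m _ => if_neg (by omega)
  · rw [if_neg h]
    obtain ⟨m, hm⟩ := Nat.exists_eq_succ_of_ne_zero h
    rw [Finset.sum_eq_single m]
    · rw [if_pos hm, hm]
    · exact fun k _ hk => if_neg (by omega)
    · exact fun hk => absurd (Finset.mem_range.2 (by omega)) hk

/-- The crank generating function, with the conventional correction at `X`. -/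
noncomputable def crankSeries (z : ℂ) : ℂ⟦X⟧ :=
  mk (fun N => ∑ π : Nat.Partition N, z ^ partitionCrank π) + (C z - 1) * X

theorem crankSeries_eq {z : ℂ} (hz : z ≠ 0) :
    crankSeries z = noOnesSeries z + someOnesSeries z + (C z - 1) * X := by
  rw [crankSeries]
  congr 1
  ext N
  rw [map_add, noOnesSeries, someOnesSeries, coeff_mk, coeff_mk, coeff_mk,
    ← Finset.sum_add_distrib]
  refine Finset.sum_congr rfl fun π _ => ?_
  rw [partitionCrank]
  split_ifs
  · rw [zpow_natCast, add_zero]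
  · rw [zpow_sub₀ hz, zpow_natCast, zpow_natCast, zero_add, inv_pow]
    field_simp

theorem crankSeries_mul_eulerSeries {z : ℂ} (hz : z ≠ 0) :
    crankSeries z * (eulerSeries z * eulerSeries z⁻¹) = eulerSeries 1 := by
  have hd (n : ℕ) : X ^ n ∣ C z⁻¹ ^ (n + 1) * X ^ (n + 1) * largePartSeries z (n + 1) :=
    Dvd.intro (C z⁻¹ ^ (n + 1) * X * largePartSeries z (n + 1)) (by ring)
  have hd' (n : ℕ) :
      X ^ n ∣ C z⁻¹ ^ n * X ^ n * (eulerPartial z n * (eulerPartial (1 : ℂ) n)⁻¹) :=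
    Dvd.intro (C z⁻¹ ^ n * (eulerPartial z n * (eulerPartial (1 : ℂ) n)⁻¹)) (by ring)
  have hs := summable_of_X_pow_dvd hd'
  have h1 : someOnesSeries z * eulerSeries z = (1 - X) * (∑' n, C z⁻¹ ^ (n + 1) * X ^ (n + 1) *
      (eulerPartial z (n + 1) * (eulerPartial (1 : ℂ) (n + 1))⁻¹)) := by
    rw [someOnesSeries_eq, ← (summable_of_X_pow_dvd hd).tsum_mul_right,
      ← ((summable_nat_add_iff 1).2 hs).tsum_mul_left]
    refine tsum_congr fun n => ?_
    have e1 := largePartSeries_mul z n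
    have e2 := eulerPartial_one_mul_inv (n + 1)
    linear_combination (C z⁻¹ ^ (n + 1) * X ^ (n + 1) * (eulerPartial (1 : ℂ) (n + 1))⁻¹) * e1 -
      C z⁻¹ ^ (n + 1) * X ^ (n + 1) * largePartSeries z (n + 1) * eulerSeries z * e2
  have h2 := noOnesSeries_eq z
  have h3 := tsum_X_pow_mul_eulerSeries z
  have h4 := tsum_X_pow_mul_eulerPartial hz
  have h5 := hs.tsum_eq_zero_add
  have h6 : C z⁻¹ ^ 0 * X ^ 0 * (eulerPartial z 0 * (eulerPartial (1 : ℂ) 0)⁻¹) = 1 := by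
    simp [eulerPartial]
  rw [h6] at h5
  rw [crankSeries_eq hz]
  rw [h5] at h4
  linear_combination h4 + eulerSeries z⁻¹ * h1 + eulerSeries z * eulerSeries z⁻¹ * h2 +
    (1 - X) * eulerSeries z⁻¹ * h3

end CrankGeneratingFunction

section CrankClasses

open PowerSeries

theorem zpow_eq_sum_ite {z : ℂ} (hz : z ^ 11 = 1) (c : ℤ) :
    z ^ c = ∑ a ∈ Finset.range 11, if c % 11 = (a : ℤ) % 11 then z ^ a else 0 := by
  have hz0 : z ≠ 0 := by
    rintro rfl
    norm_num at hz
  rw [Finset.sum_eq_single (c % 11).toNat]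
  · rw [if_pos (by omega), ← zpow_natCast, Int.toNat_of_nonneg (by omega)]
    conv_lhs => rw [← Int.mul_ediv_add_emod c 11, zpow_add₀ hz0, zpow_mul]
    rw [show z ^ (11 : ℤ) = 1 from hz, one_zpow, one_mul]
  · intro a ha hne
    have := Finset.mem_range.1 ha
    exact if_neg (by omega)
  · intro h
    exact absurd (Finset.mem_range.2 (by omega)) h

theorem coeff_crankSeries {z : ℂ} (hz : z ^ 11 = 1) (N : ℕ) :
    coeff N (crankSeries z) = ∑ a ∈ Finset.range 11, (crankCount a N : ℂ) * z ^ a := by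
  have hX : coeff N ((C z - 1) * X) = if N = 1 then z - 1 else 0 := by
    rw [show (C z - 1 : ℂ⟦X⟧) = C (z - 1) by simp, coeff_C_mul, coeff_X]
    simp
  rw [crankSeries, map_add, coeff_mk, hX]
  rcases eq_or_ne N 1 with rfl | hN
  · have h1 (π : Nat.Partition 1) : partitionCrank π = -1 := by
      rw [Subsingleton.elim π (Nat.Partition.indiscrete 1)]
      decide
    simp only [h1, zpow_eq_sum_ite hz (-1)]
    simp [Finset.sum_range_succ, crankCount]
    ring
  · simp only [if_neg hN, add_zero, zpow_eq_sum_ite hz]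
    rw [Finset.sum_comm]
    refine Finset.sum_congr rfl fun a _ => ?_
    rw [crankCount, if_neg hN, ← Finset.sum_filter, Finset.sum_const, nsmul_eq_mul]
    push_cast
    rfl

theorem partitionCount_eq_sum_crankCount (N : ℕ) :
    (partitionCount N : ℤ) = ∑ a ∈ Finset.range 11, crankCount a N := by
  have h := coeff_crankSeries (one_pow 11) N
  simp only [crankSeries, one_zpow, one_pow, mul_one, map_one, sub_self, zero_mul, add_zero,
    coeff_mk, Finset.sum_const, nsmul_eq_mul] at h
  exact_mod_cast h

/-- Fourier inversion modulo 11 for a sequence whose nontrivial Fourier coefficients vanish. -/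
theorem eleven_mul_eq_sum {ζ : ℂ} (hζ : IsPrimitiveRoot ζ 11) {d : ℕ → ℂ}
    (h : ∀ k, k < 11 → k ≠ 0 → ∑ a ∈ Finset.range 11, d a * (ζ ^ k) ^ a = 0) {b : ℕ}
    (hb : b < 11) : 11 * d b = ∑ a ∈ Finset.range 11, d a := by
  have h1 : ∑ k ∈ Finset.range 11, ζ ^ (k * (11 - b)) *
      ∑ a ∈ Finset.range 11, d a * (ζ ^ k) ^ a = ∑ a ∈ Finset.range 11, d a := by
    rw [Finset.sum_eq_single 0]
    · simp
    · intro k hk hk0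
      rw [h k (Finset.mem_range.1 hk) hk0, mul_zero]
    · intro h0
      simp at h0
  rw [← h1]
  simp only [Finset.mul_sum]
  rw [Finset.sum_comm]
  have h2 (a : ℕ) : ∑ k ∈ Finset.range 11, ζ ^ (k * (11 - b)) * (d a * (ζ ^ k) ^ a) =
      d a * ∑ k ∈ Finset.range 11, (ζ ^ (11 - b + a)) ^ k := by
    rw [Finset.mul_sum]
    refine Finset.sum_congr rfl fun k _ => ?_
    ring
  simp only [h2]
  rw [Finset.sum_eq_single b]
  · rw [Nat.sub_add_cancel hb.le, hζ.pow_eq_one]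
    simp
    ring
  · intro a ha hab
    have ha' := Finset.mem_range.1 ha
    have hco : Nat.Coprime (11 - b + a) 11 := by
      refine Nat.Coprime.symm ((Nat.Prime.coprime_iff_not_dvd (by norm_num)).2 ?_)
      omega
    rw [(hζ.pow_of_coprime _ hco).geom_sum_eq_zero (by norm_num), mul_zero]
  · exact fun hb' => absurd (Finset.mem_range.2 hb) hb'

theorem exists_crankCount_eq : ∃ τ : ℕ → ℕ → ℝ, (∀ r, r ≠ 8 → ∀ n, 0 ≤ τ r n) ∧
    ∀ N b : ℕ, b < 11 → 11 * (crankCount b N : ℝ) - partitionCount N =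
      τ (N % 11) (N / 11) * (11 * ((crankClassCoeffs (N % 11)).getD b 0 : ℝ) -
        ∑ a ∈ Finset.range 11, ((crankClassCoeffs (N % 11)).getD a 0 : ℝ)) := by
  obtain ⟨τ, hτ, hS⟩ := exists_crank_series
  refine ⟨τ, hτ, fun N b hb => ?_⟩
  have hseries {ζ : ℂ} (hζ : IsPrimitiveRoot ζ 11) :
      coeff N (crankSeries ζ) = crankClassValue ζ (N % 11) * τ (N % 11) (N / 11) := by
    have hn : ‖ζ‖ = 1 := hζ.norm'_eq_one (by norm_num)
    have hz : ζ ≠ 0 := hζ.ne_zero (by norm_num)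
    have h1 := mul_eulerSeries_eq_of_hasSum
      (φ := mk fun n : ℕ => crankClassValue ζ (n % 11) * (τ (n % 11) (n / 11) : ℂ))
      (c := ζ) (d := ζ⁻¹) hn.le (by rw [norm_inv, hn, inv_one]) fun x h0 h1 => by
        obtain ⟨S, hS1, hS2⟩ := hS ζ hζ x h0 h1
        refine ⟨S, ?_, hS2⟩
        simp only [coeff_mk]
        exact hS1
    have h2 := mul_right_cancel₀
      (mul_ne_zero (eulerSeries_ne_zero ζ) (eulerSeries_ne_zero ζ⁻¹))
      ((crankSeries_mul_eulerSeries hz).trans h1.symm)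
    rw [h2, coeff_mk]
  set r := N % 11 with hr
  set t := τ r (N / 11) with ht
  have hζ := Complex.isPrimitiveRoot_exp 11 (by norm_num)
  have h3 := eleven_mul_eq_sum hζ
    (d := fun a => (crankCount a N : ℂ) - ((crankClassCoeffs r).getD a 0 : ℂ) * t)
    (fun k hk hk0 => ?_) hb
  · have hp : (partitionCount N : ℂ) = ∑ a ∈ Finset.range 11, (crankCount a N : ℂ) := by
      exact_mod_cast partitionCount_eq_sum_crankCount N
    simp only [Finset.sum_sub_distrib, ← hp, ← Finset.sum_mul] at h3
    have h4 : ((11 * (crankCount b N : ℝ) - partitionCount N : ℝ) : ℂ) =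
        ((t * (11 * ((crankClassCoeffs r).getD b 0 : ℝ) -
        ∑ a ∈ Finset.range 11, ((crankClassCoeffs r).getD a 0 : ℝ)) : ℝ) : ℂ) := by
      push_cast
      linear_combination h3
    exact Complex.ofReal_injective h4
  · have hco : Nat.Coprime k 11 := by
      refine Nat.Coprime.symm ((Nat.Prime.coprime_iff_not_dvd (by norm_num)).2 ?_)
      omega
    have hk' := hζ.pow_of_coprime k hco
    have h5 := hseries hk'
    rw [coeff_crankSeries hk'.pow_eq_one, crankClassValue, Finset.sum_mul] at h5
    simp only [sub_mul, Finset.sum_sub_distrib]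
    rw [h5, sub_eq_zero]
    exact Finset.sum_congr rfl fun a _ => by ring

end CrankClasses

/-- Ekin's crank inequalities modulo 11. -/
theorem crank_inequalities_mod_eleven (n : ℕ) :
    (11 * crankCount 0 (11 * n) ≥ (partitionCount (11 * n) : ℤ))
    ∧ ((partitionCount (11 * n) : ℤ) ≥ 11 * crankCount 1 (11 * n))
    ∧ (11 * crankCount 1 (11 * n + 1) ≥ (partitionCount (11 * n + 1) : ℤ))
    ∧ ((partitionCount (11 * n + 1) : ℤ) ≥ 11 * crankCount 2 (11 * n + 1))
    ∧ (11 * crankCount 2 (11 * n + 1) ≥ 11 * crankCount 0 (11 * n + 1))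
    ∧ (11 * crankCount 2 (11 * n + 2) ≥ (partitionCount (11 * n + 2) : ℤ))
    ∧ ((partitionCount (11 * n + 2) : ℤ) ≥ 11 * crankCount 0 (11 * n + 2))
    ∧ (11 * crankCount 0 (11 * n + 3) ≥ (partitionCount (11 * n + 3) : ℤ))
    ∧ ((partitionCount (11 * n + 3) : ℤ) ≥ 11 * crankCount 1 (11 * n + 3))
    ∧ (11 * crankCount 0 (11 * n + 4) ≥ (partitionCount (11 * n + 4) : ℤ))
    ∧ ((partitionCount (11 * n + 4) : ℤ) ≥ 11 * crankCount 1 (11 * n + 4))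
    ∧ (11 * crankCount 0 (11 * n + 5) ≥ (partitionCount (11 * n + 5) : ℤ))
    ∧ ((partitionCount (11 * n + 5) : ℤ) ≥ 11 * crankCount 2 (11 * n + 5))
    ∧ (11 * crankCount 1 (11 * n + 7) ≥ (partitionCount (11 * n + 7) : ℤ))
    ∧ ((partitionCount (11 * n + 7) : ℤ) ≥ 11 * crankCount 0 (11 * n + 7))
    ∧ (11 * crankCount 1 (11 * n + 9) ≥ (partitionCount (11 * n + 9) : ℤ))
    ∧ ((partitionCount (11 * n + 9) : ℤ) ≥ 11 * crankCount 0 (11 * n + 9))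
    ∧ (11 * crankCount 0 (11 * n + 10) ≥ (partitionCount (11 * n + 10) : ℤ))
    ∧ ((partitionCount (11 * n + 10) : ℤ) ≥ 11 * crankCount 3 (11 * n + 10)) := by
  obtain ⟨τ, hτ, h⟩ := exists_crankCount_eq
  have key (r b : ℕ) (hr : r < 11) (hb : b < 11) :
      11 * (crankCount b (11 * n + r) : ℝ) - partitionCount (11 * n + r) =
        τ r n * ((11 * (crankClassCoeffs r).getD b 0 -
          ∑ a ∈ Finset.range 11, (crankClassCoeffs r).getD a 0 : ℤ) : ℝ) := by
    have h1 := h (11 * n + r) b hb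
    rw [show (11 * n + r) % 11 = r by omega, show (11 * n + r) / 11 = n by omega] at h1
    rw [h1]
    push_cast
    rfl
  have hge (r b : ℕ) (hr : r < 11) (hr8 : r ≠ 8) (hb : b < 11)
      (hc : 0 ≤ 11 * (crankClassCoeffs r).getD b 0 -
        ∑ a ∈ Finset.range 11, (crankClassCoeffs r).getD a 0) :
      11 * crankCount b (11 * n + r) ≥ (partitionCount (11 * n + r) : ℤ) := by
    have h1 := key r b hr hb
    have h2 := mul_nonneg (hτ r hr8 n) (Int.cast_nonneg (R := ℝ) hc)
    rw [← h1, sub_nonneg] at h2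
    exact_mod_cast h2
  have hle (r b : ℕ) (hr : r < 11) (hr8 : r ≠ 8) (hb : b < 11)
      (hc : 11 * (crankClassCoeffs r).getD b 0 -
        ∑ a ∈ Finset.range 11, (crankClassCoeffs r).getD a 0 ≤ 0) :
      (partitionCount (11 * n + r) : ℤ) ≥ 11 * crankCount b (11 * n + r) := by
    have h1 := key r b hr hb
    have h2 := mul_nonpos_of_nonneg_of_nonpos (hτ r hr8 n) (Int.cast_nonpos (R := ℝ).2 hc)
    rw [← h1, sub_nonpos] at h2
    exact_mod_cast h2
  have hmono : 11 * crankCount 2 (11 * n + 1) ≥ 11 * crankCount 0 (11 * n + 1) := by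
    have h1 := key 1 2 (by norm_num) (by norm_num)
    have h2 := key 1 0 (by norm_num) (by norm_num)
    have h3 : (11 * (crankClassCoeffs 1).getD 0 0 -
        ∑ a ∈ Finset.range 11, (crankClassCoeffs 1).getD a 0 : ℤ) ≤
        11 * (crankClassCoeffs 1).getD 2 0 -
        ∑ a ∈ Finset.range 11, (crankClassCoeffs 1).getD a 0 := by decide
    have h4 := mul_le_mul_of_nonneg_left (Int.cast_le (R := ℝ).2 h3) (hτ 1 (by norm_num) n)
    rw [← h1, ← h2, sub_le_sub_iff_right] at h4
    exact_mod_cast h4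
  exact ⟨hge 0 0 (by norm_num) (by norm_num) (by norm_num) (by decide),
    hle 0 1 (by norm_num) (by norm_num) (by norm_num) (by decide),
    hge 1 1 (by norm_num) (by norm_num) (by norm_num) (by decide),
    hle 1 2 (by norm_num) (by norm_num) (by norm_num) (by decide),
    hmono,
    hge 2 2 (by norm_num) (by norm_num) (by norm_num) (by decide),
    hle 2 0 (by norm_num) (by norm_num) (by norm_num) (by decide),
    hge 3 0 (by norm_num) (by norm_num) (by norm_num) (by decide),
    hle 3 1 (by norm_num) (by norm_num) (by norm_num) (by decide),
    hge 4 0 (by norm_num) (by norm_num) (by norm_num) (by decide),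
    hle 4 1 (by norm_num) (by norm_num) (by norm_num) (by decide),
    hge 5 0 (by norm_num) (by norm_num) (by norm_num) (by decide),
    hle 5 2 (by norm_num) (by norm_num) (by norm_num) (by decide),
    hge 7 1 (by norm_num) (by norm_num) (by norm_num) (by decide),
    hle 7 0 (by norm_num) (by norm_num) (by norm_num) (by decide),
    hge 9 1 (by norm_num) (by norm_num) (by norm_num) (by decide),
    hle 9 0 (by norm_num) (by norm_num) (by norm_num) (by decide),
    hge 10 0 (by norm_num) (by norm_num) (by norm_num) (by decide),
    hle 10 3 (by norm_num) (by norm_num) (by norm_num) (by decide)⟩
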